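/- Let N(T) denote the number of zeros ρ = β + iγ of Riemann's auxiliary function R with 0 < γ ≤ T, counted with multiplicity, and let N_ζ(T) denote the number of zeros ρ of the Riemann zeta function with 0 < Im ρ ≤ T, counted with multiplicity. Then N(T) = (1/2) N_ζ(T) + o(T) as T → +∞; that is, for every ε > 0 there exists T₀ such that for all T ≥ T₀, |N(T) − (1/2) N_ζ(T)| ≤ ε T. -/

import Mathlib

open MeasureTheory

/-- The straight line of slope 1 crossing the real axis at `1/2`,
parametrized from upper right to lower left. -/
noncomputable def rline (u : ℝ) : ℂ :=
  1 / 2 - Complex.exp (Real.pi * Complex.I / 4) * (u : ℂ)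

/-- Riemann's auxiliary function
`R(s) = ∫_{0↙1} x^{-s} e^{πix²}/(e^{πix} − e^{-πix}) dx`, written out as an
integral over the real parameter of the line `0↙1`. Here `z ^ (-s)` is the
principal power `exp (−s Log z)`. -/
noncomputable def RiemannR (s : ℂ) : ℂ :=
  -Complex.exp (Real.pi * Complex.I / 4) *
    ∫ u : ℝ, (rline u) ^ (-s) *
      Complex.exp (Real.pi * Complex.I * (rline u) ^ 2) /
      (Complex.exp (Real.pi * Complex.I * rline u) -
        Complex.exp (-(Real.pi * Complex.I * rline u)))

namespace RZ
open Filter Topology Set Complex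

/-- Shifting the line of integration in a horizontal strip. -/
theorem strip_shift {G : ℂ → ℂ} {a b : ℝ} (hab : a ≤ b)
    (hc : ContinuousOn G {z | a ≤ z.im ∧ z.im ≤ b})
    (hd : DifferentiableOn ℂ G {z | a < z.im ∧ z.im < b})
    (g : ℝ → ℝ) (hg1 : Tendsto g atTop (𝓝 0)) (hg2 : Tendsto g atBot (𝓝 0))
    (hb1 : ∀ᶠ u : ℝ in atTop, ∀ v ∈ Icc a b, ‖G (u + v * I)‖ ≤ g u)
    (hb2 : ∀ᶠ u : ℝ in atBot, ∀ v ∈ Icc a b, ‖G (u + v * I)‖ ≤ g u)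
    (ia : Integrable fun u : ℝ => G (u + a * I))
    (ib : Integrable fun u : ℝ => G (u + b * I)) :
    ∫ u : ℝ, G (u + a * I) = ∫ u : ℝ, G (u + b * I) := by
  have la := intervalIntegral_tendsto_integral ia tendsto_neg_atTop_atBot tendsto_id
  have lb := intervalIntegral_tendsto_integral ib tendsto_neg_atTop_atBot tendsto_id
  have v1 : Tendsto (fun L : ℝ => ∫ y : ℝ in a..b, G ((L : ℝ) + y * I)) atTop (𝓝 0) := by
    rw [tendsto_zero_iff_norm_tendsto_zero]
    refine squeeze_zero' (Eventually.of_forall fun _ => norm_nonneg _) ?_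
      (g := fun L => g L * |b - a|) (by simpa using hg1.mul_const |b - a|)
    filter_upwards [hb1] with L hL
    apply intervalIntegral.norm_integral_le_of_norm_le_const
    intro y hy
    rw [uIoc_of_le hab] at hy
    exact hL y ⟨hy.1.le, hy.2⟩
  have v2 : Tendsto (fun L : ℝ => ∫ y : ℝ in a..b, G (((-L : ℝ) : ℂ) + y * I)) atTop (𝓝 0) := by
    rw [tendsto_zero_iff_norm_tendsto_zero]
    refine squeeze_zero' (Eventually.of_forall fun _ => norm_nonneg _) ?_
      (g := fun L => g (-L) * |b - a|)
      (by simpa using (hg2.comp tendsto_neg_atTop_atBot).mul_const |b - a|)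
    filter_upwards [tendsto_neg_atTop_atBot.eventually hb2] with L hL
    apply intervalIntegral.norm_integral_le_of_norm_le_const
    intro y hy
    rw [uIoc_of_le hab] at hy
    exact hL y ⟨hy.1.le, hy.2⟩
  have key : ∀ L : ℝ, (∫ x : ℝ in (-L)..L, G (x + a * I)) - (∫ x : ℝ in (-L)..L, G (x + b * I))
      + I • (∫ y : ℝ in a..b, G ((L : ℝ) + y * I))
      - I • (∫ y : ℝ in a..b, G (((-L : ℝ) : ℂ) + y * I)) = 0 := by
    intro L
    have := Complex.integral_boundary_rect_eq_zero_of_continuousOn_of_differentiableOn G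
      (⟨-L, a⟩ : ℂ) (⟨L, b⟩ : ℂ) ?_ ?_
    · simpa using this
    · refine hc.mono ?_
      intro z hz
      rw [mem_reProdIm] at hz
      have := hz.2
      simp only [uIcc_of_le hab] at this
      exact this
    · refine hd.mono ?_
      intro z hz
      rw [mem_reProdIm] at hz
      have := hz.2
      simp only [min_eq_left hab, max_eq_right hab] at this
      exact this
  have lim := (((la.sub lb).add (v1.const_smul I)).sub (v2.const_smul I))
  have : Tendsto (fun _ : ℝ => (0 : ℂ)) atTop (𝓝 ((∫ u : ℝ, G (u + a * I)) -
      (∫ u : ℝ, G (u + b * I)) + I • (0 : ℂ) - I • (0 : ℂ))) := by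
    refine lim.congr fun L => ?_
    exact key L
  have h0 := tendsto_nhds_unique this tendsto_const_nhds
  simp only [smul_zero, add_zero, sub_zero] at h0
  exact sub_eq_zero.mp h0

end RZ

namespace RZ
open Filter Topology Set Complex

/-- `e^{iπ/4}` -/
noncomputable def e0 : ℂ := Complex.exp (Real.pi * Complex.I / 4)

theorem e0_eq : e0 = ((√2/2 : ℝ) : ℂ) + ((√2/2 : ℝ) : ℂ) * I := by
  have : (Real.pi * Complex.I / 4 : ℂ) = ((Real.pi/4 : ℝ) : ℂ) * I := by push_cast; ring
  rw [e0, this, Complex.exp_mul_I, ← Complex.ofReal_cos, ← Complex.ofReal_sin,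
    Real.cos_pi_div_four, Real.sin_pi_div_four]

theorem e0_re : e0.re = √2/2 := by rw [e0_eq]; simp
theorem e0_im : e0.im = √2/2 := by rw [e0_eq]; simp
theorem e0_sq : e0^2 = I := by
  rw [e0, ← Complex.exp_nat_mul]
  rw [show ((2:ℕ):ℂ) * (Real.pi * Complex.I / 4) = Real.pi/2 * I by push_cast; ring, Complex.exp_pi_div_two_mul_I]
theorem e0_ne : e0 ≠ 0 := Complex.exp_ne_zero _
theorem norm_e0 : ‖e0‖ = 1 := by
  have : (Real.pi * Complex.I / 4 : ℂ) = ((Real.pi/4 : ℝ) : ℂ) * I := by push_cast; ring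
  rw [e0, this, Complex.norm_exp_ofReal_mul_I]

theorem sqrt2_sq : √2 * √2 = (2:ℝ) := Real.mul_self_sqrt (by norm_num)

theorem line_re (A u : ℝ) : ((A:ℂ) + e0 * u).re = A + √2/2*u := by
  simp [e0_re]
theorem line_im (A u : ℝ) : ((A:ℂ) + e0 * u).im = √2/2*u := by
  simp [e0_im]

noncomputable def J (A : ℝ) (F : ℂ → ℂ) : ℂ := ∫ u : ℝ, F (A + e0 * u)

theorem integrable_of_gauss_tail {f : ℝ → ℂ} (hf : Continuous f) (C M : ℝ)
    (hb : ∀ u, M ≤ |u| → ‖f u‖ ≤ C * Real.exp (-(u^2/2))) : Integrable f := by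
  refine hf.locallyIntegrable.integrable_of_isBigO_cocompact (g := fun u => Real.exp (-(1/2)*u^2)) ?_
    ((integrable_exp_neg_mul_sq (b := 1/2) (by norm_num)).integrableAtFilter _)
  refine Asymptotics.IsBigO.of_bound C ?_
  have : ∀ᶠ u : ℝ in cocompact ℝ, M ≤ ‖u‖ := (tendsto_norm_cocompact_atTop).eventually_ge_atTop M
  filter_upwards [this] with u hu
  have := hb u hu
  rw [Real.norm_of_nonneg (Real.exp_pos _).le]
  convert this using 3
  ring

theorem gauss_to_zero (C V : ℝ) : Tendsto (fun u : ℝ => C * Real.exp (-((u-V)^2/2))) atTop (𝓝 0) := by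
  have h1 : Tendsto (fun u : ℝ => (u-V)^2/2) atTop atTop := by
    refine Tendsto.atTop_div_const (by norm_num) ?_
    refine (tendsto_pow_atTop (by norm_num)).comp ?_
    exact tendsto_atTop_add_const_right _ _ tendsto_id
  have h2 := Real.tendsto_exp_neg_atTop_nhds_zero.comp h1
  simpa using h2.const_mul C

theorem line_shift {F : ℂ → ℂ} {A B : ℝ} (hAB : A ≤ B)
    (hc : ContinuousOn F {x | A ≤ x.re - x.im ∧ x.re - x.im ≤ B})
    (hd : DifferentiableOn ℂ F {x | A < x.re - x.im ∧ x.re - x.im < B})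
    (C M : ℝ) (hb : ∀ x : ℂ, A ≤ x.re - x.im → x.re - x.im ≤ B → M ≤ |x.im| →
      ‖F x‖ ≤ C * Real.exp (-(x.im)^2)) :
    J A F = J B F ∧ Integrable (fun u : ℝ => F (A + e0 * u)) ∧
      Integrable (fun u : ℝ => F (B + e0 * u)) := by
  have s2 := sqrt2_sq
  have s2p : 0 < √2 := by positivity
  have s2l : √2 ≤ 2 := by nlinarith
  have s2g : 1 ≤ √2 := by nlinarith
  have hintg : ∀ D, A ≤ D → D ≤ B → Integrable (fun u : ℝ => F (D + e0 * u)) := by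
    intro D h1 h2
    have hm : ∀ u : ℝ, ((D:ℂ) + e0 * u).re - ((D:ℂ) + e0 * u).im = D := by
      intro u; rw [line_re, line_im]; ring
    refine integrable_of_gauss_tail ?_ C (2 * |M|) ?_
    · refine hc.comp_continuous (by fun_prop) ?_
      intro u; simp only [mem_ofPred_eq, hm]; exact ⟨h1, h2⟩
    · intro u hu
      have := hb (D + e0 * u) (by rw [hm]; exact h1) (by rw [hm]; exact h2) (by
        rw [line_im, abs_mul, abs_of_pos (by positivity)]
        nlinarith [le_abs_self M, abs_nonneg M, abs_nonneg u])
      refine this.trans (le_of_eq ?_)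
      rw [line_im]; congr 2; rw [mul_pow, div_pow, sq (√2), s2]; ring
  refine ⟨?_, hintg A le_rfl hAB, hintg B hAB le_rfl⟩
  set G : ℂ → ℂ := fun w => F (e0 * w) with hG
  have hre : ∀ w : ℂ, (e0 * w).re - (e0*w).im = -√2 * w.im := by
    intro w; simp [e0_re, e0_im]; ring
  have him : ∀ w : ℂ, (e0 * w).im = √2/2*(w.re + w.im) := by
    intro w; simp [e0_im, e0_re]; ring
  have hJ : ∀ D : ℝ, J D F = ∫ u : ℝ, G (u + ((-D/√2 : ℝ):ℂ) * I) := by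
    intro D
    rw [J, ← integral_add_right_eq_self (μ := volume) (fun u : ℝ => G (u + ((-D/√2 : ℝ):ℂ) * I)) (D/√2)]
    congr 1; ext u
    simp only [hG]
    congr 1
    apply Complex.ext
    · rw [line_re]; simp [e0_re, e0_im]; field_simp; nlinarith
    · rw [line_im]; simp [e0_re, e0_im]; field_simp; ring
  have hlineint : ∀ D : ℝ, A ≤ D → D ≤ B → Integrable (fun u : ℝ => G (u + ((-D/√2 : ℝ):ℂ) * I)) := by
    intro D h1 h2
    have := (hintg D h1 h2).comp_add_right (-(D/√2))
    refine this.congr (Eventually.of_forall fun u => ?_)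
    simp only [hG]
    congr 1
    apply Complex.ext
    · rw [line_re]; simp [e0_re, e0_im]; field_simp; nlinarith
    · rw [line_im]; simp [e0_re, e0_im]; field_simp; ring
  rw [hJ, hJ]
  symm
  have hv : ∀ w : ℂ, -B/√2 ≤ w.im → w.im ≤ -A/√2 → A ≤ (e0 * w).re - (e0*w).im ∧ (e0 * w).re - (e0*w).im ≤ B := by
    intro w h1 h2
    rw [hre]
    rw [div_le_iff₀ s2p] at h1
    rw [le_div_iff₀ s2p] at h2
    constructor <;> nlinarith
  have hv' : ∀ w : ℂ, -B/√2 < w.im → w.im < -A/√2 → A < (e0 * w).re - (e0*w).im ∧ (e0 * w).re - (e0*w).im < B := by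
    intro w h1 h2
    rw [hre]
    rw [div_lt_iff₀ s2p] at h1
    rw [lt_div_iff₀ s2p] at h2
    constructor <;> nlinarith
  obtain ⟨V, hV0, hV⟩ : ∃ V : ℝ, 0 ≤ V ∧ ∀ v ∈ Icc (-B/√2) (-A/√2), |v| ≤ V := by
    refine ⟨max |-B/√2| |-A/√2|, by positivity, fun v hv => ?_⟩
    exact abs_le_max_abs_abs hv.1 hv.2
  have key : ∀ u : ℝ, 2*|M| + V ≤ |u| → ∀ v ∈ Icc (-B/√2) (-A/√2), ‖G (u + v * I)‖ ≤ |C| * Real.exp (-((|u| - V)^2/2)) := by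
    intro u hu v hvv
    have h1 := hv (u + v*I) (by simpa using hvv.1) (by simpa using hvv.2)
    have h3 := hV v hvv
    have hle : |u| - V ≤ |u + v| := by
      have := abs_sub_abs_le_abs_sub u (-v)
      rw [abs_neg, sub_neg_eq_add] at this
      linarith
    have him' : (e0 * (u + v*I)).im = √2/2*(u+v) := by rw [him]; simp
    have hM : M ≤ |(e0 * (u + v*I)).im| := by
      rw [him', abs_mul, abs_of_pos (by positivity)]
      nlinarith [le_abs_self M, abs_nonneg M, abs_nonneg u]
    refine (hb _ h1.1 h1.2 hM).trans ?_
    refine mul_le_mul (le_abs_self C) ?_ (Real.exp_pos _).le (abs_nonneg C)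
    apply Real.exp_le_exp.mpr
    rw [him', mul_pow, div_pow, sq (√2), s2]
    have : (|u| - V)^2 ≤ (u+v)^2 := by
      rw [← sq_abs (u+v)]
      exact pow_le_pow_left₀ (by nlinarith [abs_nonneg M]) hle 2
    linarith
  refine strip_shift (by gcongr) ?_ ?_ (fun u => |C| * Real.exp (-((|u| - V)^2/2))) ?_ ?_ ?_ ?_ (hlineint B hAB le_rfl) (hlineint A le_rfl hAB)
  · exact hc.comp (by fun_prop) (fun w hw => hv w hw.1 hw.2)
  · exact hd.comp (by fun_prop) (fun w hw => hv' w hw.1 hw.2)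
  · refine (gauss_to_zero |C| V).congr' ?_
    filter_upwards [eventually_ge_atTop 0] with u hu
    rw [abs_of_nonneg hu]
  · refine ((gauss_to_zero |C| V).comp tendsto_neg_atBot_atTop).congr' ?_
    filter_upwards [eventually_le_atBot 0] with u hu
    simp [abs_of_nonpos hu]
  · filter_upwards [eventually_ge_atTop (2*|M| + V)] with u hu
    exact key u (hu.trans (le_abs_self u))
  · filter_upwards [eventually_le_atBot (-(2*|M| + V))] with u hu
    exact key u ((by linarith : 2*|M| + V ≤ -u).trans (neg_le_abs u))

end RZ

namespace RZ
open Filter Topology Set Complex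

noncomputable def kden (x : ℂ) : ℂ := Complex.exp (Real.pi * I * x) - Complex.exp (-(Real.pi * I * x))
noncomputable def kf (x : ℂ) : ℂ := Complex.exp (Real.pi * I * x^2) / kden x
noncomputable def Fs (s x : ℂ) : ℂ := x ^ (-s) * kf x

theorem norm_gauss (x : ℂ) : ‖Complex.exp (Real.pi * I * x^2)‖ = Real.exp (-(2 * Real.pi * x.re * x.im)) := by
  rw [Complex.norm_exp]; congr 1
  simp [sq]; ring

theorem kden_eq (x : ℂ) : kden x = 2 * I * Complex.sin (Real.pi * x) := by
  rw [kden, Complex.sin]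
  have h1 : -(Real.pi * x : ℂ) * I = -(Real.pi * I * x) := by ring
  have h2 : (Real.pi * x : ℂ) * I = (Real.pi * I * x) := by ring
  rw [h1, h2]
  linear_combination (-(Complex.exp (-(Real.pi * I * x)) - Complex.exp (Real.pi * I * x))) * I_sq

theorem normSq_kden (x : ℂ) : ‖kden x‖^2 = 4 * (Real.sin (Real.pi * x.re)^2 + Real.sinh (Real.pi * x.im)^2) := by
  rw [kden_eq, ← Complex.normSq_eq_norm_sq]
  have : (Real.pi * x : ℂ) = ((Real.pi * x.re : ℝ) : ℂ) + ((Real.pi * x.im : ℝ) : ℂ) * I := by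
    apply Complex.ext <;> simp
  rw [this, Complex.sin_add_mul_I, ← ofReal_sin, ← ofReal_cos, ← ofReal_sinh, ← ofReal_cosh]
  simp only [map_mul, normSq_I, ← ofReal_mul, normSq_add_mul_I]
  have h1 := Real.sin_sq_add_cos_sq (Real.pi * x.re)
  have h2 := Real.cosh_sq (Real.pi * x.im)
  have h3 : (normSq 2) = 4 := by rw [show (2:ℂ) = ((2:ℝ):ℂ) by norm_num, normSq_ofReal]; norm_num
  rw [h3, mul_pow, mul_pow, h2]
  linear_combination 4 * Real.sinh (Real.pi * x.im)^2 * h1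

theorem abs_le_abs_sinh (y : ℝ) : |y| ≤ |Real.sinh y| := by
  rcases le_total 0 y with h | h
  · rw [abs_of_nonneg h, abs_of_nonneg (Real.sinh_nonneg_iff.mpr h)]; exact Real.self_le_sinh_iff.mpr h
  · rw [abs_of_nonpos h, abs_of_nonpos (Real.sinh_nonpos_iff.mpr h)]; linarith [Real.sinh_le_self_iff.mpr h]

theorem kden_tail {x : ℂ} (h : 1 ≤ |x.im|) : 1 ≤ ‖kden x‖ := by
  have h1 := normSq_kden x
  have h2 := abs_le_abs_sinh (Real.pi * x.im)
  have h3 : 1 ≤ |Real.sinh (Real.pi * x.im)| := by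
    refine le_trans ?_ h2
    rw [abs_mul, abs_of_pos Real.pi_pos]
    nlinarith [Real.pi_gt_three]
  have h4 : 1 ≤ Real.sinh (Real.pi * x.im)^2 := by rw [← sq_abs]; nlinarith
  nlinarith [sq_nonneg (Real.sin (Real.pi * x.re)), norm_nonneg (kden x)]

theorem kden_half {x : ℂ} (n : ℤ) (h : x.re - x.im = n + 1/2) : 2 ≤ ‖kden x‖ := by
  have h1 := normSq_kden x
  have e1 : Real.pi * x.re = (Real.pi * x.im + Real.pi/2) + n * Real.pi := by
    have : x.re = x.im + n + 1/2 := by linarith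
    rw [this]; ring
  have h2 : Real.sin (Real.pi * x.re)^2 = Real.cos (Real.pi * x.im)^2 := by
    rw [e1, Real.sin_add_int_mul_pi, Real.sin_add_pi_div_two, mul_pow]
    rcases Int.even_or_odd n with h | h
    · rw [h.neg_one_zpow]; ring
    · rw [h.neg_one_zpow]; ring
  have h3 : Real.sin (Real.pi * x.im)^2 ≤ Real.sinh (Real.pi * x.im)^2 := by
    apply sq_le_sq.mpr
    exact (Real.abs_sin_le_abs).trans (abs_le_abs_sinh _)
  have h4 := Real.sin_sq_add_cos_sq (Real.pi * x.im)
  nlinarith [norm_nonneg (kden x)]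

theorem kden_eq_zero {x : ℂ} (h : kden x = 0) : x.im = 0 ∧ Real.sin (Real.pi * x.re) = 0 := by
  have h1 := normSq_kden x
  rw [h, norm_zero] at h1
  have h2 : Real.sinh (Real.pi * x.im) = 0 := by nlinarith [sq_nonneg (Real.sin (Real.pi * x.re)), sq_nonneg (Real.sinh (Real.pi * x.im))]
  have h3 : Real.sin (Real.pi * x.re) = 0 := by nlinarith [sq_nonneg (Real.sin (Real.pi * x.re)), sq_nonneg (Real.sinh (Real.pi * x.im))]
  rw [Real.sinh_eq_zero] at h2
  exact ⟨by simpa [Real.pi_ne_zero] using h2, h3⟩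

theorem kden_diff : Differentiable ℂ kden := by unfold kden; fun_prop

theorem norm_cpow_neg_le {x s : ℂ} (hx : x ≠ 0) : ‖x ^ (-s)‖ ≤ ‖x‖ ^ (-s.re) * Real.exp (Real.pi * |s.im|) := by
  rw [Complex.norm_cpow_of_ne_zero hx, neg_re, neg_im, div_eq_mul_inv, ← Real.exp_neg]
  gcongr
  have := Complex.abs_arg_le_pi x
  calc -(x.arg * -s.im) ≤ |x.arg * s.im| := by rw [mul_neg, neg_neg]; exact le_abs_self _
    _ = |x.arg| * |s.im| := abs_mul _ _
    _ ≤ _ := by gcongr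

theorem rpow_bound {a y K σ : ℝ} (ha : 1 ≤ a) (hK : 1 ≤ K) (hy : a⁻¹ ≤ y) (hy2 : y ≤ a) (hσ : |σ| ≤ K) :
    y ^ (-σ) ≤ Real.exp (K * Real.log K + a) := by
  have ha0 : 0 < a := by linarith
  have hy0 : 0 < y := lt_of_lt_of_le (by positivity) hy
  have hK0 : 0 < K := by linarith
  have l1 : |Real.log y| ≤ Real.log a := by
    rw [abs_le]; constructor
    · rw [← Real.log_inv]; exact Real.log_le_log (by positivity) hy
    · exact Real.log_le_log hy0 hy2
  have l2 : Real.log a ≤ Real.log K + a / K := by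
    have : Real.log (a/K) ≤ a/K - 1 := Real.log_le_sub_one_of_pos (by positivity)
    rw [Real.log_div (by positivity) (by positivity)] at this
    linarith
  rw [Real.rpow_def_of_pos hy0]
  apply Real.exp_le_exp.mpr
  calc Real.log y * -σ ≤ |Real.log y * -σ| := le_abs_self _
    _ = |Real.log y| * |σ| := by rw [abs_mul, abs_neg]
    _ ≤ Real.log a * K := by gcongr; exact Real.log_nonneg ha
    _ ≤ (Real.log K + a/K) * K := by gcongr
    _ = _ := by field_simp

/-- uniform tail bound of the integrand -/
theorem tail_bound (D K : ℝ) (hD : 1 ≤ D) (hK : 1 ≤ K) : ∃ C : ℝ, 0 ≤ C ∧ ∀ s x : ℂ, ‖s‖ ≤ K → |x.re - x.im| ≤ D →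
    1 ≤ |x.im| → ‖x ^ (-s)‖ * ‖Complex.exp (Real.pi * I * x^2)‖ ≤ C * Real.exp (-(x.im)^2) := by
  refine ⟨Real.exp (K * Real.log K + D + Real.pi * K + (2*Real.pi*D+2)^2), (Real.exp_pos _).le, ?_⟩
  intro s x hs hx him
  have hx0 : x ≠ 0 := by rintro rfl; simp at him; linarith
  have hre := abs_le.mp hx
  have hn1 : |x.im| ≤ ‖x‖ := abs_im_le_norm x
  have hn2 : ‖x‖ ≤ D + 2 * |x.im| := by
    have := Complex.norm_le_abs_re_add_abs_im x
    have : |x.re| ≤ D + |x.im| := by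
      calc |x.re| = |(x.re - x.im) + x.im| := by congr 1; ring
        _ ≤ _ := (abs_add_le _ _).trans (by linarith)
    linarith
  have h1 := norm_cpow_neg_le (s := s) hx0
  have h2 := rpow_bound (a := D + 2 * |x.im|) (y := ‖x‖) (K := K) (σ := s.re) (by linarith) hK
    (le_trans (inv_le_one_of_one_le₀ (by linarith)) (him.trans hn1)) hn2 ((abs_re_le_norm s).trans hs)
  rw [norm_gauss]
  have h3 : |s.im| ≤ K := (abs_im_le_norm s).trans hs
  calc _ ≤ (Real.exp (K * Real.log K + (D + 2 * |x.im|)) * Real.exp (Real.pi * K)) * Real.exp (-(2 * Real.pi * x.re * x.im)) := by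
        gcongr
        refine h1.trans ?_
        gcongr
    _ ≤ _ := by
        rw [← Real.exp_add, ← Real.exp_add, ← Real.exp_add]
        apply Real.exp_le_exp.mpr
        have e1 : x.re * x.im ≥ x.im^2 - D * |x.im| := by
          have : (x.re - x.im) * x.im ≥ -(D * |x.im|) := by
            have : |(x.re - x.im) * x.im| ≤ D * |x.im| := by rw [abs_mul]; gcongr
            exact (abs_le.mp this).1
          nlinarith
        have hpi := Real.pi_gt_three
        have e2 : 2 * Real.pi * x.re * x.im ≥ 2 * Real.pi * (x.im^2 - D * |x.im|) := by nlinarith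
        have e3 : |x.im|^2 = x.im^2 := sq_abs _
        set y := |x.im|
        rw [← e3]; rw [← e3] at e2
        nlinarith [sq_nonneg ((2*Real.pi*D+2) - y/2), sq_nonneg y]

theorem Fs_cont {s : ℂ} {S : Set ℂ} (h1 : ∀ x ∈ S, x ∈ slitPlane) (h2 : ∀ x ∈ S, kden x ≠ 0) : DifferentiableOn ℂ (Fs s) S := by
  intro x hx
  apply DifferentiableAt.differentiableWithinAt
  unfold Fs kf
  refine DifferentiableAt.mul ?_ (DifferentiableAt.div (by fun_prop) (kden_diff x) (h2 x hx))
  exact DifferentiableAt.cpow_const differentiableAt_id (h1 x hx)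

theorem line_slit {x : ℂ} (h : 0 < x.re - x.im) : x ∈ slitPlane := by
  rw [mem_slitPlane_iff]
  by_cases h0 : x.im = 0
  · left; rw [h0] at h; linarith
  · right; exact h0

theorem Fs_line_integrable (s : ℂ) (n : ℕ) : Integrable (fun u : ℝ => Fs s (((n:ℝ) + 1/2 : ℝ) + e0 * u)) := by
  obtain ⟨C, hC0, hC⟩ := tail_bound (n + 1) (‖s‖+1) (by linarith [Nat.cast_nonneg (α := ℝ) n]) (by linarith [norm_nonneg s])
  have hcont : DifferentiableOn ℂ (Fs s) {x | ((n:ℝ) + 1/2 : ℝ) ≤ x.re - x.im ∧ x.re - x.im ≤ ((n:ℝ) + 1/2 : ℝ)} := by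
    apply Fs_cont
    · intro x hx; apply line_slit; exact lt_of_lt_of_le (by positivity) hx.1
    · intro x hx h0
      have := kden_half (x := x) n (by have := hx.1; have := hx.2; push_cast; linarith)
      rw [h0] at this; norm_num at this
  refine (line_shift (F := Fs s) (le_refl ((n:ℝ) + 1/2)) hcont.continuousOn (hcont.mono ?_) C 1 ?_).2.1
  · intro x hx; exact ⟨hx.1.le, hx.2.le⟩
  · intro x h1 h2 h3
    refine le_trans ?_ (hC s x (by linarith) (by rw [abs_of_nonneg] <;> linarith [Nat.cast_nonneg (α := ℝ) n]) h3)
    rw [Fs, kf, norm_mul, norm_div]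
    gcongr
    exact div_le_self (norm_nonneg _) (kden_tail h3)

theorem RiemannR_eq_J (s : ℂ) : RiemannR s = -e0 * J (1/2) (Fs s) := by
  have h : J (1/2) (Fs s) = ∫ u : ℝ, Fs s (rline u) := by
    rw [J, ← integral_neg_eq_self]
    congr 1; ext u
    congr 1
    rw [rline, e0]; push_cast; ring
  rw [h, RiemannR, e0]
  simp only [Fs, kf, kden, mul_div_assoc]

end RZ

namespace RZ
open Filter Topology Set Complex

theorem kden_deriv (x : ℂ) : HasDerivAt kden (2 * Real.pi * I * Complex.cos (Real.pi * x)) x := by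
  have : kden = fun x => 2 * I * Complex.sin (Real.pi * x) := by ext x; exact kden_eq x
  rw [this]
  have h := ((Complex.hasDerivAt_sin (Real.pi * x)).comp x ((hasDerivAt_id x).const_mul (Real.pi:ℂ))).const_mul (2 * I)
  refine h.congr_deriv ?_
  simp only [mul_one]; ring

theorem kden_nat (n : ℕ) : kden n = 0 := by
  rw [kden_eq, mul_comm (Real.pi : ℂ), Complex.sin_nat_mul_pi]; simp

theorem norm_kden_add_one (x : ℂ) : kden (x+1) = - kden x := by
  rw [kden_eq, kden_eq, mul_add, mul_one, Complex.sin_add_pi]; ring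

theorem kf_shift (x : ℂ) (hx : kden x ≠ 0) : kf (x+1) - kf x = Complex.exp (Real.pi * I * (x^2+x)) := by
  rw [kf, kf, norm_kden_add_one]
  have h1 : Complex.exp (Real.pi * I * (x+1)^2) = - (Complex.exp (Real.pi * I * x^2) * Complex.exp (2 * (Real.pi * I * x))) := by
    rw [← Complex.exp_add, show Real.pi * I * (x+1)^2 = (Real.pi * I * x^2 + 2 * (Real.pi * I * x)) + Real.pi * I by ring, Complex.exp_add_pi_mul_I]
  have h3 : Complex.exp (Real.pi * I * x) * Complex.exp (-(Real.pi * I * x)) = 1 := by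
    rw [← Complex.exp_add, add_neg_cancel, Complex.exp_zero]
  have h4 : Complex.exp (2 * (Real.pi * I * x)) = Complex.exp (Real.pi * I * x)^2 := by
    rw [← Complex.exp_nat_mul]; norm_num
  rw [h1, neg_div_neg_eq, ← sub_div, div_eq_iff hx, mul_add, Complex.exp_add, kden, h4]
  linear_combination Complex.exp (Real.pi * I * x^2) * h3

theorem Fs_zero (x : ℂ) : Fs 0 x = kf x := by simp [Fs]

theorem half_line (n : ℕ) (u : ℝ) : ((((n:ℝ) + 1/2 : ℝ):ℂ) + e0 * u).re - ((((n:ℝ) + 1/2 : ℝ):ℂ) + e0 * u).im = n + 1/2 := by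
  rw [line_re, line_im]; ring

theorem kden_ne_half (n : ℕ) (u : ℝ) : kden ((((n:ℝ) + 1/2 : ℝ):ℂ) + e0 * u) ≠ 0 := by
  intro h0
  have := kden_half (n := n) (by rw [half_line n u]; simp : _ - _ = _)
  rw [h0] at this; norm_num at this

theorem J_kf_succ (n : ℕ) : e0 * (J ((n:ℝ) + 1 + 1/2) kf - J ((n:ℝ) + 1/2) kf) = 1 := by
  have i1 := Fs_line_integrable 0 (n+1)
  have i2 := Fs_line_integrable 0 n
  simp only [Fs_zero] at i1 i2
  rw [J, J, ← integral_sub (by simpa using i1) (by simpa using i2)]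
  set A : ℝ := (n:ℝ) + 1/2 with hA
  have : ∀ u : ℝ, kf ((((n:ℝ) + 1 + 1/2 : ℝ):ℂ) + e0 * u) - kf (((A : ℝ):ℂ) + e0 * u)
      = Complex.exp (-(Real.pi:ℂ) * (u:ℂ)^2 + (Real.pi * I * (2 * A + 1) * e0) * u + (Real.pi * I * (A^2 + A))) := by
    intro u
    rw [show ((((n:ℝ) + 1 + 1/2 : ℝ):ℂ) + e0 * u) = (((A : ℝ):ℂ) + e0 * u) + 1 by rw [hA]; push_cast; ring,
      kf_shift _ (by rw [hA]; exact kden_ne_half n u)]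
    congr 1
    linear_combination (Real.pi * I * u^2) * e0_sq + Real.pi * u^2 * I_sq
  simp only [this]
  rw [integral_cexp_quadratic (by simpa using Real.pi_pos)]
  have hp : (Real.pi : ℂ) ≠ 0 := by exact_mod_cast Real.pi_ne_zero
  rw [neg_neg, div_self hp, one_cpow, one_mul, e0, ← Complex.exp_add]
  rw [Complex.exp_eq_one_iff]
  refine ⟨0, ?_⟩
  rw [← e0]
  have : (Real.pi * I * (2 * A + 1) * e0)^2 = -((Real.pi:ℂ)^2 * (2 * (A:ℂ) + 1)^2 * I) := by
    linear_combination ((Real.pi:ℂ)^2 * I ^ 2 * (2 * (A:ℂ) + 1)^2) * e0_sq + ((Real.pi:ℂ)^2 *  (2 * (A:ℂ) + 1)^2 * I) * I_sq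
  rw [this]
  field_simp
  push_cast
  ring

theorem cross_pole (s : ℂ) (n : ℕ) : J ((n:ℝ) + 1/2) (Fs s) - ((n:ℂ)+1) ^ (-s) * J ((n:ℝ) + 1/2) kf =
    J ((n:ℝ) + 1 + 1/2) (Fs s) - ((n:ℂ)+1) ^ (-s) * J ((n:ℝ) + 1 + 1/2) kf := by
  set c : ℂ := (n:ℂ)+1 with hc
  have hcr : c.re = n + 1 := by simp [hc]
  have hci : c.im = 0 := by simp [hc]
  set f : ℂ → ℂ := fun x => x ^ (-s) with hf
  set U : Set ℂ := {x | (n:ℝ) + 1/4 < x.re - x.im ∧ x.re - x.im < n + 1 + 3/4} with hU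
  have hUo : IsOpen U := by
    have hcn : Continuous (fun x : ℂ => x.re - x.im) := by fun_prop
    exact (isOpen_lt continuous_const hcn).inter (isOpen_lt hcn continuous_const)
  have hn0 : (0:ℝ) ≤ n := Nat.cast_nonneg n
  have hcU : c ∈ U := by
    simp only [hU, mem_ofPred_eq, hcr, hci]; constructor <;> linarith
  have hUn : U ∈ 𝓝 c := hUo.mem_nhds hcU
  have hfd : DifferentiableOn ℂ f U := fun x hx =>
    (DifferentiableAt.cpow_const differentiableAt_id (line_slit (x := x) (by have := hx.1; linarith))).differentiableWithinAt
  have hd1 : DifferentiableOn ℂ (dslope f c) U := (Complex.differentiableOn_dslope hUn).mpr hfd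
  have hd2 : DifferentiableOn ℂ (dslope kden c) U := (Complex.differentiableOn_dslope hUn).mpr kden_diff.differentiableOn
  have hkc : kden c = 0 := by have := kden_nat (n+1); push_cast at this; exact this
  have hne : ∀ x ∈ U, dslope kden c x ≠ 0 := by
    intro x hx
    by_cases hxc : x = c
    · rw [hxc, dslope_same, (kden_deriv c).deriv]
      have h1 : Complex.cos (Real.pi * c) ≠ 0 := by
        have h2 : Complex.sin (Real.pi * c) = 0 := by
          have := hkc; rw [kden_eq] at this; simpa using this
        intro h3
        have := Complex.sin_sq_add_cos_sq (Real.pi * c)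
        rw [h2, h3] at this; norm_num at this
      have hp : (Real.pi : ℂ) ≠ 0 := by exact_mod_cast Real.pi_ne_zero
      simp [h1, hp]
    · rw [dslope_of_ne _ hxc, slope_def_field, hkc, sub_zero]
      refine div_ne_zero ?_ (sub_ne_zero.mpr hxc)
      intro h0
      obtain ⟨h1, h2⟩ := kden_eq_zero h0
      rw [Real.sin_eq_zero_iff] at h2
      obtain ⟨k, hk⟩ := h2
      have hk' : (k:ℝ) = x.re := by
        have := Real.pi_pos
        apply mul_right_cancel₀ Real.pi_ne_zero; rw [hk]; ring
      have hx1 := hx.1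
      have hx2 := hx.2
      rw [h1, ← hk'] at hx1 hx2
      have a1 : (n:ℤ) < k := by exact_mod_cast (by push_cast; linarith : ((n:ℤ):ℝ) < k)
      have a2 : k < (n:ℤ) + 2 := by exact_mod_cast (by push_cast; linarith : (k:ℝ) < ((n + 2 : ℤ):ℝ))
      have a3 : k = n + 1 := by omega
      apply hxc
      apply Complex.ext
      · rw [hcr, ← hk', a3]; push_cast; ring
      · rw [h1, hci]
  set Q : ℂ → ℂ := fun x => dslope f c x * Complex.exp (Real.pi * I * x^2) / dslope kden c x with hQ
  have hQd : DifferentiableOn ℂ Q U := by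
    refine DifferentiableOn.div (hd1.mul ?_) hd2 hne
    fun_prop
  have hQe : ∀ x, x ≠ c → Q x = Fs s x - c^(-s) * kf x := by
    intro x hx
    have hxc : x - c ≠ 0 := sub_ne_zero.mpr hx
    simp only [hQ, dslope_of_ne _ hx, slope_def_field, hkc, sub_zero, Fs, kf, hf]
    by_cases hk : kden x = 0
    · simp [hk]
    · field_simp
  obtain ⟨C1, hC10, hC1⟩ := tail_bound (n + 2) (‖s‖+1) (by linarith) (by linarith [norm_nonneg s])
  have hsub : {x : ℂ | (n:ℝ) + 1/2 ≤ x.re - x.im ∧ x.re - x.im ≤ n + 1 + 1/2} ⊆ U := by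
    intro x hx; exact ⟨by linarith [hx.1], by linarith [hx.2]⟩
  have main := line_shift (F := Q) (by linarith : (n:ℝ) + 1/2 ≤ n + 1 + 1/2) (hQd.mono hsub).continuousOn
    (hQd.mono (fun x hx => hsub ⟨hx.1.le, hx.2.le⟩)) (C1 + ‖c^(-s)‖ * C1) 1 (by
      intro x h1 h2 h3
      have hxne : x ≠ c := by rintro rfl; rw [hci] at h3; simp at h3; linarith
      have hx : |x.re - x.im| ≤ n + 2 := by rw [abs_of_nonneg] <;> linarith
      have b1 := hC1 s x (by linarith) hx h3
      have b2 := hC1 0 x (by rw [norm_zero]; positivity) hx h3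
      have hkk : ‖kf x‖ ≤ ‖Complex.exp (Real.pi * I * x^2)‖ := by
        rw [kf, norm_div]; exact div_le_self (norm_nonneg _) (kden_tail h3)
      rw [hQe x hxne]
      refine (norm_sub_le _ _).trans ?_
      rw [Fs, norm_mul, norm_mul, add_mul, mul_assoc]
      refine add_le_add ?_ ?_
      · exact le_trans (by gcongr) b1
      · gcongr
        refine hkk.trans ?_
        simpa using b2)
  have hsplit : ∀ m : ℕ, J ((m:ℝ) + 1/2) Q = J ((m:ℝ) + 1/2) (Fs s) - c^(-s) * J ((m:ℝ) + 1/2) kf := by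
    intro m
    have i1 := Fs_line_integrable s m
    have i2 := Fs_line_integrable 0 m
    simp only [Fs_zero] at i2
    rw [J, J, J, ← integral_const_mul, ← integral_sub i1 (i2.const_mul _)]
    congr 1; ext u
    refine hQe _ ?_
    intro h
    have := kden_ne_half m u
    rw [h] at this; exact this hkc
  have := main.1
  rw [hsplit n] at this
  have h2 := hsplit (n+1)
  push_cast at h2
  rw [h2] at this
  exact this

theorem R_sum (s : ℂ) (N : ℕ) : RiemannR s = ∑ n ∈ Finset.range N, ((n:ℂ)+1)^(-s) - e0 * J ((N:ℝ) + 1/2) (Fs s) := by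
  induction N with
  | zero => simp [RiemannR_eq_J]
  | succ n ih =>
    rw [ih, Finset.sum_range_succ]
    push_cast
    have h1 := cross_pole s n
    have h2 := J_kf_succ n
    linear_combination (-e0) * h1 + ((n:ℂ)+1)^(-s) * h2

end RZ

namespace RZ
open Filter Topology Set Complex

/-- bound on the line through 1/2 -/
theorem half_line_bound (s : ℂ) (K u : ℝ) (hK : 1 ≤ K) (hs : ‖s‖ ≤ K) :
    ‖Fs s (((1/2:ℝ):ℂ) + e0 * u)‖ ≤ Real.exp (K * Real.log K + Real.pi * K + 3 + 6 * |u| - Real.pi * u^2) ∧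
    ‖Complex.log (((1/2:ℝ):ℂ) + e0 * u)‖ ≤ Real.exp (7 + |u|) := by
  set x : ℂ := ((1/2:ℝ):ℂ) + e0 * u with hx
  have s2 := sqrt2_sq
  have s2p : 0 < √2 := by positivity
  have s2l : √2 ≤ 3/2 := by nlinarith
  have hre : x.re = 1/2 + √2/2*u := line_re _ _
  have him : x.im = √2/2*u := line_im _ _
  have hns : ‖x‖^2 = 1/4 + √2/2*u + u^2 := by
    rw [← normSq_eq_norm_sq, normSq_apply, hre, him]; nlinarith
  have hlow : (1/3:ℝ) ≤ ‖x‖ := by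
    have : (1/3:ℝ)^2 ≤ ‖x‖^2 := by rw [hns]; nlinarith [sq_nonneg (u + √2/4)]
    exact le_of_sq_le_sq this (norm_nonneg _) 
  have hup : ‖x‖ ≤ 3 + |u| := by
    have : ‖x‖^2 ≤ (3 + |u|)^2 := by rw [hns]; nlinarith [sq_abs u, le_abs_self u, abs_nonneg u]
    exact le_of_sq_le_sq this (by positivity)
  have hx0 : x ≠ 0 := by rw [← norm_pos_iff]; linarith
  have hinv : (3 + |u|)⁻¹ ≤ ‖x‖ := by
    refine le_trans ?_ hlow
    rw [inv_le_comm₀ (by positivity) (by norm_num)]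
    norm_num
  constructor
  · have hk : 2 ≤ ‖kden x‖ := kden_half (n := 0) (by rw [hre, him]; simp)
    have h1 := norm_cpow_neg_le (s := s) hx0
    have h2 := rpow_bound (a := 3 + |u|) (y := ‖x‖) (K := K) (σ := s.re) (by linarith [abs_nonneg u]) hK hinv hup ((abs_re_le_norm s).trans hs)
    have h3 : |s.im| ≤ K := (abs_im_le_norm s).trans hs
    have h4 : ‖kf x‖ ≤ Real.exp (-(2 * Real.pi * x.re * x.im)) := by
      rw [kf, norm_div, norm_gauss]
      exact div_le_self (Real.exp_pos _).le (by linarith)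
    rw [Fs, norm_mul]
    calc _ ≤ (Real.exp (K * Real.log K + (3 + |u|)) * Real.exp (Real.pi * K)) * Real.exp (-(2 * Real.pi * x.re * x.im)) := by
          gcongr
          refine h1.trans ?_
          gcongr
      _ ≤ _ := by
        rw [← Real.exp_add, ← Real.exp_add]
        apply Real.exp_le_exp.mpr
        have : 2 * Real.pi * x.re * x.im = Real.pi * u^2 + Real.pi * (√2/2) * u := by
          rw [hre, him]; linear_combination (Real.pi * u^2/2) * s2
        rw [this]
        have h5 : - (Real.pi * (√2/2) * u) ≤ 5 * |u| := by
          have : |Real.pi * (√2/2) * u| ≤ 5 * |u| := by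
            rw [abs_mul]; gcongr; rw [abs_of_pos (by positivity)]
            nlinarith [Real.pi_lt_four, Real.pi_pos]
          linarith [neg_abs_le (Real.pi * (√2/2) * u)]
        linarith
  · have h1 : |Real.log ‖x‖| ≤ 3 + |u| := by
      rw [abs_le]; constructor
      · have := Real.log_le_log (by positivity) hinv
        rw [Real.log_inv] at this
        linarith [Real.log_le_self (by positivity : (0:ℝ) ≤ 3 + |u|)]
      · have := Real.log_le_log (by linarith) hup
        linarith [Real.log_le_self (by positivity : (0:ℝ) ≤ 3 + |u|)]
    have h2 := Complex.norm_le_abs_re_add_abs_im (Complex.log x)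
    rw [Complex.log_re, Complex.log_im] at h2
    have h3 := Complex.abs_arg_le_pi x
    have h4 := Real.add_one_le_exp (7 + |u|)
    linarith [Real.pi_lt_four]

theorem gauss_dom (a u : ℝ) : Real.exp (a + 3 + 6 * |u| - Real.pi * u^2) * Real.exp (7 + |u|) ≤ Real.exp (a + 20) * Real.exp (-1 * u^2) := by
  rw [← Real.exp_add, ← Real.exp_add]
  apply Real.exp_le_exp.mpr
  nlinarith [Real.pi_gt_three, sq_abs u, sq_nonneg (|u| - 7/4), sq_nonneg u]

theorem gauss_dom' (a u : ℝ) : Real.exp (a + 3 + 6 * |u| - Real.pi * u^2) ≤ Real.exp (a + 20) * Real.exp (-1 * u^2) := by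
  rw [← Real.exp_add]
  apply Real.exp_le_exp.mpr
  nlinarith [Real.pi_gt_three, sq_abs u, sq_nonneg (|u| - 7/4), sq_nonneg u, abs_nonneg u]

theorem R_crude : ∃ C : ℝ, ∀ s : ℂ, ∀ K : ℝ, 1 ≤ K → ‖s‖ ≤ K → ‖RiemannR s‖ ≤ Real.exp (K * Real.log K + Real.pi * K + C) := by
  set I0 := ∫ u : ℝ, Real.exp (-1 * u^2)
  have hI0 : 0 < I0 := by
    rw [show I0 = √(Real.pi/1) from integral_gaussian 1]; positivity
  refine ⟨20 + Real.log I0, fun s K hK hs => ?_⟩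
  rw [RiemannR_eq_J, norm_mul, norm_neg, norm_e0, one_mul, J]
  refine (norm_integral_le_of_norm_le (g := fun u => Real.exp (K * Real.log K + Real.pi * K + 20) * Real.exp (-1 * u^2))
    ((integrable_exp_neg_mul_sq (by norm_num)).const_mul _) (Eventually.of_forall fun u => ?_)).trans ?_
  · exact (half_line_bound s K u hK hs).1.trans (gauss_dom' _ _)
  · rw [integral_const_mul, ← add_assoc, Real.exp_add _ (Real.log I0), Real.exp_log hI0]

theorem R_diff : Differentiable ℂ RiemannR := by
  have : RiemannR = fun s => -e0 * J (1/2) (Fs s) := by ext s; exact RiemannR_eq_J s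
  rw [this]
  refine Differentiable.const_mul ?_ _
  intro s₀
  set K := ‖s₀‖ + 1
  have hK : 1 ≤ K := by simp [K]
  have hslit : ∀ u : ℝ, (((1/2:ℝ):ℂ) + e0 * u) ∈ slitPlane := fun u => line_slit (by rw [line_re, line_im]; norm_num)
  have hxcont : Continuous fun u : ℝ => (((1/2:ℝ):ℂ) + e0 * u) := by fun_prop
  have hintg : ∀ s, Integrable (fun u : ℝ => Fs s (((1/2:ℝ):ℂ) + e0 * u)) := fun s => by
    have := Fs_line_integrable s 0; simpa using this
  have hlog : Continuous fun u : ℝ => Complex.log (((1/2:ℝ):ℂ) + e0 * u) := hxcont.clog hslit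
  have := hasDerivAt_integral_of_dominated_loc_of_deriv_le (μ := (volume : Measure ℝ)) (𝕜 := ℂ)
    (F := fun s (u:ℝ) => Fs s (((1/2:ℝ):ℂ) + e0 * u))
    (F' := fun s (u:ℝ) => -Complex.log (((1/2:ℝ):ℂ) + e0 * u) * Fs s (((1/2:ℝ):ℂ) + e0 * u))
    (x₀ := s₀) (s := Metric.ball s₀ 1)
    (bound := fun u => Real.exp (K * Real.log K + Real.pi * K + 20) * Real.exp (-1 * u^2))
    (Metric.ball_mem_nhds s₀ one_pos) (Eventually.of_forall fun s => (hintg s).aestronglyMeasurable) (hintg s₀)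
    (hlog.neg.aestronglyMeasurable.mul (hintg s₀).aestronglyMeasurable) ?_ ((integrable_exp_neg_mul_sq (by norm_num)).const_mul _) ?_
  · exact this.2.differentiableAt
  · refine Eventually.of_forall fun u s hs => ?_
    have hs' : ‖s‖ ≤ K := by
      rw [mem_ball_iff_norm] at hs
      have := norm_le_norm_add_norm_sub' s s₀
      simp only [K]; linarith
    obtain ⟨h1, h2⟩ := half_line_bound s K u hK hs'
    rw [norm_mul, norm_neg, mul_comm]
    refine le_trans ?_ (gauss_dom _ u)
    gcongr
  · refine Eventually.of_forall fun u s hs => ?_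
    have hne : (((1/2:ℝ):ℂ) + e0 * u) ≠ 0 := slitPlane_ne_zero (hslit u)
    have h := ((hasDerivAt_id s).neg.const_cpow (c := (((1/2:ℝ):ℂ) + e0 * u)) (Or.inl hne)).mul_const (kf (((1/2:ℝ):ℂ) + e0 * u))
    refine h.congr_deriv ?_
    simp only [Fs, id]
    simp; ring

end RZ

namespace RZ
open Filter Topology Set Complex

noncomputable def Th (p : ℝ) : ℝ := Complex.arg (((1 + p : ℝ):ℂ) + (p:ℂ) * I)

theorem Th_deriv (p : ℝ) : HasDerivAt Th (1 / (1 + 2*p + 2*p^2)) p := by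
  have hslit : (((1 + p : ℝ):ℂ) + (p:ℂ) * I) ∈ slitPlane := line_slit (by simp)
  have h1 : HasDerivAt (fun p : ℝ => (((1 + p : ℝ):ℂ) + (p:ℂ) * I)) (1 + I) p := by
    have a1 : HasDerivAt (fun p : ℝ => (p:ℂ)) 1 p := by
      simpa using (hasDerivAt_id p).ofReal_comp
    have := (a1.const_add 1).add (a1.mul_const I)
    rw [one_mul] at this
    refine this.congr_of_eventuallyEq (Eventually.of_forall fun q => ?_)
    simp
  have h2 := h1.clog_real hslit
  have h3 := (Complex.imCLM.hasFDerivAt.comp_hasDerivAt p h2)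
  have : Th = (⇑imCLM ∘ fun p : ℝ => Complex.log (((1 + p : ℝ):ℂ) + (p:ℂ) * I)) := by
    ext q; simp [Th, Complex.log_im]
  rw [this]
  refine h3.congr_deriv ?_
  rw [Complex.imCLM_apply, Complex.div_im]
  have hn : normSq (((1 + p : ℝ):ℂ) + (p:ℂ) * I) = 1 + 2*p+2*p^2 := by
    rw [normSq_add_mul_I]; ring
  rw [hn]
  simp
  ring

theorem Th_den (p : ℝ) : 1/2 ≤ 1 + 2*p+2*p^2 := by nlinarith [sq_nonneg (p+1/2)]

theorem Th_zero : Th 0 = 0 := by simp [Th]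

theorem Th_le (p : ℝ) : Th p ≤ p + p^2/2 := by
  set g : ℝ → ℝ := fun p => p + p^2/2 - Th p with hg
  have hd : ∀ p, HasDerivAt g (p * (2*(p+1)^2+1) / (1 + 2*p+2*p^2)) p := by
    intro p
    have := ((hasDerivAt_id p).add (((hasDerivAt_id p).pow 2).div_const 2)).sub (Th_deriv p)
    refine this.congr_deriv ?_
    have := Th_den p
    simp only [id]
    field_simp
    ring
  have hg0 : g 0 = 0 := by simp [hg, Th_zero]
  have hcont : Continuous g := continuous_iff_continuousAt.mpr fun p => (hd p).continuousAt
  have : 0 ≤ g p := by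
    rcases le_total 0 p with h | h
    · have : MonotoneOn g (Ici 0) := by
        apply monotoneOn_of_deriv_nonneg (convex_Ici 0) hcont.continuousOn (fun x _ => (hd x).differentiableAt.differentiableWithinAt)
        intro x hx
        rw [interior_Ici] at hx
        rw [(hd x).deriv]
        have := Th_den x
        have hx' : 0 < x := hx
        positivity
      rw [← hg0]; exact this self_mem_Ici h h
    · have : AntitoneOn g (Iic 0) := by
        apply antitoneOn_of_deriv_nonpos (convex_Iic 0) hcont.continuousOn (fun x _ => (hd x).differentiableAt.differentiableWithinAt)
        intro x hx
        rw [interior_Iic] at hx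
        rw [(hd x).deriv]
        have := Th_den x
        have hx' : x < 0 := hx
        apply div_nonpos_of_nonpos_of_nonneg _ (by linarith)
        nlinarith [sq_nonneg (x+1)]
      rw [← hg0]; exact this h self_mem_Iic h
  simp only [hg] at this; linarith

theorem Th_abs (p : ℝ) : |Th p| ≤ 2 * |p| := by
  have := Convex.norm_image_sub_le_of_norm_hasDerivWithin_le (f := Th) (C := 2) (s := univ) (x := 0) (y := p)
    (f' := fun p => (1 / (1 + 2*p + 2*p^2))) (fun x _ => (Th_deriv x).hasDerivWithinAt) (by
      intro x _
      have := Th_den x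
      rw [Real.norm_of_nonneg (by positivity), div_le_iff₀ (by linarith)]
      linarith) convex_univ (mem_univ _) (mem_univ _)
  simpa [Th_zero] using this

theorem right_pointwise (s : ℂ) (N : ℕ) (A u : ℝ) (hA : A = N + 1/2) (hN : 1 ≤ N) (hs : 0 ≤ s.re)
    (ht : |s.im - 2 * Real.pi * A^2| ≤ 4 * Real.pi * A) :
    ‖Fs s ((A:ℂ) + e0 * u)‖ ≤ (1.05:ℝ)^(-s.re) * Real.exp (-(Real.pi/2) * u^2 + 8 * Real.pi * |u|) := by
  set x : ℂ := ((A:ℝ):ℂ) + e0 * u with hx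
  set v : ℝ := √2/2*u with hv
  have s2 := sqrt2_sq
  have s2p : 0 < √2 := by positivity
  have s2l : √2 ≤ 3/2 := by nlinarith
  have hre : x.re = A + v := line_re _ _
  have him : x.im = v := line_im _ _
  have hA1 : 3/2 ≤ A := by rw [hA]; have : (1:ℝ) ≤ N := by exact_mod_cast hN
                           linarith
  have hv2 : v^2 = u^2/2 := by rw [hv]; nlinarith
  have hns : ‖x‖^2 = (A+v)^2 + v^2 := by
    rw [← normSq_eq_norm_sq, normSq_apply, hre, him]; ring
  have hlow : (1.05:ℝ) ≤ ‖x‖ := by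
    have : (1.05:ℝ)^2 ≤ ‖x‖^2 := by rw [hns]; nlinarith [sq_nonneg (A + 2*v)]
    exact le_of_sq_le_sq this (norm_nonneg _) 
  have hx0 : x ≠ 0 := by rw [← norm_pos_iff]; linarith
  have hk : 2 ≤ ‖kden x‖ := kden_half (n := N) (by rw [hre, him, hA]; push_cast; ring)
  have h4 : ‖kf x‖ ≤ Real.exp (-(2 * Real.pi * x.re * x.im)) := by
    rw [kf, norm_div, norm_gauss]
    exact div_le_self (Real.exp_pos _).le (by linarith)
  set p := v / A with hp
  have hvp : v = A * p := by rw [hp]; field_simp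
  have harg : x.arg = Th p := by
    have : x = (A:ℂ) * (((1 + p : ℝ):ℂ) + (p:ℂ) * I) := by
      apply Complex.ext
      · rw [hre, hvp]; simp; ring
      · rw [him, hvp]; simp
    rw [this, Complex.arg_real_mul _ (by linarith)]; rfl
  rw [Fs, norm_mul, Complex.norm_cpow_of_ne_zero hx0, neg_re, neg_im, div_eq_mul_inv, ← Real.exp_neg, mul_assoc]
  have e1 : ‖x‖ ^ (-s.re) ≤ (1.05:ℝ)^(-s.re) := Real.rpow_le_rpow_of_nonpos (by norm_num) hlow (by linarith)
  refine mul_le_mul e1 ?_ (by positivity) (by positivity)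
  refine (mul_le_mul_of_nonneg_left h4 (Real.exp_pos _).le).trans ?_
  rw [← Real.exp_add]
  apply Real.exp_le_exp.mpr
  rw [harg, hre, him]
  have a1 := Th_le p
  have a2 := Th_abs p
  have hpi := Real.pi_pos
  have a3 : (s.im - 2 * Real.pi * A^2) * Th p ≤ 8 * Real.pi * |v| := by
    calc _ ≤ |(s.im - 2 * Real.pi * A^2) * Th p| := le_abs_self _
      _ = |s.im - 2 * Real.pi * A^2| * |Th p| := abs_mul _ _
      _ ≤ (4 * Real.pi * A) * (2 * |p|) := by gcongr
      _ = _ := by rw [hvp, abs_mul, abs_of_pos (by linarith : (0:ℝ) < A)]; ring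
  have a4 : 2 * Real.pi * A^2 * Th p ≤ 2 * Real.pi * A^2 * (p + p^2/2) := by gcongr
  have a5 : |v| ≤ |u| := by
    rw [hv, abs_mul, abs_of_pos (by positivity)]; nlinarith [abs_nonneg u]
  have a6 : 2 * Real.pi * A^2 * (p + p^2/2) = 2 * Real.pi * (A * v) + Real.pi * v^2 := by rw [hvp]; ring
  have a7 : 8 * Real.pi * |v| ≤ 8 * Real.pi * |u| := by gcongr
  have a8 : Real.pi * v^2 = Real.pi/2 * u^2 := by rw [hv2]; ring
  nlinarith

theorem sum_tail_bound (σ : ℝ) (hσ : 2 ≤ σ) (M : ℕ) :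
    ∑ n ∈ Finset.range M, ((n:ℝ)+2)^(-σ) ≤ (2:ℝ)^(2-σ) * (1 - 1/((M:ℝ)+1)) := by
  induction M with
  | zero => simp
  | succ k ih =>
    rw [Finset.sum_range_succ]
    have h1 : ((k:ℝ)+2)^(-σ) ≤ (2:ℝ)^(2-σ) * (((k:ℝ)+2)^2)⁻¹ := by
      rw [show -σ = (2-σ) + (-2) by ring, Real.rpow_add (by positivity)]
      have : ((k:ℝ)+2)^(-2:ℝ) = (((k:ℝ)+2)^2)⁻¹ := by
        rw [Real.rpow_neg (by positivity)]; norm_num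
      rw [this]
      gcongr ?_ * _
      exact Real.rpow_le_rpow_of_nonpos (by norm_num) (by linarith [Nat.cast_nonneg (α := ℝ) k]) (by linarith)
    have h2 : (((k:ℝ)+2)^2)⁻¹ ≤ 1/((k:ℝ)+1) - 1/((k:ℝ)+1+1) := by
      have : 1/((k:ℝ)+1) - 1/((k:ℝ)+1+1) = (((k:ℝ)+1)*((k:ℝ)+2))⁻¹ := by field_simp; ring
      rw [this]
      gcongr
      nlinarith
    have h3 : (0:ℝ) < (2:ℝ)^(2-σ) := by positivity
    push_cast
    nlinarith

theorem choose_N (t : ℝ) (ht : 0 ≤ t) : ∃ N : ℕ, 1 ≤ N ∧ |t - 2 * Real.pi * ((N:ℝ)+1/2)^2| ≤ 4 * Real.pi * ((N:ℝ)+1/2) := by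
  have hpi := Real.pi_pos
  by_cases h : t < 2 * Real.pi
  · refine ⟨1, le_rfl, ?_⟩
    rw [abs_le]; constructor <;> norm_num <;> nlinarith
  · push Not at h
    set y := √(t/(2*Real.pi)) with hy
    have hy2 : y^2 = t/(2*Real.pi) := Real.sq_sqrt (by positivity)
    have ht' : t = 2 * Real.pi * y^2 := by rw [hy2]; field_simp
    have hy1 : 1 ≤ y := by
      rw [hy]; apply Real.one_le_sqrt.mpr; rw [le_div_iff₀ (by positivity)]; linarith
    refine ⟨⌊y⌋₊, Nat.one_le_floor_iff _ |>.mpr hy1, ?_⟩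
    have b1 := Nat.floor_le (by linarith : 0 ≤ y)
    have b2 := Nat.lt_floor_add_one y
    set n : ℝ := (⌊y⌋₊ : ℝ)
    have hn : 1 ≤ n := by
      have := Nat.one_le_floor_iff _ |>.mpr hy1
      simp only [n]; exact_mod_cast this
    rw [ht', show 2 * Real.pi * y^2 - 2 * Real.pi * (n+1/2)^2 = 2 * Real.pi * (y^2 - (n+1/2)^2) by ring, abs_mul, abs_of_pos (by positivity)]
    have : |y^2 - (n+1/2)^2| ≤ 2 * (n+1/2) := by
      rw [abs_le]; constructor <;> nlinarith
    nlinarith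

theorem tendsto_rpow_neg (a : ℝ) (ha : 1 < a) : Tendsto (fun σ : ℝ => a^(-σ)) atTop (𝓝 0) := by
  have h : Tendsto (fun σ : ℝ => Real.exp (-(Real.log a * σ))) atTop (𝓝 0) :=
    Real.tendsto_exp_neg_atTop_nhds_zero.comp (tendsto_id.const_mul_atTop (Real.log_pos ha))
  refine h.congr fun σ => ?_
  rw [Real.rpow_def_of_pos (by linarith)]; congr 1; ring

theorem R_right : ∃ σ0 : ℝ, 2 ≤ σ0 ∧ ∀ s : ℂ, σ0 ≤ s.re → 0 ≤ s.im → ‖RiemannR s - 1‖ ≤ 1/2 := by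
  set g : ℝ → ℝ := fun u => Real.exp (-(Real.pi/2) * u^2 + 8 * Real.pi * |u|) with hg
  have hgi : Integrable g := by
    have : Integrable (fun u : ℝ => Real.exp (100 * Real.pi) * Real.exp (-(Real.pi/4) * u^2)) :=
      (integrable_exp_neg_mul_sq (by positivity)).const_mul _
    refine this.mono' (by fun_prop) (Eventually.of_forall fun u => ?_)
    rw [Real.norm_of_nonneg (Real.exp_pos _).le, ← Real.exp_add]
    apply Real.exp_le_exp.mpr
    have := Real.pi_pos
    have h2 : u^2/4 - 8*|u| + 100 ≥ 0 := by nlinarith [sq_abs u, sq_nonneg (|u| - 16)]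
    nlinarith
  set C := ∫ u, g u
  have t1 : Tendsto (fun σ : ℝ => (2:ℝ)^2 * (2:ℝ)^(-σ) + (1.05:ℝ)^(-σ) * C) atTop (𝓝 0) := by
    have := ((tendsto_rpow_neg 2 (by norm_num)).const_mul ((2:ℝ)^2)).add ((tendsto_rpow_neg 1.05 (by norm_num)).mul_const C)
    simpa using this
  obtain ⟨σ1, h1⟩ := eventually_atTop.mp (t1.eventually_le_const (by norm_num : (0:ℝ) < 1/2))
  refine ⟨max 2 σ1, le_max_left _ _, fun s hs ht => ?_⟩
  have hs2 : 2 ≤ s.re := (le_max_left _ _).trans hs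
  have hs1 := h1 s.re ((le_max_right _ _).trans hs)
  obtain ⟨N, hN1, hN⟩ := choose_N s.im ht
  obtain ⟨M, rfl⟩ : ∃ M, N = M + 1 := ⟨N - 1, by omega⟩
  rw [R_sum s (M+1), Finset.sum_range_succ']
  simp only [Nat.cast_zero, zero_add, one_cpow]
  rw [show ∀ a b : ℂ, a + 1 - b - 1 = a - b by intros; ring]
  refine (norm_sub_le _ _).trans (le_trans (add_le_add ?_ ?_) hs1)
  · refine (norm_sum_le _ _).trans ?_
    calc _ = ∑ n ∈ Finset.range M, ((n:ℝ)+2)^(-s.re) := by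
          apply Finset.sum_congr rfl
          intro n _
          have : (((n + 1 : ℕ) : ℂ) + 1) = (((n:ℝ)+2 : ℝ) : ℂ) := by push_cast; ring
          rw [this, Complex.norm_cpow_eq_rpow_re_of_pos (by positivity), neg_re]
      _ ≤ _ := sum_tail_bound _ hs2 M
      _ ≤ (2:ℝ)^(2-s.re) * 1 := by gcongr; have : (0:ℝ) ≤ 1/((M:ℝ)+1) := by positivity
                                   linarith
      _ = _ := by rw [mul_one, sub_eq_add_neg, Real.rpow_add (by norm_num)]; norm_num
  · rw [norm_mul, norm_e0, one_mul, J]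
    refine (norm_integral_le_of_norm_le (g := fun u => (1.05:ℝ)^(-s.re) * g u) (hgi.const_mul _) (Eventually.of_forall fun u => ?_)).trans ?_
    · exact right_pointwise s (M+1) _ u rfl hN1 (by linarith) hN
    · rw [integral_const_mul]

end RZ

namespace RZ
open Filter Topology Set Complex

theorem kden_low {x : ℂ} (h : |x.re| ≤ 1/2) : 2 * ‖x‖ ≤ ‖kden x‖ := by
  have h1 := normSq_kden x
  have h2 := abs_le_abs_sinh (Real.pi * x.im)
  have h3 : 2 * |x.re| ≤ |Real.sin (Real.pi * x.re)| := by
    have : 2 / Real.pi * |Real.pi * x.re| ≤ |Real.sin (Real.pi * x.re)| := by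
      apply Real.mul_abs_le_abs_sin
      rw [abs_mul, abs_of_pos Real.pi_pos]; nlinarith [Real.pi_pos]
    rw [abs_mul, abs_of_pos Real.pi_pos] at this
    have e : 2 / Real.pi * (Real.pi * |x.re|) = 2 * |x.re| := by field_simp
    rwa [e] at this
  have h4 : x.re^2 ≤ Real.sin (Real.pi * x.re)^2 := by
    apply sq_le_sq.mpr; linarith [abs_nonneg x.re]
  have h5 : x.im^2 ≤ Real.sinh (Real.pi * x.im)^2 := by
    apply sq_le_sq.mpr; refine le_trans ?_ h2
    rw [abs_mul, abs_of_pos Real.pi_pos]; nlinarith [Real.pi_gt_three, abs_nonneg x.im]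
  have h6 : ‖x‖^2 = x.re^2 + x.im^2 := by rw [← normSq_eq_norm_sq, normSq_apply]; ring
  apply le_of_sq_le_sq _ (norm_nonneg _)
  nlinarith

theorem Fs_contAt_zero {s : ℂ} (hs : s.re ≤ -2) : ContinuousAt (Fs s) 0 := by
  have hs0 : s ≠ 0 := by rintro rfl; simp at hs; linarith
  have h0 : Fs s 0 = 0 := by rw [Fs, zero_cpow (neg_ne_zero.mpr hs0), zero_mul]
  rw [ContinuousAt, h0, tendsto_zero_iff_norm_tendsto_zero]
  have hlim : Tendsto (fun x : ℂ => ‖x‖ * Real.exp (Real.pi * |s.im|) * ‖Complex.exp (Real.pi * I * x^2)‖) (𝓝 0) (𝓝 0) := by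
    have : Continuous (fun x : ℂ => ‖x‖ * Real.exp (Real.pi * |s.im|) * ‖Complex.exp (Real.pi * I * x^2)‖) := by fun_prop
    have := this.tendsto 0
    simpa using this
  refine squeeze_zero' (Eventually.of_forall fun _ => norm_nonneg _) ?_ hlim
  filter_upwards [Metric.ball_mem_nhds (0:ℂ) (by norm_num : (0:ℝ) < 1/2)] with x hx
  rw [mem_ball_zero_iff] at hx
  by_cases hx0 : x = 0
  · rw [hx0, h0]; simp
  have hxn : 0 < ‖x‖ := norm_pos_iff.mpr hx0
  rw [Fs, kf, norm_mul, norm_div]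
  have h1 := norm_cpow_neg_le (s := s) hx0
  have h2 := kden_low (x := x) ((abs_re_le_norm x).trans hx.le)
  have h3 : ‖x‖ ^ (-s.re) ≤ ‖x‖ ^ (2:ℝ) := Real.rpow_le_rpow_of_exponent_ge hxn (by linarith) (by linarith)
  have h4 : ‖x‖ ^ (2:ℝ) = ‖x‖^2 := by norm_cast
  rw [h4] at h3
  have h5 : ‖x ^ (-s)‖ ≤ ‖x‖^2 * Real.exp (Real.pi * |s.im|) := h1.trans (by gcongr)
  rw [← mul_div_assoc, div_le_iff₀ (by linarith)]
  calc _ ≤ (‖x‖^2 * Real.exp (Real.pi * |s.im|)) * ‖Complex.exp (Real.pi * I * x^2)‖ := by gcongr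
    _ ≤ (‖x‖ * Real.exp (Real.pi * |s.im|) * ‖Complex.exp (Real.pi * I * x^2)‖) * (2 * ‖x‖) := by
        have : 0 ≤ ‖x‖^2 * Real.exp (Real.pi * |s.im|) * ‖Complex.exp (Real.pi * I * x^2)‖ := by positivity
        nlinarith
    _ ≤ _ := by gcongr

theorem kden_ne_strip {x : ℂ} (hx : x ≠ 0) (h1 : 0 ≤ x.re - x.im) (h2 : x.re - x.im ≤ 1/2) : kden x ≠ 0 := by
  intro h0
  obtain ⟨h3, h4⟩ := kden_eq_zero h0
  rw [h3, sub_zero] at h1 h2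
  have hl := kden_low (x := x) (abs_le.mpr ⟨by linarith, h2⟩)
  rw [h0, norm_zero] at hl
  have := norm_pos_iff.mpr hx
  linarith

theorem Fs_neg_ray (s : ℂ) (u : ℝ) (hu : 0 < u) : Fs s (e0 * ((-u : ℝ):ℂ)) = - Complex.exp (I * Real.pi * s) * Fs s (e0 * (u:ℂ)) := by
  have hk : kf (e0 * ((-u : ℝ):ℂ)) = - kf (e0 * (u:ℂ)) := by
    rw [kf, kf, kden_eq, kden_eq]
    have : (Real.pi * (e0 * ((-u : ℝ):ℂ)) : ℂ) = -(Real.pi * (e0 * (u:ℂ))) := by push_cast; ring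
    rw [this, Complex.sin_neg]
    have : (e0 * ((-u : ℝ):ℂ))^2 = (e0 * (u:ℂ))^2 := by push_cast; ring
    rw [this, mul_neg, div_neg]
  have hl0 : Complex.log e0 = ((Real.pi/4 : ℝ):ℂ) * I := by
    rw [e0, show (Real.pi * I / 4 : ℂ) = ((Real.pi/4 : ℝ):ℂ) * I by push_cast; ring, Complex.log_exp]
    · simp; linarith [Real.pi_pos]
    · simp; linarith [Real.pi_pos]
  have hl1 : Complex.log (-e0) = ((-(3*Real.pi/4) : ℝ):ℂ) * I := by
    have : -e0 = Complex.exp (((-(3*Real.pi/4) : ℝ):ℂ) * I) := by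
      rw [e0, neg_eq_neg_one_mul, ← Complex.exp_pi_mul_I, ← Complex.exp_add, Complex.exp_eq_exp_iff_exists_int]
      exact ⟨1, by push_cast; ring⟩
    rw [this, Complex.log_exp]
    · simp; linarith [Real.pi_pos]
    · simp; linarith [Real.pi_pos]
  have hu0 : (u:ℂ) ≠ 0 := by exact_mod_cast hu.ne'
  have ha : e0 * (u:ℂ) ≠ 0 := mul_ne_zero e0_ne hu0
  have hb : (-e0) * (u:ℂ) ≠ 0 := mul_ne_zero (neg_ne_zero.mpr e0_ne) hu0
  have hneg : e0 * ((-u : ℝ):ℂ) = (-e0) * (u:ℂ) := by push_cast; ring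
  rw [Fs, Fs, hk]
  rw [hneg, cpow_def_of_ne_zero hb, cpow_def_of_ne_zero ha, Complex.log_mul_ofReal u hu _ (neg_ne_zero.mpr e0_ne),
    Complex.log_mul_ofReal u hu _ e0_ne, hl0, hl1, mul_neg, neg_mul, ← mul_assoc, ← Complex.exp_add]
  congr 3
  push_cast; ring

theorem R_left_ray {s : ℂ} (hs : s.re ≤ -2) : RiemannR s = -(1 - Complex.exp (I * Real.pi * s)) * ∫ u in Ioi (0:ℝ), e0 * Fs s (e0 * (u:ℂ)) := by
  obtain ⟨C, hC0, hC⟩ := tail_bound 1 (‖s‖+1) le_rfl (by linarith [norm_nonneg s])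
  have hslit : ∀ x : ℂ, x ≠ 0 → 0 ≤ x.re - x.im → x ∈ slitPlane := by
    intro x hx h
    rw [mem_slitPlane_iff]
    by_cases h0 : x.im = 0
    · left
      rw [h0, sub_zero] at h
      rcases h.lt_or_eq with h | h
      · exact h
      · exact absurd (Complex.ext h.symm h0) hx
    · right; exact h0
  have hdiff : ∀ x : ℂ, x ≠ 0 → 0 ≤ x.re - x.im → x.re - x.im ≤ 1/2 → DifferentiableAt ℂ (Fs s) x := by
    intro x hx h1 h2
    unfold Fs kf
    refine DifferentiableAt.mul ?_ (DifferentiableAt.div (by fun_prop) (kden_diff x) (kden_ne_strip hx h1 h2))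
    exact DifferentiableAt.cpow_const differentiableAt_id (hslit x hx h1)
  obtain ⟨hJ, hi0, -⟩ := line_shift (F := Fs s) (A := 0) (B := 1/2) (by norm_num) (by
      intro x hx
      apply ContinuousAt.continuousWithinAt
      by_cases hx0 : x = 0
      · rw [hx0]; exact Fs_contAt_zero hs
      · exact (hdiff x hx0 hx.1 hx.2).continuousAt) (by
      intro x hx
      refine (hdiff x ?_ hx.1.le hx.2.le).differentiableWithinAt
      rintro rfl; simp at hx) C 1 (by
      intro x h1 h2 h3
      refine le_trans ?_ (hC s x (by linarith) (by rw [abs_of_nonneg] <;> linarith) h3)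
      rw [Fs, kf, norm_mul, norm_div]
      gcongr
      exact div_le_self (norm_nonneg _) (kden_tail h3))
  rw [RiemannR_eq_J, ← hJ, J]
  simp only [ofReal_zero, zero_add] at hi0 ⊢
  rw [← intervalIntegral.integral_Iic_add_Ioi (b := 0) hi0.integrableOn hi0.integrableOn,
    ← neg_zero, ← integral_comp_neg_Ioi, neg_zero]
  have : ∫ u in Ioi (0:ℝ), Fs s (e0 * ((-u : ℝ):ℂ)) = - Complex.exp (I * Real.pi * s) * ∫ u in Ioi (0:ℝ), Fs s (e0 * (u:ℂ)) := by
    rw [← integral_const_mul]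
    apply setIntegral_congr_fun measurableSet_Ioi
    intro u hu
    exact Fs_neg_ray s u hu
  rw [this, integral_const_mul]
  ring

end RZ

namespace RZ
open Filter Topology Set Complex

theorem integrable_exp_neg_abs' : Integrable (fun y : ℝ => Real.exp (-|y|)) := by
  rw [← integrableOn_univ, ← Iic_union_Ioi (a := (0:ℝ))]
  refine IntegrableOn.union ?_ ?_
  · refine (integrableOn_exp_Iic 0).congr_fun (fun y hy => ?_) measurableSet_Iic
    simp only [abs_of_nonpos (show y ≤ 0 from hy), neg_neg]
  · refine (integrableOn_exp_neg_Ioi 0).congr_fun (fun y hy => ?_) measurableSet_Ioi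
    simp only [abs_of_pos (show 0 < y from hy)]

theorem dexp_bound (a c : ℝ) (ha : 1 ≤ a) (hc : 0 < c) : ∃ C : ℝ, 0 < C ∧ ∀ y : ℝ,
    Real.exp (a * y) * Real.exp (-(c * Real.exp (2*y))) ≤ C * Real.exp (-|y|) := by
  obtain ⟨n, hn⟩ := exists_nat_ge (a + 1)
  refine ⟨1 + n.factorial / c^n, by positivity, fun y => ?_⟩
  rcases le_total y 0 with h | h
  · have h1 : Real.exp (a * y) ≤ Real.exp (-|y|) := by
      apply Real.exp_le_exp.mpr; rw [abs_of_nonpos h]; nlinarith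
    have h2 : Real.exp (-(c * Real.exp (2*y))) ≤ 1 := by
      apply Real.exp_le_one_iff.mpr; have := Real.exp_pos (2*y); nlinarith
    calc _ ≤ Real.exp (-|y|) * 1 := by gcongr
      _ ≤ (1 + n.factorial / c^n) * Real.exp (-|y|) := by
        rw [mul_comm]; gcongr
        have : 0 ≤ n.factorial / c^n := by positivity
        linarith
  · rw [abs_of_nonneg h, Real.exp_neg, Real.exp_neg y, ← div_eq_mul_inv, ← div_eq_mul_inv,
      div_le_div_iff₀ (Real.exp_pos _) (Real.exp_pos _), ← Real.exp_add]
    have h1 : Real.exp (a * y + y) ≤ (Real.exp (2*y))^n := by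
      rw [← Real.exp_nat_mul]; apply Real.exp_le_exp.mpr
      have : (a+1) * y ≤ n * y := by gcongr
      have : 0 ≤ n * y := by positivity
      nlinarith
    have h2 := Real.pow_div_factorial_le_exp (c * Real.exp (2*y)) (by positivity) n
    rw [mul_pow, div_le_iff₀ (by positivity)] at h2
    refine h1.trans ?_
    have h3 : (Real.exp (2*y))^n ≤ n.factorial / c^n * Real.exp (c * Real.exp (2*y)) := by
      rw [div_mul_eq_mul_div, le_div_iff₀ (by positivity)]; linarith
    refine h3.trans ?_
    gcongr; linarith

noncomputable def Ff (φ : ℂ → ℂ) (s x : ℂ) : ℂ := x ^ (-s) * Complex.exp (Real.pi * I * x^2) * φ x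

theorem ray_to_line (f : ℝ → ℂ) : ∫ u in Ioi (0:ℝ), f u = ∫ y : ℝ, Real.exp y • f (Real.exp y) := by
  have := integral_image_eq_integral_abs_deriv_smul (s := univ) (f := Real.exp) (f' := Real.exp) MeasurableSet.univ
    (fun x _ => (Real.hasDerivAt_exp x).hasDerivWithinAt) Real.exp_injective.injOn f
  rw [image_univ, Real.range_exp] at this
  rw [this]
  simp [abs_of_pos (Real.exp_pos _)]

noncomputable def Gw (φ : ℂ → ℂ) (s w : ℂ) : ℂ := Complex.exp ((1-s) * w) * Complex.exp (Real.pi * I * Complex.exp (2*w)) * φ (Complex.exp w)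

theorem ray_Gw (φ : ℂ → ℂ) (s : ℂ) (θ : ℝ) (h1 : -Real.pi < θ) (h2 : θ ≤ Real.pi) :
    ∫ u in Ioi (0:ℝ), Complex.exp (θ * I) * Ff φ s (Complex.exp (θ * I) * (u:ℂ)) = ∫ y : ℝ, Gw φ s (y + θ * I) := by
  rw [ray_to_line]
  congr 1; ext y
  have he : Complex.exp (θ * I) * ((Real.exp y : ℝ):ℂ) = Complex.exp (y + θ * I) := by
    rw [Complex.exp_add, ofReal_exp]; ring
  rw [he, Ff, Gw, cpow_def_of_ne_zero (Complex.exp_ne_zero _), Complex.log_exp (by simpa using h1) (by simpa using h2),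
    ← Complex.exp_nat_mul, Complex.real_smul]
  have e1 : Complex.exp ((1-s) * (y + θ * I)) = Complex.exp y * Complex.exp (θ * I) * Complex.exp ((y + θ * I) * -s) := by
    rw [← Complex.exp_add, ← Complex.exp_add]; congr 1; ring
  rw [e1, ofReal_exp]; push_cast; ring

theorem rotate {φ : ℂ → ℂ} {s : ℂ} (hs : s.re ≤ -2) {α : ℝ} (hα : 0 < α) (hα2 : α ≤ Real.pi/4) (K : ℝ) (hK : 0 ≤ K)
    (hφd : ∀ x : ℂ, 0 < x.re → 0 < x.im → DifferentiableAt ℂ φ x)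
    (hφb : ∀ x : ℂ, 0 < x.re → 0 < x.im → ‖φ x‖ ≤ K * (1 + 1/x.im)) :
    (∫ u in Ioi (0:ℝ), e0 * Ff φ s (e0 * (u:ℂ))) = ∫ u in Ioi (0:ℝ), Complex.exp (α * I) * Ff φ s (Complex.exp (α * I) * (u:ℂ)) := by
  have hpi := Real.pi_pos
  have he0 : e0 = Complex.exp (((Real.pi/4:ℝ):ℂ) * I) := by rw [e0]; congr 1; push_cast; ring
  rw [he0, ray_Gw φ s _ (by linarith) (by linarith), ray_Gw φ s _ (by linarith) (by linarith)]
  have hsa : 0 < Real.sin α := Real.sin_pos_of_pos_of_lt_pi hα (by linarith)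
  have hs2a : 0 < Real.sin (2*α) := Real.sin_pos_of_pos_of_lt_pi (by linarith) (by linarith)
  set c := Real.pi * Real.sin (2*α) with hc
  obtain ⟨C1, hC1, hb1⟩ := dexp_bound (1-s.re) c (by linarith) (by positivity)
  obtain ⟨C2, hC2, hb2⟩ := dexp_bound (-s.re) c (by linarith) (by positivity)
  set B := Real.exp (|s.im|) * K * (C1 + C2 / Real.sin α) with hB
  have hpos : ∀ w : ℂ, α ≤ w.im → w.im ≤ Real.pi/4 → 0 < (Complex.exp w).re ∧ Real.exp w.re * Real.sin α ≤ (Complex.exp w).im := by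
    intro w h1 h2
    rw [Complex.exp_re, Complex.exp_im]
    constructor
    · exact mul_pos (Real.exp_pos _) (Real.cos_pos_of_mem_Ioo ⟨by linarith, by linarith⟩)
    · gcongr
      exact Real.sin_le_sin_of_le_of_le_pi_div_two (by linarith) (by linarith) h1
  have hdiff : ∀ w : ℂ, α ≤ w.im → w.im ≤ Real.pi/4 → DifferentiableAt ℂ (Gw φ s) w := by
    intro w h1 h2
    obtain ⟨a1, a2⟩ := hpos w h1 h2
    have a3 : 0 < (Complex.exp w).im := lt_of_lt_of_le (by positivity) a2
    unfold Gw
    refine DifferentiableAt.mul (by fun_prop) ?_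
    exact (hφd _ a1 a3).comp w Complex.differentiableAt_exp
  have hbound : ∀ y θ : ℝ, α ≤ θ → θ ≤ Real.pi/4 → ‖Gw φ s (y + θ * I)‖ ≤ B * Real.exp (-|y|) := by
    intro y θ h1 h2
    have hwi : ((y:ℂ) + θ * I).im = θ := by simp
    have hwr : ((y:ℂ) + θ * I).re = y := by simp
    obtain ⟨a1, a2⟩ := hpos (y + θ * I) (by rw [hwi]; exact h1) (by rw [hwi]; exact h2)
    rw [hwr] at a2
    have a3 : 0 < (Complex.exp (y + θ * I)).im := lt_of_lt_of_le (by positivity) a2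
    have n1 : ‖Complex.exp ((1-s) * (y + θ * I))‖ ≤ Real.exp ((1-s.re) * y) * Real.exp (|s.im|) := by
      rw [Complex.norm_exp, ← Real.exp_add]
      apply Real.exp_le_exp.mpr
      simp
      have : s.im * θ ≤ |s.im| := by
        calc s.im * θ ≤ |s.im| * θ := mul_le_mul_of_nonneg_right (le_abs_self _) (by linarith)
          _ ≤ |s.im| * 1 := by gcongr; linarith [Real.pi_lt_four]
          _ = _ := mul_one _
      linarith
    have n2 : ‖Complex.exp (Real.pi * I * Complex.exp (2*(y + θ * I)))‖ ≤ Real.exp (-(c * Real.exp (2*y))) := by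
      rw [Complex.norm_exp]
      apply Real.exp_le_exp.mpr
      have : (Real.pi * I * Complex.exp (2*(y + θ * I))).re = -(Real.pi * (Real.exp (2*y) * Real.sin (2*θ))) := by
        rw [mul_assoc, Complex.re_ofReal_mul, Complex.I_mul_re, Complex.exp_im]
        simp
      rw [this, hc]
      have : Real.sin (2*α) ≤ Real.sin (2*θ) := Real.sin_le_sin_of_le_of_le_pi_div_two (by linarith) (by linarith) (by linarith)
      have h5 : Real.pi * (Real.exp (2*y) * Real.sin (2*α)) ≤ Real.pi * (Real.exp (2*y) * Real.sin (2*θ)) := by gcongr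
      linarith
    have n3 : ‖φ (Complex.exp (y + θ * I))‖ ≤ K * (1 + Real.exp (-y) / Real.sin α) := by
      refine (hφb _ a1 a3).trans ?_
      have h7 : 1 / (Complex.exp (y + θ * I)).im ≤ Real.exp (-y) / Real.sin α := by
        rw [Real.exp_neg, div_eq_mul_inv (Real.exp y)⁻¹, ← mul_inv, ← one_div]
        exact one_div_le_one_div_of_le (by positivity) a2
      exact mul_le_mul_of_nonneg_left (by linarith) hK
    rw [Gw, norm_mul, norm_mul]
    calc _ ≤ (Real.exp ((1-s.re) * y) * Real.exp (|s.im|)) * Real.exp (-(c * Real.exp (2*y))) * (K * (1 + Real.exp (-y) / Real.sin α)) := by gcongr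
      _ = Real.exp (|s.im|) * K * (Real.exp ((1-s.re) * y) * Real.exp (-(c * Real.exp (2*y))) + (Real.exp (-s.re * y) * Real.exp (-(c * Real.exp (2*y)))) / Real.sin α) := by
        rw [show (1-s.re) * y = y + (-s.re) * y by ring, Real.exp_add y, Real.exp_neg y]
        field_simp
      _ ≤ Real.exp (|s.im|) * K * (C1 * Real.exp (-|y|) + (C2 * Real.exp (-|y|)) / Real.sin α) := by
        have := hb1 y; have := hb2 y
        gcongr
      _ = _ := by rw [hB]; ring
  have hintg : ∀ θ : ℝ, α ≤ θ → θ ≤ Real.pi/4 → Integrable (fun y : ℝ => Gw φ s (y + θ * I)) := by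
    intro θ h1 h2
    refine (integrable_exp_neg_abs'.const_mul B).mono' ?_ (Eventually.of_forall fun y => hbound y θ h1 h2)
    apply Continuous.aestronglyMeasurable
    rw [continuous_iff_continuousAt]
    intro y
    have h5 := (hdiff (y + θ * I) (by simpa using h1) (by simpa using h2)).continuousAt
    exact ContinuousAt.comp (f := fun y : ℝ => (y:ℂ) + θ * I) h5 (by fun_prop)
  have lim1 : Tendsto (fun y : ℝ => B * Real.exp (-|y|)) atTop (𝓝 0) := by
    simpa using (Real.tendsto_exp_neg_atTop_nhds_zero.comp tendsto_abs_atTop_atTop).const_mul B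
  have lim2 : Tendsto (fun y : ℝ => B * Real.exp (-|y|)) atBot (𝓝 0) := by
    simpa using (Real.tendsto_exp_neg_atTop_nhds_zero.comp tendsto_abs_atBot_atTop).const_mul B
  symm
  refine strip_shift hα2 ?_ ?_ _ lim1 lim2 ?_ ?_ (hintg α le_rfl hα2) (hintg _ hα2 le_rfl)
  · intro w hw; exact (hdiff w hw.1 hw.2).continuousAt.continuousWithinAt
  · intro w hw; exact (hdiff w hw.1.le hw.2.le).differentiableWithinAt
  · exact Eventually.of_forall fun y θ h => hbound y θ h.1 h.2
  · exact Eventually.of_forall fun y θ h => hbound y θ h.1 h.2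

/-- the exponent -/
noncomputable def hh (y : ℝ) : ℝ := (y^2-1)/2 - Real.log y

/-- `η(s)^2 = s/(2πi)`, i.e. `zz s = s/(2πi)` -/
noncomputable def zz (s : ℂ) : ℂ := ⟨s.im/(2*Real.pi), -s.re/(2*Real.pi)⟩
noncomputable def et (s : ℂ) : ℂ := Complex.exp (Complex.log (zz s) / 2)

theorem zz_eq (s : ℂ) : 2 * Real.pi * I * zz s = s := by
  have := Real.pi_ne_zero
  apply Complex.ext <;> simp [zz] <;> field_simp

theorem zz_ne {s : ℂ} (h : s.re < 0) : zz s ≠ 0 := by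
  intro h0
  have := zz_eq s
  rw [h0, mul_zero] at this
  rw [← this] at h; simp at h

theorem et_sq {s : ℂ} (h : s.re < 0) : et s ^ 2 = zz s := by
  rw [et, ← Complex.exp_nat_mul]
  rw [show ((2:ℕ):ℂ) * (Complex.log (zz s) / 2) = Complex.log (zz s) by push_cast; ring, Complex.exp_log (zz_ne h)]

theorem zz_arg {s : ℂ} (h : s.re < 0) (ht : 0 < s.im) : 0 < (zz s).arg ∧ (zz s).arg < Real.pi/2 := by
  have hpi := Real.pi_pos
  have h1 : 0 < (zz s).re := by simp only [zz]; positivity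
  have h2 : 0 < (zz s).im := by simp only [zz]; apply div_pos <;> linarith
  constructor
  · have h3 := (Complex.arg_nonneg_iff (z := zz s)).mpr h2.le
    rcases h3.lt_or_eq with h4 | h4
    · exact h4
    · have := Complex.arg_eq_zero_iff.mp h4.symm
      linarith [this.2]
  · exact (abs_lt.mp (Complex.abs_arg_lt_pi_div_two_iff.mpr (Or.inl h1))).2

theorem et_polar (s : ℂ) : et s = ((Real.exp (Real.log ‖zz s‖/2) : ℝ):ℂ) * Complex.exp ((((zz s).arg/2 : ℝ):ℂ) * I) := by
  rw [et, ofReal_exp, ← Complex.exp_add]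
  congr 1
  apply Complex.ext <;> simp [Complex.log_re, Complex.log_im]

theorem left_formula {φ : ℂ → ℂ} {s : ℂ} (hs : s.re ≤ -2) (ht : 0 < s.im) (K : ℝ) (hK : 0 ≤ K)
    (hφd : ∀ x : ℂ, 0 < x.re → 0 < x.im → DifferentiableAt ℂ φ x)
    (hφb : ∀ x : ℂ, 0 < x.re → 0 < x.im → ‖φ x‖ ≤ K * (1 + 1/x.im)) :
    (∫ u in Ioi (0:ℝ), e0 * Ff φ s (e0 * (u:ℂ))) =
      Complex.exp ((1-s) * (Complex.log (zz s)/2)) * Complex.exp (s/2) * ∫ y in Ioi (0:ℝ), Complex.exp (s * hh y) * φ (et s * y) := by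
  have hpi := Real.pi_pos
  obtain ⟨ha1, ha2⟩ := zz_arg (by linarith : s.re < 0) ht
  rw [rotate hs (α := (zz s).arg/2) (by linarith) (by linarith) K hK hφd hφb]
  set ρ := Real.exp (Real.log ‖zz s‖/2) with hρ
  have hρ0 : 0 < ρ := Real.exp_pos _
  set ω := Complex.exp ((((zz s).arg/2 : ℝ):ℂ) * I) with hω
  have hsc := integral_comp_mul_left_Ioi (fun u : ℝ => ω * Ff φ s (ω * (u:ℂ))) 0 hρ0
  rw [mul_zero] at hsc
  have : ∫ u in Ioi (0:ℝ), ω * Ff φ s (ω * (u:ℂ)) = ρ • ∫ x in Ioi (0:ℝ), ω * Ff φ s (ω * ((ρ * x : ℝ):ℂ)) := by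
    rw [hsc, smul_smul, mul_inv_cancel₀ hρ0.ne', one_smul]
  rw [this, Complex.real_smul, ← integral_const_mul, ← integral_const_mul]
  apply setIntegral_congr_fun measurableSet_Ioi
  intro y hy
  have hy0 : (0:ℝ) < y := hy
  have hyc : (y:ℂ) ≠ 0 := by exact_mod_cast hy0.ne'
  have e1 : ω * ((ρ * y : ℝ):ℂ) = et s * (y:ℂ) := by
    rw [et_polar, ← hω, ← hρ]; push_cast; ring
  have hetne : et s ≠ 0 := Complex.exp_ne_zero _
  have hlog : Complex.log (et s) = Complex.log (zz s)/2 := by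
    rw [et, Complex.log_exp]
    · simp [Complex.log_im]; linarith
    · simp [Complex.log_im]; linarith
  simp only
  rw [e1, ← mul_assoc, show (ρ:ℂ) * ω = et s from (et_polar s).symm, Ff, cpow_def_of_ne_zero (mul_ne_zero hetne hyc),
    Complex.log_mul_ofReal y hy0 _ hetne, hlog, mul_pow, et_sq (by linarith)]
  have e2 : (Real.pi * I * (zz s * (y:ℂ)^2) : ℂ) = s/2 * (y:ℂ)^2 := by
    have := zz_eq s
    linear_combination (y:ℂ)^2/2 * this
  rw [e2]
  have e3 : et s * (Complex.exp ((↑(Real.log y) + Complex.log (zz s)/2) * -s) * Complex.exp (s/2 * (y:ℂ)^2)) =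
      Complex.exp ((1-s) * (Complex.log (zz s)/2)) * Complex.exp (s/2) * Complex.exp (s * hh y) := by
    rw [et, ← Complex.exp_add, ← Complex.exp_add, ← Complex.exp_add, ← Complex.exp_add]
    congr 1
    rw [hh]; push_cast; ring
  rw [← mul_assoc, ← mul_assoc, mul_assoc (et s), e3, mul_assoc _ _ (φ _)]

end RZ

namespace RZ
open Filter Topology Set Complex

theorem hh_ge {v : ℝ} (hv : -1 < v) : v^2/2 ≤ hh (1+v) := by
  have := Real.log_le_sub_one_of_pos (show 0 < 1+v by linarith)
  unfold hh; nlinarith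

theorem hh_taylor {v : ℝ} (hv : |v| ≤ 1/2) : |hh (1+v) - v^2| ≤ 2*|v|^3 := by
  have h := Real.abs_log_sub_add_sum_range_le (x := -v) (by rw [abs_neg]; linarith) 2
  simp only [Finset.sum_range_succ, Finset.sum_range_zero, abs_neg] at h
  have h2 : |v|^3/(1-|v|) ≤ 2*|v|^3 := by
    rw [div_le_iff₀ (by linarith)]
    nlinarith [pow_nonneg (abs_nonneg v) 3]
  have e : hh (1+v) - v^2 = -(0 + (-v)^(0+1)/((0:ℕ)+1) + (-v)^(1+1)/((1:ℕ)+1) + Real.log (1 - -v)) := by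
    unfold hh; push_cast; rw [sub_neg_eq_add]; ring
  rw [e, abs_neg]
  calc _ ≤ _ := h
    _ ≤ _ := h2

theorem exp_sub_le {a b : ℂ} {M : ℝ} (ha : a.re ≤ M) (hb : b.re ≤ M) :
    ‖Complex.exp a - Complex.exp b‖ ≤ Real.exp M * ‖a - b‖ := by
  refine Convex.norm_image_sub_le_of_norm_deriv_le (s := {z : ℂ | z.re ≤ M}) (f := Complex.exp) (fun x _ => Complex.differentiableAt_exp) ?_ (convex_halfSpace_re_le M) hb ha
  intro x hx
  rw [Complex.deriv_exp, Complex.norm_exp]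
  exact Real.exp_le_exp.2 hx

noncomputable def psi (s : ℂ) (v : ℝ) : ℂ := if -1 < v then Complex.exp (s * hh (1+v)) else 0

theorem psi_norm {s : ℂ} (hs : s.re ≤ -2) (v : ℝ) : ‖psi s v‖ ≤ Real.exp (s.re * v^2/2) := by
  unfold psi
  split_ifs with h
  · rw [Complex.norm_exp]
    apply Real.exp_le_exp.2
    have := hh_ge h
    simp only [Complex.mul_re, Complex.ofReal_re, Complex.ofReal_im, mul_zero, sub_zero]
    nlinarith
  · simp; positivity

theorem psi_sub {s : ℂ} (hs : s.re ≤ -2) (v : ℝ) :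
    ‖psi s v - Complex.exp (s * v^2)‖ ≤ 16 * ‖s‖ * |v|^3 * Real.exp (s.re * v^2/2) := by
  have hs1 : 1 ≤ ‖s‖ := by
    have := Complex.abs_re_le_norm s
    have := neg_le_abs s.re
    linarith
  have hre : (s * (v:ℂ)^2).re = s.re * v^2 := by
    rw [← Complex.ofReal_pow, Complex.mul_re, Complex.ofReal_re, Complex.ofReal_im]; ring
  have hg : ‖Complex.exp (s * v^2)‖ ≤ Real.exp (s.re * v^2/2) := by
    rw [Complex.norm_exp, hre]
    apply Real.exp_le_exp.2
    nlinarith [sq_nonneg v]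
  have hE := Real.exp_pos (s.re * v^2/2)
  by_cases hv : |v| ≤ 1/2
  · have hv1 : -1 < v := by have := neg_abs_le v; linarith
    have h1 := hh_ge hv1
    have h2 := hh_taylor hv
    unfold psi
    rw [if_pos hv1]
    have h3 := exp_sub_le (a := s * hh (1+v)) (b := s * v^2) (M := s.re * v^2/2)
      (by simp only [Complex.mul_re, Complex.ofReal_re, Complex.ofReal_im, mul_zero, sub_zero]; nlinarith)
      (by rw [hre]; nlinarith [sq_nonneg v])
    have h4 : ‖s * hh (1+v) - s * (v:ℂ)^2‖ ≤ ‖s‖ * (2*|v|^3) := by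
      rw [← mul_sub, norm_mul, ← Complex.ofReal_pow, ← Complex.ofReal_sub, Complex.norm_real, Real.norm_eq_abs]
      gcongr
    calc _ ≤ _ := h3
      _ ≤ Real.exp (s.re * v^2/2) * (‖s‖ * (2*|v|^3)) := by gcongr
      _ ≤ _ := by
        have : 0 ≤ ‖s‖ * |v|^3 * Real.exp (s.re * v^2/2) := by positivity
        nlinarith
  · push Not at hv
    have h8 : 1/8 ≤ |v|^3 := by
      have : (1/2:ℝ)^3 ≤ |v|^3 := by gcongr
      linarith
    have h9 : 1/8 ≤ ‖s‖ * |v|^3 := by nlinarith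
    calc _ ≤ ‖psi s v‖ + ‖Complex.exp (s * v^2)‖ := norm_sub_le _ _
      _ ≤ 2 * Real.exp (s.re * v^2/2) := by linarith [psi_norm hs v]
      _ ≤ _ := by nlinarith

theorem cube_integrable : Integrable (fun x : ℝ => |x|^3 * Real.exp (-(1/4) * x^2)) := by
  have := (integrable_rpow_mul_exp_neg_mul_sq (b := 1/4) (by norm_num) (s := 3) (by norm_num)).norm
  refine this.congr (Eventually.of_forall fun x => ?_)
  simp only [norm_mul, Real.norm_eq_abs, Real.abs_exp]
  rw [show x^(3:ℝ) = x^3 by exact_mod_cast Real.rpow_natCast x 3, abs_pow]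

theorem cube_scale {n : ℝ} (hn : 0 < n) : Integrable (fun v : ℝ => |v|^3 * Real.exp (-(n/4) * v^2)) ∧
    ∫ v : ℝ, |v|^3 * Real.exp (-(n/4) * v^2) = (1/n^2) * ∫ x : ℝ, |x|^3 * Real.exp (-(1/4) * x^2) := by
  set a := Real.sqrt n
  have ha : 0 < a := Real.sqrt_pos.2 hn
  have ha2 : a^2 = n := Real.sq_sqrt hn.le
  have e : (fun v : ℝ => |v|^3 * Real.exp (-(n/4) * v^2)) = fun v => (1/a^3) * (fun x : ℝ => |x|^3 * Real.exp (-(1/4) * x^2)) (a*v) := by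
    funext v
    simp only [abs_mul, abs_of_pos ha, mul_pow, ha2]
    field_simp
  constructor
  · rw [e]
    exact (cube_integrable.comp_mul_left' ha.ne').const_mul _
  · rw [e, integral_const_mul, Measure.integral_comp_mul_left (fun x : ℝ => |x|^3 * Real.exp (-(1/4) * x^2)) a]
    rw [abs_of_pos (by positivity), smul_eq_mul, ← mul_assoc, ← ha2]
    congr 1
    field_simp

theorem psi_meas (s : ℂ) : Measurable (psi s) := by
  unfold psi hh
  refine Measurable.ite measurableSet_Ioi ?_ measurable_const
  fun_prop

theorem psi_int (s : ℂ) (f : ℝ → ℂ) : ∫ y in Ioi (0:ℝ), Complex.exp (s * hh y) * f y = ∫ v : ℝ, psi s v * f (1+v) := by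
  rw [← integral_indicator measurableSet_Ioi, ← integral_add_left_eq_self _ (1:ℝ)]
  congr 1
  funext v
  unfold psi Set.indicator
  simp only [mem_Ioi]
  by_cases h : -1 < v
  · rw [if_pos h, if_pos (by linarith)]
  · rw [if_neg h, if_neg (by linarith), zero_mul]

theorem lam_bound {n l v : ℝ} (h : l^2 ≤ n) : l * v ≤ n*v^2/4 + 1 := by
  nlinarith [sq_nonneg (l*v - 2), mul_nonneg (sub_nonneg.2 h) (sq_nonneg v)]

theorem laplace : ∃ C : ℝ, 0 < C ∧ ∀ s l : ℂ, s.re ≤ -2 → l.re^2 ≤ -s.re →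
    ‖(∫ y in Ioi (0:ℝ), Complex.exp (s * hh y) * Complex.exp (l * ((y:ℂ)-1))) -
      (Real.pi / -s)^(1/2:ℂ) * Complex.exp (-(l^2/(4*s)))‖ ≤ C * (‖s‖/s.re^2) := by
  set C0 := ∫ x : ℝ, |x|^3 * Real.exp (-(1/4) * x^2)
  have hC0 : 0 ≤ C0 := integral_nonneg fun x => by positivity
  refine ⟨16 * Real.exp 1 * C0 + 1, by positivity, fun s l hs hl => ?_⟩
  have hn : 0 < -s.re := by linarith
  rw [psi_int s (fun y => Complex.exp (l * ((y:ℂ)-1)))]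
  have e1 : ∫ v : ℝ, psi s v * Complex.exp (l * (((1+v:ℝ):ℂ)-1)) = ∫ v : ℝ, psi s v * Complex.exp (l * v) := by
    congr 1; funext v; push_cast; congr 2; ring
  rw [e1]
  have e2 := integral_cexp_quadratic (b := s) (by linarith) l 0
  rw [zero_sub] at e2
  rw [← e2]
  have hle : ∀ v : ℝ, ‖Complex.exp (l * v)‖ ≤ Real.exp 1 * Real.exp (-s.re*v^2/4) := by
    intro v
    rw [Complex.norm_exp, ← Real.exp_add]
    apply Real.exp_le_exp.2
    have := lam_bound (v := v) hl
    simp only [Complex.mul_re, Complex.ofReal_re, Complex.ofReal_im, mul_zero, sub_zero]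
    linarith
  have hq : Integrable (fun v : ℝ => Complex.exp (s * v^2 + l * v + 0)) := by
    exact integrable_cexp_quadratic' (by linarith) l 0
  have hmeas : AEStronglyMeasurable (fun v : ℝ => psi s v * Complex.exp (l * v)) :=
    ((psi_meas s).mul (by fun_prop)).aestronglyMeasurable
  have hp : Integrable (fun v : ℝ => psi s v * Complex.exp (l * v)) := by
    refine Integrable.mono' ((integrable_exp_neg_mul_sq (b := -s.re/4) (by linarith)).const_mul (Real.exp 1)) hmeas (Eventually.of_forall fun v => ?_)
    rw [norm_mul]
    calc _ ≤ Real.exp (s.re * v^2/2) * (Real.exp 1 * Real.exp (-s.re*v^2/4)) := by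
          gcongr
          · exact psi_norm hs v
          · exact hle v
      _ = _ := by rw [mul_left_comm, ← Real.exp_add]; ring_nf
  rw [← integral_sub hp hq]
  obtain ⟨c1, c2⟩ := cube_scale hn
  calc _ ≤ ∫ v : ℝ, 16 * ‖s‖ * Real.exp 1 * (|v|^3 * Real.exp (-(-s.re/4) * v^2)) := by
        refine norm_integral_le_of_norm_le (c1.const_mul _) (Eventually.of_forall fun v => ?_)
        rw [add_zero, Complex.exp_add, ← sub_mul, norm_mul]
        calc _ ≤ (16 * ‖s‖ * |v|^3 * Real.exp (s.re * v^2/2)) * (Real.exp 1 * Real.exp (-s.re*v^2/4)) := by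
              gcongr
              · exact psi_sub hs v
              · exact hle v
          _ = 16 * ‖s‖ * Real.exp 1 * (|v|^3 * (Real.exp (s.re * v^2/2) * Real.exp (-s.re*v^2/4))) := by ring
          _ = _ := by rw [← Real.exp_add]; ring_nf
    _ = 16 * Real.exp 1 * C0 * (‖s‖/s.re^2) := by
        rw [integral_const_mul, c2]; ring
    _ ≤ _ := by
        have : 0 ≤ ‖s‖/s.re^2 := by positivity
        nlinarith
end RZ

namespace RZ
open Filter Topology Set Complex

theorem psi_exp_integrable {s l : ℂ} (hs : s.re ≤ -2) (hl : l.re^2 ≤ -s.re) :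
    Integrable (fun v : ℝ => psi s v * Complex.exp (l * v)) := by
  have hle : ∀ v : ℝ, ‖Complex.exp (l * v)‖ ≤ Real.exp 1 * Real.exp (-s.re*v^2/4) := by
    intro v
    rw [Complex.norm_exp, ← Real.exp_add]
    apply Real.exp_le_exp.2
    have := lam_bound (v := v) hl
    simp only [Complex.mul_re, Complex.ofReal_re, Complex.ofReal_im, mul_zero, sub_zero]
    linarith
  have hmeas : AEStronglyMeasurable (fun v : ℝ => psi s v * Complex.exp (l * v)) :=
    ((psi_meas s).mul (by fun_prop)).aestronglyMeasurable
  refine Integrable.mono' ((integrable_exp_neg_mul_sq (b := -s.re/4) (by linarith)).const_mul (Real.exp 1)) hmeas (Eventually.of_forall fun v => ?_)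
  rw [norm_mul]
  calc _ ≤ Real.exp (s.re * v^2/2) * (Real.exp 1 * Real.exp (-s.re*v^2/4)) := by
        gcongr
        · exact psi_norm hs v
        · exact hle v
    _ = _ := by rw [mul_left_comm, ← Real.exp_add]; ring_nf

theorem zz_norm (s : ℂ) : ‖zz s‖ = ‖s‖/(2*Real.pi) := by
  have h := congrArg norm (zz_eq s)
  have hp := Real.pi_pos
  simp only [norm_mul, Complex.norm_I, Complex.norm_real, Real.norm_eq_abs, abs_of_pos hp, Complex.norm_two, mul_one] at h
  rw [← h]; field_simp

theorem et_pos {s : ℂ} (h : s.re < 0) (ht : 0 < s.im) : 0 < (et s).re ∧ 0 < (et s).im := by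
  obtain ⟨h1, h2⟩ := zz_arg h ht
  have hpi := Real.pi_pos
  have e : Complex.exp ((((zz s).arg/2 : ℝ):ℂ) * I) = ⟨Real.cos ((zz s).arg/2), Real.sin ((zz s).arg/2)⟩ := by
    apply Complex.ext
    · exact Complex.exp_ofReal_mul_I_re _
    · exact Complex.exp_ofReal_mul_I_im _
  rw [et_polar, e]
  constructor
  · rw [Complex.re_ofReal_mul]
    exact mul_pos (Real.exp_pos _) (Real.cos_pos_of_mem_Ioo ⟨by linarith, by linarith⟩)
  · rw [Complex.im_ofReal_mul]
    exact mul_pos (Real.exp_pos _) (Real.sin_pos_of_pos_of_lt_pi (by linarith) (by linarith))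

theorem et_im_sq {s : ℂ} (h : s.re < 0) : 4 * Real.pi * (et s).im^2 = ‖s‖ - s.im := by
  have h1 := et_sq h
  have h2 : ‖et s‖^2 = ‖s‖/(2*Real.pi) := by rw [← norm_pow, h1, zz_norm]
  have h3 := congrArg Complex.re h1
  rw [Complex.sq_norm, Complex.normSq_apply] at h2
  simp only [pow_two, Complex.mul_re, zz] at h3
  have hp := Real.pi_pos
  have h4 : 2 * (et s).im * (et s).im = ‖s‖/(2*Real.pi) - s.im/(2*Real.pi) := by rw [← h2, ← h3]; ring
  calc _ = 2*Real.pi*(2 * (et s).im * (et s).im) := by ring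
    _ = _ := by rw [h4]; field_simp

noncomputable def bet (s : ℂ) : ℝ := Real.pi * (et s).im

theorem bet_bounds {s : ℂ} (h : s.re < 0) (ht : 0 < s.im) :
    0 < bet s ∧ bet s^2 ≤ -s.re ∧ s.re^2 ≤ 4 * ‖s‖ * bet s^2 := by
  have hp := Real.pi_pos
  have hp3 := Real.pi_gt_three
  have hp4 := Real.pi_lt_four
  have hb := et_im_sq h
  have hn : ‖s‖^2 = s.re^2 + s.im^2 := by rw [Complex.sq_norm, Complex.normSq_apply]; ring
  have hst : s.im ≤ ‖s‖ := Complex.im_le_norm s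
  have hsr : -s.re ≤ ‖s‖ := (neg_le_abs _).trans (Complex.abs_re_le_norm s)
  have hb2 : 4 * bet s^2 = Real.pi * (‖s‖ - s.im) := by rw [← hb]; unfold bet; ring
  refine ⟨mul_pos hp (et_pos h ht).2, ?_, ?_⟩
  · have : ‖s‖ - s.im ≤ -s.re := by nlinarith
    nlinarith
  · have : s.re^2 = (‖s‖ - s.im) * (‖s‖ + s.im) := by nlinarith
    rw [this, show 4 * ‖s‖ * bet s^2 = ‖s‖ * (4 * bet s^2) by ring, hb2]
    have h0 : 0 ≤ ‖s‖ - s.im := by linarith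
    have : ‖s‖ + s.im ≤ ‖s‖ * Real.pi := by nlinarith [norm_nonneg s]
    nlinarith

theorem kinv_bound {x : ℂ} (hx : 0 < x.im) :
    ‖1 / kden x + Complex.exp (Real.pi * I * x)‖ ≤ Real.exp (-(Real.pi * x.im)) / (2 * (Real.pi * x.im)) := by
  have hp := Real.pi_pos
  set E := Complex.exp (Real.pi * I * x)
  have hE : ‖E‖ = Real.exp (-(Real.pi * x.im)) := by
    simp only [E, Complex.norm_exp]
    congr 1
    simp [Complex.mul_re, Complex.mul_im]
  have hE0 : E ≠ 0 := Complex.exp_ne_zero _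
  set B := Real.pi * x.im
  have hB : 0 < B := mul_pos hp hx
  have hE1 : ‖E^2‖ = Real.exp (-(2*B)) := by rw [norm_pow, hE, ← Real.exp_nat_mul]; congr 1; push_cast; ring
  have hlt : Real.exp (-(2*B)) < 1 := by rw [Real.exp_lt_one_iff]; linarith
  have hd : 1 - Real.exp (-(2*B)) ≤ ‖E^2 - 1‖ := by
    have := norm_sub_norm_le (1:ℂ) (E^2)
    rw [norm_one, hE1, norm_sub_rev] at this; exact this
  have hne : E^2 - 1 ≠ 0 := by
    intro h; rw [h, norm_zero] at hd; linarith
  have e : 1 / kden x + E = E * E^2 / (E^2 - 1) := by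
    have : kden x = E - E⁻¹ := by rw [kden, Complex.exp_neg]
    rw [this]
    have h2 : E - E⁻¹ = (E^2-1)/E := by field_simp
    rw [h2]; field_simp; ring
  rw [e, norm_div, norm_mul, hE, hE1]
  rw [div_le_div_iff₀ (by linarith) (by linarith)]
  have h3 : Real.exp (-(2*B)) * (2*B) ≤ 1 - Real.exp (-(2*B)) := by
    have := Real.add_one_le_exp (2*B)
    have h4 : Real.exp (-(2*B)) * Real.exp (2*B) = 1 := by rw [← Real.exp_add]; simp
    have h5 := Real.exp_pos (-(2*B))
    nlinarith
  rw [mul_assoc]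
  have := Real.exp_pos (-B)
  gcongr
  linarith

theorem err2_pt {s : ℂ} (hs : s.re ≤ -4) (ht : 0 < s.im) (v : ℝ) :
    ‖psi s v * (1 / kden (et s * ((1+v:ℝ):ℂ)) + Complex.exp (Real.pi * I * (et s * ((1+v:ℝ):ℂ))))‖ ≤
      Real.exp (-bet s) / (2 * bet s) * (Real.exp (3/2) * Real.exp (-(-s.re/8) * v^2)) := by
  obtain ⟨hb0, hb1, -⟩ := bet_bounds (by linarith : s.re < 0) ht
  by_cases hv : -1 < v
  swap
  · rw [psi, if_neg hv, zero_mul, norm_zero]; positivity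
  have hy : 0 < 1 + v := by linarith
  have him : (et s * ((1+v:ℝ):ℂ)).im = (et s).im * (1+v) := by rw [Complex.im_mul_ofReal]
  have hk := kinv_bound (x := et s * ((1+v:ℝ):ℂ)) (by rw [him]; exact mul_pos (et_pos (by linarith) ht).2 hy)
  rw [him, show Real.pi * ((et s).im * (1+v)) = bet s * (1+v) by unfold bet; ring] at hk
  rw [norm_mul]
  have hpsi : ‖psi s v‖ = Real.exp (s.re * hh (1+v)) := by
    rw [psi, if_pos hv, Complex.norm_exp, Complex.re_mul_ofReal]
  rw [hpsi]
  have h1 := hh_ge hv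
  have hlog : (1+v)⁻¹ = Real.exp (-Real.log (1+v)) := by rw [Real.exp_neg, Real.exp_log hy]
  calc _ ≤ Real.exp (s.re * hh (1+v)) * (Real.exp (-(bet s * (1+v))) / (2 * (bet s * (1+v)))) := by gcongr
    _ = 1 / (2*bet s) * (Real.exp (s.re * hh (1+v)) * Real.exp (-(bet s * (1+v))) * (1+v)⁻¹) := by field_simp
    _ = 1 / (2*bet s) * (Real.exp (s.re * hh (1+v) + -(bet s * (1+v)) + -Real.log (1+v))) := by
        rw [hlog, ← Real.exp_add, ← Real.exp_add]
    _ ≤ 1 / (2*bet s) * Real.exp (-bet s + (3/2 + -(-s.re/8) * v^2)) := by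
        refine mul_le_mul_of_nonneg_left (Real.exp_le_exp.2 ?_) (by positivity)
        have h2 : -(bet s) * v ≤ (-s.re)*v^2/4 + 1 := lam_bound (by rw [neg_sq]; exact hb1)
        have h3 : -Real.log (1+v) = hh (1+v) - ((1+v)^2-1)/2 := by unfold hh; ring
        rw [h3]
        have h4 : (s.re + 1) * hh (1+v) ≤ (s.re+1) * (v^2/2) := mul_le_mul_of_nonpos_left h1 (by linarith)
        nlinarith [sq_nonneg v, sq_nonneg (1+v), mul_nonneg (by linarith : 0 ≤ -s.re - 4) (sq_nonneg v)]
    _ = _ := by rw [Real.exp_add, Real.exp_add]; ring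

noncomputable def LL (s : ℂ) : ℂ := ∫ y in Ioi (0:ℝ), Complex.exp (s * hh y) * (1 / kden (et s * y))

theorem LL_approx : ∃ C : ℝ, 0 < C ∧ ∀ s : ℂ, s.re ≤ -4 → 0 < s.im →
    |‖LL s‖ - Real.exp (-bet s) * Real.sqrt (Real.pi/‖s‖)| ≤
      C * Real.exp (-bet s) * (‖s‖/s.re^2 + 1/bet s * Real.sqrt (1 / (-s.re))) := by
  obtain ⟨C, hC, hlap⟩ := laplace
  set C2 := Real.exp (3/2) * Real.sqrt (8*Real.pi)/2
  have hC2 : 0 < C2 := by positivity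
  refine ⟨C + C2, by positivity, fun s hs ht => ?_⟩
  obtain ⟨hb0, hb1, -⟩ := bet_bounds (by linarith : s.re < 0) ht
  have hs0 : s ≠ 0 := by rintro rfl; simp at hs; linarith
  set l : ℂ := Real.pi * I * et s
  have hlre : l.re = -bet s := by simp [l, bet, Complex.mul_re, Complex.mul_im]
  have hl2 : l.re^2 ≤ -s.re := by rw [hlre, neg_sq]; exact hb1
  have h1 := hlap s l (by linarith) hl2
  have hq : l^2/(4*s) = (Real.pi/8:ℝ) * I := by
    have hz := zz_eq s
    have : l^2 = -(Real.pi^2 * zz s) := by simp only [l]; rw [mul_pow, mul_pow, et_sq (by linarith), Complex.I_sq]; ring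
    rw [this]
    have hz0 := zz_ne (s := s) (by linarith)
    have hp : (Real.pi:ℂ) ≠ 0 := by exact_mod_cast Real.pi_ne_zero
    rw [← hz] 
    rw [hz]
    rw [div_eq_iff (by simpa using hs0)]
    rw [show (4:ℂ) * s = 4 * (2*Real.pi*I*zz s) by rw [hz]]
    push_cast
    linear_combination (-(Real.pi:ℂ)^2 * zz s) * Complex.I_sq
  rw [hq] at h1
  set G : ℂ := (Real.pi / -s)^(1/2:ℂ) * Complex.exp (-((Real.pi/8:ℝ) * I))
  have hG : ‖G‖ = Real.sqrt (Real.pi/‖s‖) := by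
    simp only [G]
    rw [norm_mul, show -(((Real.pi/8:ℝ):ℂ) * I) = ((-(Real.pi/8):ℝ):ℂ) * I by push_cast; ring, Complex.norm_exp_ofReal_mul_I, mul_one,
      show (1/2:ℂ) = ((1/2:ℝ):ℂ) by norm_num, Complex.norm_cpow_real, Real.sqrt_eq_rpow]
    simp [abs_of_pos Real.pi_pos]
  rw [psi_int s (fun y => Complex.exp (l * ((y:ℂ)-1)))] at h1
  have hintg := psi_exp_integrable (l := l) (by linarith : s.re ≤ -2) hl2
  have e1 : ∫ v : ℝ, psi s v * Complex.exp (l * (((1+v:ℝ):ℂ)-1)) = ∫ v : ℝ, psi s v * Complex.exp (l * v) := by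
    congr 1; funext v; push_cast; congr 2; ring
  rw [e1] at h1
  have hgi := (integrable_exp_neg_mul_sq (b := -s.re/8) (by linarith)).const_mul (Real.exp (3/2))
  have hgi2 := hgi.const_mul (Real.exp (-bet s) / (2 * bet s))
  have herr : Integrable (fun v : ℝ => psi s v * (1 / kden (et s * ((1+v:ℝ):ℂ)) + Complex.exp (Real.pi * I * (et s * ((1+v:ℝ):ℂ))))) := by
    refine Integrable.mono' hgi2 ?_ (Eventually.of_forall fun v => err2_pt hs ht v)
    apply Measurable.aestronglyMeasurable
    refine (psi_meas s).mul ?_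
    unfold kden
    fun_prop
  set Er := ∫ v : ℝ, psi s v * (1 / kden (et s * ((1+v:ℝ):ℂ)) + Complex.exp (Real.pi * I * (et s * ((1+v:ℝ):ℂ))))
  have hEr : ‖Er‖ ≤ C2 * Real.exp (-bet s) * (1/bet s * Real.sqrt (1 / (-s.re))) := by
    have := norm_integral_le_of_norm_le hgi2 (Eventually.of_forall fun v => err2_pt hs ht v)
    refine this.trans (le_of_eq ?_)
    rw [integral_const_mul, integral_const_mul, integral_gaussian,
      show Real.pi/(-s.re/8) = (8*Real.pi) * (1 / (-s.re)) by field_simp, Real.sqrt_mul (by positivity)]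
    simp only [C2]; field_simp
  have hLL : LL s = Er - Complex.exp l * ∫ v : ℝ, psi s v * Complex.exp (l * v) := by
    rw [LL, psi_int s (fun y => 1 / kden (et s * (y:ℂ))), ← integral_const_mul, ← integral_sub herr (hintg.const_mul _)]
    congr 1; funext v
    have : Complex.exp (Real.pi * I * (et s * ((1+v:ℝ):ℂ))) = Complex.exp l * Complex.exp (l * v) := by
      rw [← Complex.exp_add]; congr 1; simp only [l]; push_cast; ring
    rw [this]; ring
  have hel : ‖Complex.exp l‖ = Real.exp (-bet s) := by rw [Complex.norm_exp, hlre]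
  have hfin : ‖LL s - -(Complex.exp l * G)‖ ≤ (C + C2) * Real.exp (-bet s) * (‖s‖/s.re^2 + 1/bet s * Real.sqrt (1 / (-s.re))) := by
    have : LL s - -(Complex.exp l * G) = Er - Complex.exp l * ((∫ v : ℝ, psi s v * Complex.exp (l * v)) - G) := by
      rw [hLL]; ring
    rw [this]
    refine (norm_sub_le _ _).trans ?_
    rw [norm_mul, hel]
    have h2 : Real.exp (-bet s) * ‖(∫ v : ℝ, psi s v * Complex.exp (l * v)) - G‖ ≤ Real.exp (-bet s) * (C * (‖s‖/s.re^2)) := by gcongr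
    have p1 : 0 ≤ C * Real.exp (-bet s) * (1/bet s * Real.sqrt (1 / (-s.re))) := by positivity
    have p2 : 0 ≤ C2 * Real.exp (-bet s) * (‖s‖/s.re^2) := by positivity
    nlinarith
  have h9 := (abs_norm_sub_norm_le (LL s) (-(Complex.exp l * G))).trans hfin
  rwa [norm_neg, norm_mul, hel, hG] at h9
end RZ

namespace RZ
open Filter Topology Set Complex

theorem LL_bounds : ∃ P0 : ℝ, 10 ≤ P0 ∧ ∀ (s : ℂ) (p : ℝ), P0 ≤ p → p^8 = ‖s‖ → p^7 ≤ -s.re → 0 < s.im →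
    Real.exp (-bet s)/p^4 ≤ ‖LL s‖ ∧ ‖LL s‖ ≤ 3 * (Real.exp (-bet s)/p^4) := by
  obtain ⟨C, hC, h⟩ := LL_approx
  refine ⟨max 10 (6*C), le_max_left _ _, fun s p hp hs hn ht => ?_⟩
  have hp10 : 10 ≤ p := (le_max_left _ _).trans hp
  have hp6 : 6*C ≤ p := (le_max_right _ _).trans hp
  have hp0 : 0 < p := by linarith
  have h7 : p ≤ p^7 := le_self_pow₀ (by linarith) (by norm_num)
  have hs4 : s.re ≤ -4 := by linarith
  obtain ⟨hb0, hb1, hb2⟩ := bet_bounds (by linarith : s.re < 0) ht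
  have h := h s hs4 ht
  have hbe : p^3 ≤ 2 * bet s := by
    have h1 : (p^7)^2 ≤ s.re^2 := by rw [← neg_sq s.re]; gcongr
    have h2 : p^8 * (p^3)^2 ≤ p^8 * (2*bet s)^2 := by
      rw [← hs] at hb2
      calc _ = (p^7)^2 := by ring
        _ ≤ _ := h1
        _ ≤ _ := hb2
        _ = _ := by ring
    have h3 := le_of_mul_le_mul_left h2 (by positivity)
    exact le_of_sq_le_sq h3 (by positivity)
  have e1 : Real.sqrt (Real.pi/‖s‖) = Real.sqrt Real.pi / p^4 := by
    rw [Real.sqrt_div Real.pi_pos.le, ← hs, show p^8 = (p^4)^2 by ring, Real.sqrt_sq (by positivity)]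
  have e2 : ‖s‖/s.re^2 ≤ 1/p^6 := by
    rw [← hs, ← neg_sq s.re]
    rw [div_le_div_iff₀ (by nlinarith) (by positivity)]
    calc p^8 * p^6 = (p^7)^2 := by ring
      _ ≤ _ := by rw [one_mul]; gcongr
  have e3 : Real.sqrt (1 / (-s.re)) ≤ 1/p^3 := by
    rw [Real.sqrt_le_left (by positivity), div_pow, one_pow]
    apply one_div_le_one_div_of_le (by positivity)
    refine le_trans ?_ hn
    rw [← pow_mul]
    exact pow_le_pow_right₀ (by linarith) (by norm_num)
  have e4 : 1/bet s ≤ 2/p^3 := by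
    rw [div_le_div_iff₀ hb0 (by positivity)]; linarith
  have e5 : ‖s‖/s.re^2 + 1/bet s * Real.sqrt (1 / (-s.re)) ≤ 3/p^6 := by
    have : 1/bet s * Real.sqrt (1 / (-s.re)) ≤ 2/p^3 * (1/p^3) := by gcongr
    have e : 2/p^3 * (1/p^3) = 2/p^6 := by field_simp
    have e' : 3/p^6 = 1/p^6+2/p^6 := by ring
    rw [e', ← e]; linarith
  have hE := Real.exp_pos (-bet s)
  have e6 : C * Real.exp (-bet s) * (‖s‖/s.re^2 + 1/bet s * Real.sqrt (1 / (-s.re))) ≤ (1/2) * (Real.exp (-bet s)/p^4) := by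
    calc _ ≤ C * Real.exp (-bet s) * (3/p^6) := by gcongr
      _ = (3*C) * (Real.exp (-bet s)/p^4) / p^2 := by field_simp
      _ ≤ _ := by
        rw [div_le_iff₀ (by positivity)]
        have : 0 < Real.exp (-bet s)/p^4 := by positivity
        have : 6 * C ≤ p^2 := hp6.trans (le_self_pow₀ (by linarith) (by norm_num))
        nlinarith
  have sp1 : 3/2 ≤ Real.sqrt Real.pi := by
    apply Real.le_sqrt_of_sq_le; nlinarith [Real.pi_gt_three]
  have sp2 : Real.sqrt Real.pi ≤ 2 := by
    rw [Real.sqrt_le_left (by norm_num)]; nlinarith [Real.pi_lt_four]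
  have e7 : Real.exp (-bet s) * Real.sqrt (Real.pi/‖s‖) = Real.sqrt Real.pi * (Real.exp (-bet s)/p^4) := by rw [e1]; ring
  rw [e7] at h
  have hh := abs_le.1 (h.trans e6)
  have : 0 < Real.exp (-bet s)/p^4 := by positivity
  constructor <;> nlinarith [hh.1, hh.2]

noncomputable def XX (s : ℂ) : ℝ := (1-s.re)*Real.log ‖zz s‖ + s.im*(zz s).arg + s.re

theorem norm_pref (s : ℂ) : ‖Complex.exp ((1-s) * (Complex.log (zz s)/2)) * Complex.exp (s/2)‖ = Real.exp (XX s/2) := by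
  rw [norm_mul, Complex.norm_exp, Complex.norm_exp, ← Real.exp_add]
  congr 1
  have : (1-s) * (Complex.log (zz s)/2) = ((1-s) * Complex.log (zz s))/2 := by ring
  rw [this]
  simp only [Complex.div_ofNat_re, Complex.mul_re, Complex.sub_re, Complex.sub_im, Complex.one_re, Complex.one_im, Complex.log_re, Complex.log_im, XX]
  ring

theorem kden_im_low {x : ℂ} (hx : 0 < x.im) : x.im ≤ ‖kden x‖ := by
  have h := normSq_kden x
  have h1 := abs_le_abs_sinh (Real.pi * x.im)
  have hp := Real.pi_gt_three
  have h2 : (Real.pi*x.im)^2 ≤ Real.sinh (Real.pi*x.im)^2 := sq_le_sq.2 h1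
  have h3 : x.im^2 ≤ ‖kden x‖^2 := by
    rw [h]
    have : x.im^2 ≤ (Real.pi*x.im)^2 := by
      apply pow_le_pow_left₀ hx.le; nlinarith
    nlinarith [sq_nonneg (Real.sin (Real.pi*x.re)), sq_nonneg (Real.sinh (Real.pi*x.im))]
  exact le_of_sq_le_sq h3 (norm_nonneg _)

theorem R_left_formula {s : ℂ} (hs : s.re ≤ -2) (ht : 0 < s.im) :
    RiemannR s = -(1 - Complex.exp (I*Real.pi*s)) * (Complex.exp ((1-s) * (Complex.log (zz s)/2)) * Complex.exp (s/2) * LL s) := by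
  rw [R_left_ray hs, LL, ← left_formula (φ := fun x => 1 / kden x) hs ht 1 zero_le_one]
  · congr 2
    funext u
    simp only [Fs, kf, Ff]; ring
  · intro x hx1 hx2
    have : kden x ≠ 0 := by
      intro h; have := kden_im_low hx2; rw [h, norm_zero] at this; linarith
    exact (differentiableAt_const _).div (kden_diff x) this
  · intro x hx1 hx2
    have := kden_im_low hx2
    rw [norm_div, norm_one, one_mul]
    have h2 : 1/‖kden x‖ ≤ 1/x.im := one_div_le_one_div_of_le hx2 this
    linarith

theorem log_near {a m : ℝ} {c : ℝ} (hm : 0 < m) (hc : 1 ≤ c) (h1 : m/c ≤ a) (h2 : a ≤ c*m) :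
    |Real.log a - Real.log m| ≤ Real.log c := by
  have hc0 : 0 < c := by linarith
  have ha : 0 < a := lt_of_lt_of_le (by positivity) h1
  have l1 := Real.log_le_log (by positivity) h1
  have l2 := Real.log_le_log ha h2
  rw [Real.log_div hm.ne' hc0.ne'] at l1
  rw [Real.log_mul hc0.ne' hm.ne'] at l2
  rw [abs_le]; constructor <;> linarith

theorem R_left : ∃ P0 : ℝ, 10 ≤ P0 ∧ (∀ (s : ℂ) (p : ℝ), P0 ≤ p → p^8 = ‖s‖ → p^7 ≤ -s.re → 0 < s.im → RiemannR s ≠ 0) ∧ 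
    ∀ (s : ℂ) (p : ℝ), P0 ≤ p → p^8 = ‖s‖ → p^7 ≤ -s.re → 1 ≤ s.im →
     |2 * Real.log ‖RiemannR s‖ - (XX s - 2*bet s - 8*Real.log p)| ≤ 6 := by
  obtain ⟨P0, hP, h⟩ := LL_bounds
  have hs2 : ∀ (s : ℂ) (p : ℝ), P0 ≤ p → p^7 ≤ -s.re → s.re ≤ -2 := by
    intro s p hp hn
    have : p ≤ p^7 := le_self_pow₀ (by linarith) (by norm_num)
    linarith
  have hex : ∀ s : ℂ, ‖Complex.exp (I*Real.pi*s)‖ = Real.exp (-(Real.pi*s.im)) := by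
    intro s
    rw [Complex.norm_exp]; congr 1; simp [Complex.mul_re, Complex.mul_im]
  refine ⟨P0, hP, ?_, ?_⟩
  · intro s p hp hs hn ht
    rw [R_left_formula (hs2 s p hp hn) ht]
    have hp0 : 0 < p := by linarith
    have h1 : LL s ≠ 0 := by
      intro h0
      have := (h s p hp hs hn ht).1
      rw [h0, norm_zero] at this
      have : 0 < Real.exp (-bet s)/p^4 := by positivity
      linarith
    have h2 : 1 - Complex.exp (I*Real.pi*s) ≠ 0 := by
      intro h0
      have h3 := hex s
      rw [← sub_eq_zero.1 h0, norm_one] at h3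
      have : Real.exp (-(Real.pi*s.im)) < 1 := by rw [Real.exp_lt_one_iff]; nlinarith [Real.pi_pos]
      linarith
    exact mul_ne_zero (neg_ne_zero.2 h2) (mul_ne_zero (mul_ne_zero (Complex.exp_ne_zero _) (Complex.exp_ne_zero _)) h1)
  · intro s p hp hs hn ht
    have ht0 : 0 < s.im := by linarith
    have hp0 : 0 < p := by linarith
    obtain ⟨h1, h2⟩ := h s p hp hs hn ht0
    rw [R_left_formula (hs2 s p hp hn) ht0, norm_mul, norm_mul, norm_pref, norm_neg]
    have hE : ‖Complex.exp (I*Real.pi*s)‖ ≤ 1/2 := by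
      rw [hex, Real.exp_neg]
      rw [← one_div]
      apply one_div_le_one_div_of_le (by norm_num)
      have := Real.add_one_le_exp (Real.pi*s.im)
      nlinarith [Real.pi_gt_three]
    have a1 : 1/2 ≤ ‖1 - Complex.exp (I*Real.pi*s)‖ := by
      have := norm_sub_norm_le (1:ℂ) (Complex.exp (I*Real.pi*s)); rw [norm_one] at this; linarith
    have a2 : ‖1 - Complex.exp (I*Real.pi*s)‖ ≤ 3/2 := by
      have := norm_sub_le (1:ℂ) (Complex.exp (I*Real.pi*s)); rw [norm_one] at this; linarith
    have hm : 0 < Real.exp (-bet s)/p^4 := by positivity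
    have b1 := log_near (c := 3) hm (by norm_num) (by linarith) h2
    have b2 := log_near (a := ‖1 - Complex.exp (I*Real.pi*s)‖) (m := 1) (c := 2) one_pos (by norm_num) a1 (by linarith)
    have hL : 0 < ‖LL s‖ := lt_of_lt_of_le hm h1
    rw [Real.log_mul (by linarith) (by positivity), Real.log_mul (Real.exp_pos _).ne' hL.ne', Real.log_exp]
    rw [Real.log_div (Real.exp_pos _).ne' (by positivity), Real.log_exp, Real.log_pow] at b1
    rw [Real.log_one] at b2
    have l3 : Real.log 3 ≤ 2 := by have := Real.log_le_sub_one_of_pos (show (0:ℝ)<3 by norm_num); linarith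
    have l2 : Real.log 2 ≤ 1 := by have := Real.log_le_sub_one_of_pos (show (0:ℝ)<2 by norm_num); linarith
    rw [abs_le] at b1 b2 ⊢
    push_cast at b1
    constructor <;> linarith [b1.1, b1.2, b2.1, b2.2]

theorem XX_bounds {s : ℂ} {p : ℝ} (hp : 10 ≤ p) (hs : p^8 = ‖s‖) (hn : s.re < 0) (ht : 0 < s.im) :
    s.re ≤ XX s ∧ XX s ≤ (1-s.re)*(8*Real.log p) := by
  obtain ⟨a1, a2⟩ := zz_arg hn ht
  have hpi := Real.pi_gt_three
  have hpi4 := Real.pi_lt_four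
  have h1 := Real.le_tan a1.le a2
  rw [Complex.tan_arg] at h1
  have e : (zz s).im/(zz s).re = -s.re/s.im := by simp only [zz]; field_simp
  rw [e, le_div_iff₀ ht] at h1
  have hp8 : (10:ℝ)^8 ≤ p^8 := by gcongr
  have z1 : 1 ≤ ‖zz s‖ := by
    rw [zz_norm, ← hs, le_div_iff₀ (by positivity)]; norm_num at hp8; linarith
  have z2 : ‖zz s‖ ≤ p^8 := by
    rw [zz_norm, ← hs]; apply div_le_self (by positivity); linarith
  have l0 := Real.log_nonneg z1
  have l1 := Real.log_le_log (by linarith) z2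
  rw [Real.log_pow] at l1
  push_cast at l1
  unfold XX
  constructor
  · have : 0 ≤ s.im * (zz s).arg := by positivity
    nlinarith
  · nlinarith
end RZ

namespace RZ
open Filter Topology Set Complex

theorem e0_u_cpow (a : ℂ) {u : ℝ} (hu : 0 < u) : (e0 * (u:ℂ))^(-a) = Complex.exp (-a * (Real.pi * I/4)) * (u:ℂ)^(-a) := by
  have hpi := Real.pi_pos
  have hl : Complex.log e0 = Real.pi * I/4 := by
    rw [e0, Complex.log_exp]
    · simp; linarith
    · simp; linarith
  rw [Complex.cpow_def_of_ne_zero (mul_ne_zero e0_ne (by exact_mod_cast hu.ne')), Complex.cpow_def_of_ne_zero (by exact_mod_cast hu.ne'),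
    mul_comm e0, Complex.log_ofReal_mul hu e0_ne, hl, ← Complex.exp_add, Complex.ofReal_log hu.le]
  congr 1; ring

theorem gamma_ray {a : ℂ} (ha : a.re ≤ -2) :
    ‖∫ u in Ioi (0:ℝ), e0 * Ff (fun _ => 1) a (e0 * (u:ℂ))‖ =
      Real.exp (Real.pi * a.im/4) * ((1/2) * ((1/Real.pi)^((1-a.re)/2) * ‖Complex.Gamma ((1-a)/2)‖)) := by
  have hpi := Real.pi_pos
  have e1 : ∫ u in Ioi (0:ℝ), e0 * Ff (fun _ => 1) a (e0 * (u:ℂ)) =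
      ∫ u in Ioi (0:ℝ), (e0 * Complex.exp (-a * (Real.pi * I/4))) * ((u:ℂ)^((1-a)-1) • Complex.exp (-((Real.pi:ℝ) * ((u^(2:ℝ):ℝ):ℂ)))) := by
    refine setIntegral_congr_fun measurableSet_Ioi fun u hu => ?_
    simp only [Ff]
    rw [e0_u_cpow a hu]
    have : (Real.pi:ℂ) * I * (e0 * u)^2 = -((Real.pi:ℝ) * ((u^(2:ℝ):ℝ):ℂ)) := by
      rw [mul_pow, e0_sq]
      rw [show (u:ℝ)^(2:ℝ) = u^2 by exact_mod_cast Real.rpow_natCast u 2]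
      push_cast
      linear_combination (Real.pi * (u:ℂ)^2) * Complex.I_sq
    rw [this, show (1-a)-1 = -a by ring, smul_eq_mul]; ring
  rw [e1, integral_const_mul]
  have e2 := mellin_comp_rpow (fun x : ℝ => Complex.exp (-((Real.pi:ℝ) * (x:ℂ)))) (1-a) 2
  rw [mellin, mellin] at e2
  rw [e2]
  have e3 := Complex.integral_cpow_mul_exp_neg_mul_Ioi (a := (1-a)/((2:ℝ):ℂ)) (r := Real.pi) (by
    rw [show ((2:ℝ):ℂ) = 2 by norm_num, Complex.div_ofNat_re]; simp; linarith) hpi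
  simp only [smul_eq_mul] at e3 ⊢
  rw [e3, norm_mul, norm_mul, norm_e0, one_mul, Complex.norm_exp, norm_smul, norm_mul]
  have e4 : ((1:ℂ)/(Real.pi:ℂ)) = ((1/Real.pi:ℝ):ℂ) := by push_cast; ring
  rw [e4, Complex.norm_cpow_eq_rpow_re_of_pos (by positivity)]
  have e5 : ((1-a)/((2:ℝ):ℂ)).re = (1-a.re)/2 := by
    rw [show ((2:ℝ):ℂ) = 2 by norm_num, Complex.div_ofNat_re]; simp
  rw [e5]
  have e6 : (-a * (Real.pi * I/4)).re = Real.pi * a.im/4 := by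
    rw [show -a * ((Real.pi:ℂ) * I/4) = ((-(Real.pi/4):ℝ):ℂ) * (a * I) by push_cast; ring, Complex.re_ofReal_mul]
    simp; ring
  rw [e6]
  have : ‖|(2:ℝ)|⁻¹‖ = 1/2 := by norm_num
  rw [this, show ((2:ℝ):ℂ) = 2 by norm_num]

noncomputable def Lap (a : ℂ) : ℂ := ∫ y in Ioi (0:ℝ), Complex.exp (a * hh y) * 1

theorem zeta_right {s : ℂ} (hs : 3 ≤ s.re) : ‖riemannZeta s - 1‖ ≤ 1/2 := by
  have h0 := zeta_eq_tsum_one_div_nat_add_one_cpow (s := s) (by linarith)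
  have hsum : Summable (fun n : ℕ => 1 / ((n:ℂ) + 1) ^ s) := by
    have := (summable_nat_add_iff 1).2 ((Complex.summable_one_div_nat_cpow (p := s)).2 (by linarith))
    simpa using this
  have h1 := hsum.hasSum
  rw [← h0] at h1
  have h2 := (hasSum_nat_add_iff' 1).2 h1
  simp only [Finset.sum_range_one, Nat.cast_zero, zero_add, Complex.one_cpow, div_one] at h2
  refine le_of_tendsto (h2.tendsto_sum_nat.norm) (Eventually.of_forall fun M => ?_)
  have hb := sum_tail_bound s.re (by linarith) M
  calc _ ≤ ∑ n ∈ Finset.range M, ((n:ℝ)+2)^(-s.re) := by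
        refine norm_sum_le_of_le _ fun n _ => ?_
        have e : ((n+1:ℕ):ℂ) + 1 = (((n:ℝ)+2:ℝ):ℂ) := by push_cast; ring
        rw [e, norm_div, norm_one, Complex.norm_cpow_eq_rpow_re_of_pos (by positivity), Real.rpow_neg (by positivity), one_div]
    _ ≤ _ := hb
    _ ≤ 2^(2-s.re) * 1 := by
        gcongr
        have : 0 < 1/((M:ℝ)+1) := by positivity
        linarith
    _ ≤ 2^(-1:ℝ) := by rw [mul_one]; exact Real.rpow_le_rpow_of_exponent_le (by norm_num) (by linarith)
    _ = 1/2 := by rw [Real.rpow_neg_one]; norm_num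

theorem Lap_bounds : ∃ P0 : ℝ, 10 ≤ P0 ∧ ∀ (s : ℂ) (p : ℝ), P0 ≤ p → p^8 = ‖s‖ → p^7 ≤ -s.re →
    1/3*(1/p^4) ≤ ‖Lap (2*s-1)‖ ∧ ‖Lap (2*s-1)‖ ≤ 3 * (1/p^4) := by
  obtain ⟨C, hC, h⟩ := laplace
  refine ⟨max 10 (2*C), le_max_left _ _, fun s p hp hs hn => ?_⟩
  have hp10 : 10 ≤ p := (le_max_left _ _).trans hp
  have hp6 : 2*C ≤ p := (le_max_right _ _).trans hp
  have hp0 : 0 < p := by linarith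
  have h7 : p ≤ p^7 := le_self_pow₀ (by linarith) (by norm_num)
  set a := 2*s-1 with ha
  have hare : a.re = 2*s.re-1 := by simp [ha]
  have h := h a 0 (by rw [hare]; linarith) (by rw [hare]; simp; linarith)
  have e : (∫ y in Ioi (0:ℝ), Complex.exp (a * hh y) * Complex.exp (0 * ((y:ℂ)-1))) = Lap a := by
    unfold Lap; simp
  rw [e] at h
  simp only [ne_eq, OfNat.ofNat_ne_zero, not_false_eq_true, zero_pow, zero_div, neg_zero, Complex.exp_zero, mul_one] at h
  have hp8 : 1 ≤ p^8 := one_le_pow₀ (by linarith)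
  have na1 : p^8 ≤ ‖a‖ := by
    have := norm_sub_norm_le (2*s) 1
    rw [norm_mul, Complex.norm_two, norm_one, ← hs] at this; linarith
  have na2 : ‖a‖ ≤ 3*p^8 := by
    have := norm_sub_le (2*s) 1
    rw [norm_mul, Complex.norm_two, norm_one, ← hs] at this; linarith
  have hG : ‖(Real.pi / -a)^(1/2:ℂ)‖ = Real.sqrt (Real.pi/‖a‖) := by
    rw [show (1/2:ℂ) = ((1/2:ℝ):ℂ) by norm_num, Complex.norm_cpow_real, Real.sqrt_eq_rpow]
    simp [abs_of_pos Real.pi_pos]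
  have g1 : 1/p^4 ≤ Real.sqrt (Real.pi/‖a‖) := by
    apply Real.le_sqrt_of_sq_le
    rw [div_pow, one_pow, ← pow_mul, div_le_div_iff₀ (by positivity) (by linarith)]
    norm_num only
    nlinarith [Real.pi_gt_three]
  have g2 : Real.sqrt (Real.pi/‖a‖) ≤ 2*(1/p^4) := by
    rw [Real.sqrt_le_left (by positivity), mul_pow, div_pow, one_pow, ← pow_mul, mul_one_div, div_le_div_iff₀ (by linarith) (by positivity)]
    norm_num only
    nlinarith [Real.pi_lt_four, Real.pi_pos]
  have er : C * (‖a‖/a.re^2) ≤ 1/2*(1/p^4) := by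
    have k1 : (2*p^7)^2 ≤ a.re^2 := by rw [← neg_sq a.re]; gcongr; rw [hare]; linarith
    calc _ ≤ C * (3*p^8/(2*p^7)^2) := by gcongr
      _ = (3/4*C)/p^6 := by field_simp; ring
      _ ≤ p^2/2/p^6 := by
        gcongr
        have : p ≤ p^2 := le_self_pow₀ (by linarith) (by norm_num)
        linarith
      _ = _ := by field_simp
  have h9 := abs_le.1 (((abs_norm_sub_norm_le _ _).trans h).trans er)
  rw [hG] at h9
  have : 0 < 1/p^4 := by positivity
  constructor <;> linarith [h9.1, h9.2]

theorem arctan_sub_le (x y : ℝ) : |Real.arctan x - Real.arctan y| ≤ |x - y| := by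
  have := Convex.norm_image_sub_le_of_norm_deriv_le (𝕜 := ℝ) (s := univ) (f := Real.arctan) (C := 1) (x := y) (y := x) (fun x _ => Real.differentiableAt_arctan x) (by
    intro x _
    rw [Real.deriv_arctan, Real.norm_eq_abs, abs_of_pos (by positivity), div_le_one (by positivity)]
    nlinarith [sq_nonneg x]) convex_univ trivial trivial
  simpa using this

theorem XX_double {s : ℂ} (hs : s.re ≤ -2) (ht : 0 < s.im) : |XX (2*s-1)/2 - (1-s.re)*Real.log 2 - XX s| ≤ 3 := by
  set a := 2*s-1 with ha
  have hpi := Real.pi_pos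
  have hare : a.re = 2*s.re-1 := by simp [ha]
  have haim : a.im = 2*s.im := by simp [ha]
  have hS : 2 ≤ ‖s‖ := by
    have := Complex.abs_re_le_norm s
    have := neg_le_abs s.re
    linarith
  have hS2 : -s.re ≤ ‖s‖ := (neg_le_abs _).trans (Complex.abs_re_le_norm s)
  have na1 : 2*‖s‖-1 ≤ ‖a‖ := by
    have := norm_sub_norm_le (2*s) 1
    rw [norm_mul, Complex.norm_two, norm_one] at this; linarith
  have na2 : ‖a‖ ≤ 2*‖s‖+1 := by
    have := norm_sub_le (2*s) 1
    rw [norm_mul, Complex.norm_two, norm_one] at this; linarith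
  have hr : Real.log ‖zz a‖ - Real.log 2 - Real.log ‖zz s‖ = Real.log (‖a‖/(2*‖s‖)) := by
    rw [zz_norm, zz_norm, Real.log_div (by linarith) (by positivity), Real.log_div (by linarith) (by positivity),
      Real.log_div (x := ‖a‖) (y := 2*‖s‖) (by linarith) (by positivity), Real.log_mul (x := 2) (y := ‖s‖) (by norm_num) (by linarith)]
    ring
  have hl : |Real.log (‖a‖/(2*‖s‖))| ≤ 1/‖s‖ := by
    have hr0 : 0 < ‖a‖/(2*‖s‖) := by apply div_pos <;> linarith
    rw [abs_le]; constructor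
    · have := Real.one_sub_inv_le_log_of_pos hr0
      have k : (‖a‖/(2*‖s‖))⁻¹ ≤ 1 + 1/‖s‖ := by
        rw [inv_div, div_le_iff₀ (by linarith)]
        calc 2*‖s‖ ≤ (1+1/‖s‖)*(2*‖s‖-1) := by
              have : (1+1/‖s‖)*(2*‖s‖-1) = 2*‖s‖+1-1/‖s‖ := by field_simp; ring
              rw [this]
              have : 1/‖s‖ ≤ 1 := by rw [div_le_one] <;> linarith
              linarith
          _ ≤ _ := by gcongr
      linarith
    · have := Real.log_le_sub_one_of_pos hr0
      have k : ‖a‖/(2*‖s‖) ≤ 1 + 1/‖s‖ := by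
        rw [div_le_iff₀ (by linarith)]
        have : (1+1/‖s‖)*(2*‖s‖) = 2*‖s‖+2 := by field_simp
        linarith
      linarith
  have argf : ∀ w : ℂ, w.re < 0 → 0 < w.im → (zz w).arg = Real.arctan (-w.re/w.im) := by
    intro w h1 h2
    obtain ⟨a1, a2⟩ := zz_arg h1 h2
    have := Real.arctan_tan (by linarith) a2
    rw [← this, Complex.tan_arg]
    congr 1; simp only [zz]; field_simp
  have hd : |s.im * ((zz a).arg - (zz s).arg)| ≤ 1/2 := by
    rw [argf a (by rw [hare]; linarith) (by rw [haim]; linarith), argf s (by linarith) ht, abs_mul, abs_of_pos ht]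
    have := arctan_sub_le (-a.re/a.im) (-s.re/s.im)
    have e : -a.re/a.im - -s.re/s.im = 1/(2*s.im) := by rw [hare, haim]; field_simp; ring
    rw [e, abs_of_pos (show 0 < 1/(2*s.im) by positivity)] at this
    calc _ ≤ s.im * (1/(2*s.im)) := by gcongr
      _ = _ := by field_simp
  have hf : |(1-s.re) * Real.log (‖a‖/(2*‖s‖))| ≤ 2 := by
    rw [abs_mul, abs_of_pos (by linarith)]
    calc _ ≤ (2*‖s‖) * (1/‖s‖) := by gcongr; linarith
      _ = 2 := by field_simp
  have e : XX a/2 - (1-s.re)*Real.log 2 - XX s = (1-s.re) * Real.log (‖a‖/(2*‖s‖)) + s.im * ((zz a).arg - (zz s).arg) - 1/2 := by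
    rw [← hr, XX, XX, hare, haim]; ring
  rw [e]
  rw [abs_le] at hd hf ⊢
  constructor <;> linarith [hd.1, hd.2, hf.1, hf.2]

theorem cos_bounds {x : ℂ} (hx : x.im ≤ -1) : Real.exp (-x.im)/4 ≤ ‖Complex.cos x‖ ∧ ‖Complex.cos x‖ ≤ 4 * Real.exp (-x.im) := by
  have n1 : ‖Complex.exp (x*I)‖ = Real.exp (-x.im) := by rw [Complex.norm_exp]; simp
  have n2 : ‖Complex.exp (-x*I)‖ = Real.exp (x.im) := by rw [Complex.norm_exp]; simp
  have hh : Real.exp (x.im) ≤ Real.exp (-x.im)/2 := by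
    have h1 : Real.exp (-x.im) = Real.exp (x.im) * Real.exp (-(2*x.im)) := by rw [← Real.exp_add]; ring_nf
    have h2 := Real.add_one_le_exp (-(2*x.im))
    rw [h1]
    nlinarith [Real.exp_pos x.im]
  have hc : Complex.cos x = (Complex.exp (x*I) + Complex.exp (-x*I))/2 := rfl
  have hn : ‖Complex.cos x‖ = ‖Complex.exp (x*I) + Complex.exp (-x*I)‖/2 := by
    rw [hc, norm_div, Complex.norm_two]
  have a1 := norm_add_le (Complex.exp (x*I)) (Complex.exp (-x*I))
  have a2 := norm_sub_le (Complex.exp (x*I) + Complex.exp (-x*I)) (Complex.exp (-x*I))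
  rw [add_sub_cancel_right] at a2
  rw [n1, n2] at a1 a2
  have := Real.exp_pos (-x.im)
  rw [hn]
  constructor <;> linarith

theorem zeta_left : ∃ P0 : ℝ, 10 ≤ P0 ∧ 
    ∀ (s : ℂ) (p : ℝ), P0 ≤ p → p^8 = ‖s‖ → p^7 ≤ -s.re → 1 ≤ s.im →
     riemannZeta s ≠ 0 ∧ |Real.log ‖riemannZeta s‖ - (XX s - 4*Real.log p)| ≤ 20 := by
  obtain ⟨P0, hP, h⟩ := Lap_bounds
  refine ⟨P0, hP, fun s p hp hs hn ht => ?_⟩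
  have hpi := Real.pi_pos
  have hp0 : 0 < p := by linarith
  have h7 : p ≤ p^7 := le_self_pow₀ (by linarith) (by norm_num)
  obtain ⟨l1, l2⟩ := h s p hp hs hn
  set a := 2*s-1 with ha
  have hare : a.re = 2*s.re-1 := by simp [ha]
  have haim : a.im = 2*s.im := by simp [ha]
  have hlf := left_formula (φ := fun _ => 1) (s := a) (by rw [hare]; linarith) (by rw [haim]; linarith) 1 zero_le_one
    (fun x _ _ => differentiableAt_const _) (fun x _ hx => by
      have : 0 < 1/x.im := by positivity
      rw [norm_one, one_mul]; linarith)
  have hgr := gamma_ray (a := a) (by rw [hare]; linarith)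
  change _ = _ * Lap a at hlf
  rw [hlf, norm_mul, norm_pref, hare, haim, show (1-a)/2 = 1-s by rw [ha]; ring] at hgr
  have hm : 0 < 1/p^4 := by positivity
  have hL0 : 0 < ‖Lap a‖ := by linarith
  have b1 := log_near (c := 3) hm (by norm_num) (by linarith) l2
  have hG0 : Complex.Gamma (1-s) ≠ 0 := Complex.Gamma_ne_zero_of_re_pos (by simp; linarith)
  have hlog := congrArg Real.log hgr
  rw [Real.log_mul (Real.exp_pos _).ne' hL0.ne', Real.log_exp, Real.log_mul (Real.exp_pos _).ne' (by positivity), Real.log_exp,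
    Real.log_mul (by norm_num) (by positivity), Real.log_mul (by positivity) (by positivity), Real.log_rpow (by positivity),
    one_div Real.pi, Real.log_inv, one_div, Real.log_inv] at hlog
  have hw : ∀ n : ℕ, (1-s) ≠ -(n:ℂ) := by
    intro n hn
    have := congrArg Complex.im hn
    simp at this; linarith
  have hfe := riemannZeta_one_sub (s := 1-s) hw (by
    intro hn; have := congrArg Complex.im hn
    simp at this; linarith)
  rw [sub_sub_cancel] at hfe
  have hz := zeta_right (s := 1-s) (by simp; linarith)
  have z1 : 1/2 ≤ ‖riemannZeta (1-s)‖ := by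
    have := norm_sub_norm_le (1:ℂ) (1 - riemannZeta (1-s)); rw [norm_one, sub_sub_cancel, norm_sub_rev] at this; linarith
  have z2 : ‖riemannZeta (1-s)‖ ≤ 2 := by
    have := norm_add_le (1:ℂ) (riemannZeta (1-s) - 1); rw [norm_one, add_sub_cancel] at this; linarith
  have him : (Real.pi * (1-s)/2 : ℂ).im = -(Real.pi*s.im/2) := by
    rw [show (Real.pi * (1-s)/2 : ℂ) = ((Real.pi/2:ℝ):ℂ) * (1-s) by push_cast; ring, Complex.im_ofReal_mul]
    simp; ring
  obtain ⟨c1, c2⟩ := cos_bounds (x := Real.pi * (1-s)/2) (by rw [him]; nlinarith [Real.pi_gt_three])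
  rw [him, neg_neg] at c1 c2
  have hcos0 : 0 < ‖Complex.cos (Real.pi * (1-s)/2)‖ := lt_of_lt_of_le (by positivity) c1
  have b2 := log_near (c := 4) (Real.exp_pos _) (by norm_num) c1 c2
  have b3 := log_near (a := ‖riemannZeta (1-s)‖) (m := 1) (c := 2) one_pos (by norm_num) z1 (by linarith)
  have hG0' : 0 < ‖Complex.Gamma (1-s)‖ := norm_pos_iff.2 hG0
  have hnz : ‖riemannZeta s‖ = 2 * (2*Real.pi)^(-(1-s.re)) * ‖Complex.Gamma (1-s)‖ * ‖Complex.cos (Real.pi * (1-s)/2)‖ * ‖riemannZeta (1-s)‖ := by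
    rw [hfe, norm_mul, norm_mul, norm_mul, norm_mul, Complex.norm_two]
    rw [show (2*Real.pi:ℂ) = ((2*Real.pi:ℝ):ℂ) by push_cast; ring, Complex.norm_cpow_eq_rpow_re_of_pos (by positivity)]
    simp
  have hz0 : 0 < ‖riemannZeta (1-s)‖ := by linarith
  refine ⟨?_, ?_⟩
  · rw [← norm_pos_iff, hnz]; positivity
  rw [hnz, Real.log_mul (by positivity) hz0.ne', Real.log_mul (by positivity) hcos0.ne', Real.log_mul (by positivity) hG0'.ne',
    Real.log_mul (by norm_num) (by positivity), Real.log_rpow (by positivity), Real.log_mul (by norm_num) hpi.ne']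
  have hX := XX_double (s := s) (by linarith) (by linarith)
  rw [Real.log_exp] at b2
  rw [Real.log_one] at b3
  rw [one_div, Real.log_inv, Real.log_pow] at b1
  have l4 : Real.log 4 ≤ 3 := by have := Real.log_le_sub_one_of_pos (show (0:ℝ)<4 by norm_num); linarith
  have l3 : Real.log 3 ≤ 2 := by have := Real.log_le_sub_one_of_pos (show (0:ℝ)<3 by norm_num); linarith
  have l2 : Real.log 2 ≤ 1 := by have := Real.log_le_sub_one_of_pos (show (0:ℝ)<2 by norm_num); linarith
  have l20 : 0 ≤ Real.log 2 := Real.log_nonneg (by norm_num)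
  rw [← ha] at hX
  rw [abs_le] at b1 b2 b3 hX ⊢
  push_cast at b1
  have e7 : (1 - (2*s.re-1))/2 = 1 - s.re := by ring
  rw [e7] at hlog
  constructor <;> linarith [b1.1, b1.2, b2.1, b2.2, b3.1, b3.2, hX.1, hX.2]
end RZ

namespace RZ
open Filter Topology Set Complex

theorem norm_Gamma_le {z : ℂ} (hz : 0 < z.re) : ‖Complex.Gamma z‖ ≤ Real.Gamma z.re := by
  rw [Complex.Gamma_eq_integral hz, Real.Gamma_eq_integral hz, Complex.GammaIntegral]
  refine (norm_integral_le_integral_norm _).trans (le_of_eq ?_)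
  refine setIntegral_congr_fun measurableSet_Ioi fun x hx => ?_
  simp only [norm_mul, Complex.norm_real, Real.norm_eq_abs, Real.abs_exp]
  rw [Complex.norm_cpow_eq_rpow_re_of_pos hx]; simp

theorem Gamma_real_bound {x : ℝ} (hx : 2 ≤ x) : Real.Gamma x ≤ Real.exp ((x+2)*Real.log (x+2)) := by
  set n := ⌈x⌉₊ + 1
  have h1 : x ≤ (n:ℝ) := by simp only [n]; push_cast; linarith [Nat.le_ceil x]
  have h2 : (n:ℝ) ≤ x+2 := by simp only [n]; push_cast; linarith [Nat.ceil_lt_add_one (by linarith : 0 ≤ x)]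
  have h3 : Real.Gamma x ≤ Real.Gamma ((n:ℝ)+1) := Real.Gamma_strictMonoOn_Ici.monotoneOn hx (by simp only [mem_Ici]; linarith) (by linarith)
  rw [Real.Gamma_nat_eq_factorial] at h3
  have h4 : ((n.factorial:ℕ):ℝ) ≤ (n:ℝ)^n := by exact_mod_cast Nat.factorial_le_pow n
  have hn0 : (0:ℝ) < n := by linarith
  calc _ ≤ (n:ℝ)^n := h3.trans h4
    _ = Real.exp (n * Real.log n) := by rw [← Real.log_pow, Real.exp_log (by positivity)]
    _ ≤ _ := by
      apply Real.exp_le_exp.2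
      have : Real.log n ≤ Real.log (x+2) := Real.log_le_log hn0 h2
      have : 0 ≤ Real.log n := Real.log_nonneg (by linarith)
      nlinarith

theorem lam0_bound : ∃ M : ℝ, 0 < M ∧ ∀ s : ℂ, 0 ≤ s.re → s.re ≤ 4 → ‖completedRiemannZeta₀ s‖ ≤ M := by
  set f := (HurwitzZeta.hurwitzEvenFEPair 0).f_modif
  have hconv : ∀ s : ℂ, MellinConvergent f s := fun s =>
    ((HurwitzZeta.hurwitzEvenFEPair 0).isStrongFEPair_toStrongFEPair.hasMellin s).1
  have i0 := (hconv 0).norm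
  have i2 := (hconv 2).norm
  set g : ℝ → ℝ := fun t => ‖(t:ℂ)^((0:ℂ)-1) • f t‖ + ‖(t:ℂ)^((2:ℂ)-1) • f t‖
  have hg : IntegrableOn g (Ioi 0) := i0.add i2
  have hg0 : 0 ≤ ∫ t in Ioi (0:ℝ), g t := integral_nonneg fun t => by positivity
  refine ⟨(∫ t in Ioi (0:ℝ), g t)/2+1, by positivity, fun s h0 h4 => ?_⟩
  have e : completedRiemannZeta₀ s = (mellin f (s/2))/2 := rfl
  rw [e, norm_div, Complex.norm_two]
  have : ‖mellin f (s/2)‖ ≤ ∫ t in Ioi (0:ℝ), g t := by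
    rw [mellin]
    refine norm_integral_le_of_norm_le hg ?_
    refine (ae_restrict_iff' measurableSet_Ioi).2 (Eventually.of_forall fun t ht => ?_)
    simp only [g, norm_smul]
    rw [← add_mul]
    gcongr
    rw [Complex.norm_cpow_eq_rpow_re_of_pos ht, Complex.norm_cpow_eq_rpow_re_of_pos ht, Complex.norm_cpow_eq_rpow_re_of_pos ht]
    have hre : (s/2-1).re = s.re/2-1 := by simp
    rw [hre]
    have a1 : ((0:ℂ)-1).re = -1 := by simp
    have a2 : ((2:ℂ)-1).re = 1 := by norm_num
    rw [a1, a2]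
    have ht' : (0:ℝ) < t := ht
    have p1 := Real.rpow_nonneg ht'.le (-1:ℝ)
    have p2 := Real.rpow_nonneg ht'.le (1:ℝ)
    rcases le_total t 1 with h | h
    · have := Real.rpow_le_rpow_of_exponent_ge ht' h (show (-1:ℝ) ≤ s.re/2-1 by linarith)
      exact this.trans (le_add_of_nonneg_right p2)
    · have := Real.rpow_le_rpow_of_exponent_le h (show s.re/2-1 ≤ (1:ℝ) by linarith)
      exact this.trans (le_add_of_nonneg_left p1)
  linarith

theorem norm_sin_le_exp (z : ℂ) : ‖Complex.sin z‖ ≤ Real.exp ‖z‖ := by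
  have hc : Complex.sin z = (Complex.exp (-z*I) - Complex.exp (z*I)) * I/2 := rfl
  have hle : ∀ w : ℂ, ‖w‖ = ‖z‖ → ‖Complex.exp w‖ ≤ Real.exp ‖z‖ := by
    intro w hw
    rw [Complex.norm_exp]
    exact Real.exp_le_exp.2 (hw ▸ Complex.re_le_norm w)
  rw [hc, norm_div, norm_mul, Complex.norm_I, Complex.norm_two, mul_one]
  have h1 := hle (-z*I) (by simp)
  have h2 := hle (z*I) (by simp)
  have := norm_sub_le (Complex.exp (-z*I)) (Complex.exp (z*I))
  linarith

theorem norm_cos_le_exp (z : ℂ) : ‖Complex.cos z‖ ≤ Real.exp ‖z‖ := by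
  have hc : Complex.cos z = (Complex.exp (z*I) + Complex.exp (-z*I))/2 := rfl
  have hle : ∀ w : ℂ, ‖w‖ = ‖z‖ → ‖Complex.exp w‖ ≤ Real.exp ‖z‖ := by
    intro w hw
    rw [Complex.norm_exp]
    exact Real.exp_le_exp.2 (hw ▸ Complex.re_le_norm w)
  rw [hc, norm_div, Complex.norm_two]
  have h1 := hle (-z*I) (by simp)
  have h2 := hle (z*I) (by simp)
  have := norm_add_le (Complex.exp (z*I)) (Complex.exp (-z*I))
  linarith

theorem Gamma_shift {w : ℂ} (h0 : 0 ≤ w.re) (h1 : w.re ≤ 2) (h2 : 1/2 ≤ w.im) : ‖Complex.Gamma (1-w)‖ ≤ 48 := by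
  have im1 : ∀ k : ℝ, 1/2 ≤ ‖(k:ℂ)-w‖ := by
    intro k
    have := Complex.abs_im_le_norm ((k:ℂ)-w)
    simp only [Complex.sub_im, Complex.ofReal_im, zero_sub, abs_neg] at this
    have := le_abs_self w.im
    linarith
  have hne : ∀ k : ℝ, (k:ℂ)-w ≠ 0 := by
    intro k h; have := im1 k; rw [h, norm_zero] at this; norm_num at this
  have g1 := Complex.Gamma_add_one _ (hne 1)
  have g2 := Complex.Gamma_add_one _ (hne 2)
  have g3 := Complex.Gamma_add_one _ (hne 3)
  rw [show ((1:ℝ):ℂ)-w+1 = ((2:ℝ):ℂ)-w by push_cast; ring] at g1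
  rw [show ((2:ℝ):ℂ)-w+1 = ((3:ℝ):ℂ)-w by push_cast; ring] at g2
  rw [g2, g1] at g3
  have hre : (((3:ℝ):ℂ)-w+1).re = 4 - w.re := by simp; ring
  have hb := norm_Gamma_le (z := ((3:ℝ):ℂ)-w+1) (by rw [hre]; linarith)
  have hb2 : Real.Gamma (4-w.re) ≤ 6 := by
    have := Real.Gamma_strictMonoOn_Ici.monotoneOn (a := 4-w.re) (b := ((3:ℕ):ℝ)+1) (by simp only [mem_Ici]; linarith) (by simp only [mem_Ici]; norm_num) (by push_cast; linarith)
    rw [Real.Gamma_nat_eq_factorial] at this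
    simpa [Nat.factorial] using this
  rw [hre, g3, norm_mul, norm_mul, norm_mul] at hb
  have e1 : Complex.Gamma (1-w) = Complex.Gamma (((1:ℝ):ℂ)-w) := by norm_num
  rw [e1]
  set G := ‖Complex.Gamma (((1:ℝ):ℂ)-w)‖
  have hG : 0 ≤ G := norm_nonneg _
  have : 1/2*(1/2*(1/2*G)) ≤ ‖((3:ℝ):ℂ)-w‖ * (‖((2:ℝ):ℂ)-w‖ * (‖((1:ℝ):ℂ)-w‖ * G)) := by
    gcongr
    · exact im1 3
    · exact im1 2
    · exact im1 1
  linarith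

theorem zeta_strip : ∃ C : ℝ, 0 ≤ C ∧ ∀ s : ℂ, 0 ≤ s.re → 1 ≤ s.im → ‖riemannZeta s‖ ≤ Real.exp (C + 2 * ‖s‖) := by
  obtain ⟨M, hM, hb⟩ := lam0_bound
  set C := Real.log ((M+2)*(Real.pi^2*48))
  have hpi := Real.pi_gt_three
  have harg : 1 ≤ (M+2)*(Real.pi^2*48) := by nlinarith
  have hC : 0 ≤ C := Real.log_nonneg harg
  refine ⟨C, hC, fun s h0 ht => ?_⟩
  rcases le_total 3 s.re with h3 | h3
  · have hz := zeta_right h3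
    have z2 : ‖riemannZeta s‖ ≤ 2 := by
      have := norm_add_le (1:ℂ) (riemannZeta s - 1); rw [norm_one, add_sub_cancel] at this; linarith
    have h9 := Complex.re_le_norm s
    have := Real.add_one_le_exp (C+2*‖s‖)
    linarith
  have hs1 : 1 ≤ ‖s‖ := ht.trans (Complex.im_le_norm s)
  have hs0 : s ≠ 0 := by rintro rfl; simp at ht; linarith
  have hs1' : 1 ≤ ‖1-s‖ := by
    have := Complex.abs_im_le_norm (1-s)
    simp only [Complex.sub_im, Complex.one_im, zero_sub, abs_neg] at this
    have := le_abs_self s.im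
    linarith
  rw [riemannZeta_eq_completedRiemannZeta₀ hs0]
  set w := s/2 with hw
  have hwre : w.re = s.re/2 := by simp [hw]
  have hwim : w.im = s.im/2 := by simp [hw]
  have hrefl := Complex.Gamma_mul_Gamma_one_sub w
  have hG := Gamma_shift (w := w) (by rw [hwre]; linarith) (by rw [hwre]; linarith) (by rw [hwim]; linarith)
  have hsin : Complex.sin (Real.pi * w) ≠ 0 := by
    rw [Complex.sin_ne_zero_iff]
    intro k hk
    have := congrArg Complex.im hk
    rw [mul_comm (k:ℂ), Complex.im_ofReal_mul, Complex.im_ofReal_mul] at this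
    have h2 : Real.pi * w.im = 0 := by
      rw [this]; simp
    rw [hwim] at h2
    have := Real.pi_pos
    nlinarith
  have hpic : (Real.pi:ℂ) ≠ 0 := by exact_mod_cast (by linarith : Real.pi ≠ 0)
  have hGw : Complex.Gamma w ≠ 0 := by
    intro h; rw [h, zero_mul] at hrefl
    exact (div_ne_zero hpic hsin) hrefl.symm
  have hGi : ‖(Complex.Gamma w)⁻¹‖ ≤ 48 * Real.exp (Real.pi*‖w‖)/Real.pi := by
    have e : (Complex.Gamma w)⁻¹ = Complex.Gamma (1-w) * Complex.sin (Real.pi*w)/Real.pi := by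
      rw [eq_div_iff hpic, inv_mul_eq_iff_eq_mul₀ hGw, ← mul_assoc, hrefl, div_mul_cancel₀ _ hsin]
    rw [e, norm_div, norm_mul, Complex.norm_real, Real.norm_eq_abs, abs_of_pos (by linarith)]
    have := norm_sin_le_exp (Real.pi*w)
    rw [norm_mul, Complex.norm_real, Real.norm_eq_abs, abs_of_pos (by linarith)] at this
    gcongr
  have hpw : ‖((Real.pi:ℂ)^(-s/2))⁻¹‖ ≤ Real.pi^2 := by
    rw [norm_inv, Complex.norm_cpow_eq_rpow_re_of_pos (by linarith), ← Real.rpow_neg (by linarith)]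
    have : -(-s/2).re = s.re/2 := by simp; ring
    rw [this, ← Real.rpow_natCast]
    exact Real.rpow_le_rpow_of_exponent_le (by linarith) (by push_cast; linarith)
  have hnum : ‖completedRiemannZeta₀ s - 1/s - 1/(1-s)‖ ≤ M+2 := by
    have k1 : ‖1/s‖ ≤ 1 := by rw [norm_div, norm_one, div_le_one] <;> linarith
    have k2 : ‖1/(1-s)‖ ≤ 1 := by rw [norm_div, norm_one, div_le_one] <;> linarith
    have := norm_sub_le (completedRiemannZeta₀ s - 1/s) (1/(1-s))
    have := norm_sub_le (completedRiemannZeta₀ s) (1/s)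
    have := hb s h0 (by linarith)
    linarith
  rw [div_eq_mul_inv, mul_inv, norm_mul, norm_mul]
  have hnw : ‖w‖ = ‖s‖/2 := by rw [hw, norm_div, Complex.norm_two]
  calc _ ≤ (M+2) * (Real.pi^2 * (48 * Real.exp (Real.pi*‖w‖)/Real.pi)) := by gcongr
    _ ≤ (M+2) * (Real.pi^2 * (48 * Real.exp (Real.pi*‖w‖))) := by
        gcongr; apply div_le_self (by positivity); linarith
    _ = Real.exp (C + Real.pi*‖w‖) := by
        rw [Real.exp_add, Real.exp_log (by linarith)]; ring
    _ ≤ _ := by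
        apply Real.exp_le_exp.2
        rw [hnw]; nlinarith [Real.pi_lt_four]

theorem zeta_crude : ∃ C : ℝ, 0 < C ∧ ∀ (s : ℂ) (K : ℝ), 3 ≤ K → ‖s‖ ≤ K → 1 ≤ s.im →
    ‖riemannZeta s‖ ≤ Real.exp (C * (K * Real.log K)) := by
  obtain ⟨C, hC, hz⟩ := zeta_strip
  refine ⟨C + 20, by linarith, fun s K hK hs ht => ?_⟩
  have hl : 1 ≤ Real.log K := by
    rw [Real.le_log_iff_exp_le (by linarith)]
    linarith [Real.exp_one_lt_three]
  have hKl : K ≤ K * Real.log K := by nlinarith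
  rcases le_total 0 s.re with h0 | h0
  · refine (hz s h0 ht).trans (Real.exp_le_exp.2 ?_)
    nlinarith
  have hpi := Real.pi_gt_three
  have hpi4 := Real.pi_lt_four
  have hw : ∀ n : ℕ, (1-s) ≠ -(n:ℂ) := by
    intro n hn
    have := congrArg Complex.im hn
    simp at this; linarith
  have hfe := riemannZeta_one_sub (s := 1-s) hw (by
    intro hn; have := congrArg Complex.im hn
    simp at this; linarith)
  rw [sub_sub_cancel] at hfe
  have hconj : ‖riemannZeta (1-s)‖ ≤ Real.exp (C + 2*(1+K)) := by
    have e : ‖riemannZeta (1-s)‖ = ‖riemannZeta ((starRingEnd ℂ) (1-s))‖ := by rw [riemannZeta_conj, Complex.norm_conj]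
    rw [e]
    refine (hz _ (by simp; linarith) (by simp; linarith)).trans (Real.exp_le_exp.2 ?_)
    rw [Complex.norm_conj]
    have := norm_sub_le (1:ℂ) s
    rw [norm_one] at this
    linarith
  have hn1 : ‖1-s‖ ≤ 1+K := by
    have := norm_sub_le (1:ℂ) s
    rw [norm_one] at this
    linarith
  have hs1' : 1 ≤ ‖1-s‖ := by
    have := Complex.abs_im_le_norm (1-s)
    simp only [Complex.sub_im, Complex.one_im, zero_sub, abs_neg] at this
    have := le_abs_self s.im
    linarith
  have hsr : -s.re ≤ K := ((neg_le_abs _).trans (Complex.abs_re_le_norm s)).trans hs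
  have hl2 : Real.log (K+4) ≤ 2 * Real.log K := by
    rw [← Real.log_rpow (by linarith)]
    apply Real.log_le_log (by linarith)
    rw [show (K:ℝ)^(2:ℝ) = K^2 by exact_mod_cast Real.rpow_natCast K 2]
    nlinarith
  have hG : ‖Complex.Gamma (1-s)‖ ≤ Real.exp ((K+4)*(2*Real.log K)) := by
    have g := Complex.Gamma_add_one (1-s) (by intro h; rw [h, norm_zero] at hs1'; linarith)
    have hb := norm_Gamma_le (z := 1-s+1) (by simp; linarith)
    have hre : (1-s+1).re = 2-s.re := by simp; ring
    rw [hre] at hb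
    have hb2 := hb.trans (Gamma_real_bound (by linarith))
    rw [g, norm_mul] at hb2
    have k1 : Real.exp ((2 - s.re + 2) * Real.log (2 - s.re + 2)) ≤ Real.exp ((K+4)*(2*Real.log K)) := by
      apply Real.exp_le_exp.2
      have : Real.log (2-s.re+2) ≤ Real.log (K+4) := Real.log_le_log (by linarith) (by linarith)
      have h00 : 0 ≤ Real.log (2-s.re+2) := Real.log_nonneg (by linarith)
      apply mul_le_mul (by linarith) (by linarith) h00 (by linarith)
    have := norm_nonneg (Complex.Gamma (1-s))
    nlinarith
  have hcos : ‖Complex.cos (Real.pi * (1-s)/2)‖ ≤ Real.exp (2*(1+K)) := by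
    refine (norm_cos_le_exp _).trans (Real.exp_le_exp.2 ?_)
    rw [norm_div, norm_mul, Complex.norm_real, Real.norm_eq_abs, abs_of_pos (by linarith), Complex.norm_two]
    nlinarith [norm_nonneg (1-s)]
  have h2p : ‖(2*Real.pi:ℂ)^(-(1-s))‖ ≤ 1 := by
    rw [show (2*Real.pi:ℂ) = ((2*Real.pi:ℝ):ℂ) by push_cast; ring, Complex.norm_cpow_eq_rpow_re_of_pos (by positivity)]
    apply Real.rpow_le_one_of_one_le_of_nonpos (by linarith)
    simp; linarith
  have h2e : ‖(2:ℂ)‖ ≤ Real.exp 1 := by rw [Complex.norm_two]; linarith [Real.add_one_le_exp (1:ℝ)]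
  rw [hfe, norm_mul, norm_mul, norm_mul, norm_mul]
  calc _ ≤ Real.exp 1 * 1 * Real.exp ((K+4)*(2*Real.log K)) * Real.exp (2*(1+K)) * Real.exp (C + 2*(1+K)) := by gcongr
    _ = Real.exp (1 + (K+4)*(2*Real.log K) + 2*(1+K) + (C+2*(1+K))) := by
      rw [mul_one, ← Real.exp_add, ← Real.exp_add, ← Real.exp_add]
    _ ≤ _ := by
      apply Real.exp_le_exp.2
      nlinarith
end RZ

namespace RZ
open Filter Topology Set Complex

theorem jensen_finset {f : ℂ → ℂ} {c : ℂ} {r : ℝ} (hr : 0 < r)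
    (hf : AnalyticOnNhd ℂ f (Metric.closedBall c r)) (hc : f c ≠ 0) (Z : Finset ℂ)
    (hZ : ∀ u ∈ Metric.closedBall c r, f u = 0 → u ∈ Z) :
    Real.circleAverage (fun z => Real.log ‖f z‖) c r =
      ∑ ρ ∈ Z, (analyticOrderNatAt f ρ : ℝ) * Real.posLog (r / ‖c - ρ‖) + Real.log ‖f c‖ := by
  have hab : |r| = r := abs_of_pos hr
  have hf' : AnalyticOnNhd ℂ f (Metric.closedBall c |r|) := by rwa [hab]
  have := AnalyticOnNhd.circleAverage_log_norm hr.ne' hf' hc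
  have hdiv : ∀ u ∈ Metric.closedBall c r, ((MeromorphicOn.divisor f (Metric.closedBall c r) u : ℤ) : ℝ) = (analyticOrderNatAt f u : ℝ) := by
    intro u hu
    rw [MeromorphicOn.AnalyticOnNhd.divisor_apply hf hu, analyticOrderNatAt]
    cases analyticOrderAt f u with
    | top => simp
    | coe n => simp
  rw [this, hab]
  congr 1
  rw [finsum_eq_sum_of_support_subset (s := Z)]
  · refine Finset.sum_congr rfl fun ρ hρ => ?_
    by_cases hm : ρ ∈ Metric.closedBall c r
    · rw [hdiv ρ hm]
      have e : r * ‖c - ρ‖⁻¹ = r/‖c-ρ‖ := rfl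
      rw [e]
      by_cases h0 : ρ = c
      · subst h0; simp
      congr 1
      rw [Real.posLog_eq_log]
      rw [abs_of_nonneg (by positivity), le_div_iff₀ (by rw [norm_pos_iff, sub_ne_zero]; exact Ne.symm h0)]
      rw [Metric.mem_closedBall, dist_comm, dist_eq_norm] at hm
      linarith
    · rw [Function.locallyFinsuppWithin.apply_eq_zero_of_notMem _ hm]
      rw [(Real.posLog_eq_zero_iff _).2]
      · simp
      · rw [Metric.mem_closedBall, dist_comm, dist_eq_norm, not_le] at hm
        rw [abs_of_nonneg (by positivity), div_le_one (by linarith)]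
        exact hm.le
  · intro u hu
    by_contra hn
    apply hu
    by_cases hm : u ∈ Metric.closedBall c r
    · have : f u ≠ 0 := fun h => hn (hZ u hm h)
      simp only
      rw [hdiv u hm, analyticOrderNatAt, (hf u hm).analyticOrderAt_eq_zero.2 this]
      simp
    · simp only
      rw [Function.locallyFinsuppWithin.apply_eq_zero_of_notMem _ hm]
      simp

/-- cosine change of variables -/
theorem cos_change (G : ℝ → ENNReal) {r : ℝ} (hr : 0 < r) :
    ∫⁻ x in Ioo (-r) r, G x = ∫⁻ θ in Ioo 0 Real.pi, ENNReal.ofReal (r * Real.sin θ) * G (r * Real.cos θ) := by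
  have him : Set.image (fun θ => r * Real.cos θ) (Ioo 0 Real.pi) = Ioo (-r) r := by
    ext x
    constructor
    · rintro ⟨θ, hθ, rfl⟩
      have h1 : Real.cos θ < 1 := by
        have := Real.strictAntiOn_cos (left_mem_Icc.2 Real.pi_pos.le) (Ioo_subset_Icc_self hθ) hθ.1
        rwa [Real.cos_zero] at this
      have h2 : -1 < Real.cos θ := by
        have := Real.strictAntiOn_cos (Ioo_subset_Icc_self hθ) (right_mem_Icc.2 Real.pi_pos.le) hθ.2
        rwa [Real.cos_pi] at this
      constructor <;> simp only <;> nlinarith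
    · rintro ⟨h1, h2⟩
      have k1 : -1 < x/r := by rw [lt_div_iff₀ hr]; linarith
      have k2 : x/r < 1 := by rw [div_lt_iff₀ hr]; linarith
      refine ⟨Real.arccos (x/r), ⟨Real.arccos_pos.2 k2, ?_⟩, ?_⟩
      · rcases (Real.arccos_le_pi (x/r)).lt_or_eq with h | h
        · exact h
        · rw [Real.arccos_eq_pi] at h; linarith
      · simp only
        rw [Real.cos_arccos k1.le k2.le]; field_simp
  have := lintegral_image_eq_lintegral_abs_deriv_mul (s := Ioo 0 Real.pi) (f := fun θ => r * Real.cos θ)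
    (f' := fun θ => r * (-Real.sin θ)) measurableSet_Ioo
    (fun x _ => ((Real.hasDerivAt_cos x).const_mul r).hasDerivWithinAt)
    (fun a ha b hb hab => Real.injOn_cos (Ioo_subset_Icc_self ha) (Ioo_subset_Icc_self hb)
      (mul_left_cancel₀ hr.ne' hab)) G
  rw [him] at this
  rw [this]
  refine setLIntegral_congr_fun measurableSet_Ioo fun θ hθ => ?_
  congr 2
  rw [mul_neg, abs_neg, abs_of_nonneg]
  exact mul_nonneg hr.le (Real.sin_pos_of_mem_Ioo hθ).le

theorem cos_down (G : ℝ → ENNReal) {r : ℝ} (hr : 0 < r) :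
    ∫⁻ x in Ioo (-r) r, G x ≤ ENNReal.ofReal r * ∫⁻ θ in Ioc 0 (2*Real.pi), G (r * Real.cos θ) := by
  rw [cos_change G hr]
  rw [← lintegral_const_mul' _ _ ENNReal.ofReal_ne_top]
  refine (setLIntegral_mono_ae' measurableSet_Ioo (ae_of_all _ fun θ hθ => ?_)).trans
    (lintegral_mono_set (show Ioo 0 Real.pi ⊆ Ioc 0 (2*Real.pi) from fun x hx => ⟨hx.1, by
      have := Real.pi_pos; have := hx.2; linarith⟩))
  gcongr
  have := Real.sin_le_one θ
  nlinarith

theorem cos_up (G : ℝ → ENNReal) {r w : ℝ} (hr : 0 < r) (hw : 2*w ≤ r)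
    (h0 : ∀ x, ¬ (-w < x ∧ x < 0) → G x = 0) :
    ENNReal.ofReal r * ∫⁻ θ in Ioc 0 (2*Real.pi), G (r * Real.cos θ) ≤ 4 * ∫⁻ x, G x := by
  have hpi := Real.pi_pos
  have key : ENNReal.ofReal r * ∫⁻ θ in Ioo 0 Real.pi, G (r * Real.cos θ) ≤ 2 * ∫⁻ x, G x := by
    refine le_trans ?_ (mul_le_mul_right (setLIntegral_le_lintegral (Ioo (-r) r) G) 2)
    rw [cos_change G hr, ← lintegral_const_mul' _ _ ENNReal.ofReal_ne_top, ← lintegral_const_mul' _ _ (by simp)]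
    refine setLIntegral_mono_ae' measurableSet_Ioo (ae_of_all _ fun θ hθ => ?_)
    by_cases h : -w < r * Real.cos θ ∧ r * Real.cos θ < 0
    · rw [← mul_assoc]
      gcongr
      rw [show (2:ENNReal) = ENNReal.ofReal 2 by simp, ← ENNReal.ofReal_mul (by norm_num)]
      apply ENNReal.ofReal_le_ofReal
      have hs := Real.sin_pos_of_mem_Ioo hθ
      have hc1 : Real.cos θ < 0 := by nlinarith
      have hc2 : -(1/2) < Real.cos θ := by nlinarith
      have := Real.sin_sq_add_cos_sq θ
      have : 1/2 ≤ Real.sin θ := by nlinarith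
      nlinarith
    · rw [h0 _ h]; simp
  have hsplit : ∫⁻ θ in Ioc 0 (2*Real.pi), G (r * Real.cos θ) ≤
      (∫⁻ θ in Ioo 0 Real.pi, G (r * Real.cos θ)) + ∫⁻ θ in Ioo 0 Real.pi, G (r * Real.cos θ) := by
    have e2 : ∫⁻ θ in Ioo Real.pi (2*Real.pi), G (r * Real.cos θ) = ∫⁻ θ in Ioo 0 Real.pi, G (r * Real.cos θ) := by
      rw [← lintegral_indicator measurableSet_Ioo, ← lintegral_indicator measurableSet_Ioo]
      rw [← lintegral_sub_left_eq_self _ (2*Real.pi)]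
      congr 1
      ext θ
      by_cases hθ : θ ∈ Ioo 0 Real.pi
      · rw [indicator_of_mem hθ, indicator_of_mem (show 2*Real.pi - θ ∈ Ioo Real.pi (2*Real.pi) from ⟨by linarith [hθ.2], by linarith [hθ.1]⟩)]
        rw [Real.cos_two_pi_sub]
      · rw [indicator_of_notMem hθ, indicator_of_notMem]
        intro h
        exact hθ ⟨by linarith [h.2], by linarith [h.1]⟩
    have e3 : Ioc (0:ℝ) (2*Real.pi) ⊆ (Ioo 0 Real.pi ∪ Ioo Real.pi (2*Real.pi)) ∪ {Real.pi, 2*Real.pi} := by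
      intro x hx
      rcases lt_trichotomy x Real.pi with h | h | h
      · exact Or.inl (Or.inl ⟨hx.1, h⟩)
      · exact Or.inr (Or.inl h)
      · rcases hx.2.lt_or_eq with h' | h'
        · exact Or.inl (Or.inr ⟨h, h'⟩)
        · exact Or.inr (Or.inr h')
    refine (lintegral_mono_set e3).trans ((lintegral_union_le _ _ _).trans ?_)
    have e4 : ∫⁻ θ in ({Real.pi, 2*Real.pi} : Set ℝ), G (r * Real.cos θ) = 0 :=
      setLIntegral_measure_zero _ _ (Set.Finite.measure_zero (by simp) _)
    rw [e4, add_zero]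
    refine (lintegral_union_le _ _ _).trans ?_
    rw [e2]
  refine (mul_le_mul_right hsplit _).trans ?_
  rw [mul_add]
  refine (add_le_add key key).trans (le_of_eq ?_)
  rw [← add_mul]; norm_num
end RZ

namespace RZ
open Filter Topology Set Complex

noncomputable def gk (r δ x : ℝ) : ℝ := Real.posLog (r / ‖(⟨δ, x⟩ : ℂ)‖)

theorem gk_nonneg (r δ x : ℝ) : 0 ≤ gk r δ x := Real.posLog_nonneg

theorem gk_neg (r δ x : ℝ) : gk r δ (-x) = gk r δ x := by
  unfold gk
  have : (⟨δ, -x⟩ : ℂ) = (starRingEnd ℂ) ⟨δ, x⟩ := by apply Complex.ext <;> simp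
  rw [this, RCLike.norm_conj]

theorem gk_cont {r δ : ℝ} (hδ : 0 < δ) : Continuous (gk r δ) := by
  unfold gk
  apply Real.continuous_posLog.comp
  have h : Continuous fun x : ℝ => ‖(⟨δ, x⟩ : ℂ)‖ := by
    have : (fun x : ℝ => ‖(⟨δ, x⟩ : ℂ)‖) = fun x : ℝ => ‖(δ:ℂ) + x * I‖ := by
      ext x; congr 1; apply Complex.ext <;> simp
    rw [this]; fun_prop
  refine continuous_const.div h fun x hx => ?_
  rw [norm_eq_zero] at hx
  have := congrArg Complex.re hx
  simp at this
  linarith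

theorem gk_norm_ge (δ x : ℝ) : |x| ≤ ‖(⟨δ, x⟩ : ℂ)‖ := Complex.abs_im_le_norm ⟨δ, x⟩

theorem gk_norm_le {δ x : ℝ} (hδ : 0 ≤ δ) : ‖(⟨δ, x⟩ : ℂ)‖ ≤ δ + |x| := by
  have := Complex.norm_le_abs_re_add_abs_im ⟨δ, x⟩
  simp only [abs_of_nonneg hδ] at this
  exact this

theorem gk_zero {r δ x : ℝ} (hr : 0 < r) (hx : r ≤ |x|) : gk r δ x = 0 := by
  unfold gk
  rw [Real.posLog_eq_zero_iff]
  have := gk_norm_ge δ x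
  rw [abs_of_nonneg (by positivity), div_le_one (by linarith)]
  linarith

theorem gk_supp {r δ : ℝ} (hr : 0 < r) : Function.support (gk r δ) ⊆ Ioc (-r) r := by
  intro x hx
  by_contra h
  apply hx
  apply gk_zero hr
  rw [le_abs]
  by_contra hh
  push Not at hh
  exact h ⟨by linarith, by linarith⟩

theorem gk_integrable {r δ : ℝ} (hr : 0 < r) (hδ : 0 < δ) : Integrable (gk r δ) := by
  apply (integrableOn_iff_integrable_of_support_subset (gk_supp hr)).1
  exact ((gk_cont hδ).integrableOn_Icc).mono_set Ioc_subset_Icc_self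

theorem gk_total {r δ : ℝ} (hr : 0 < r) (hδ : 0 < δ) : ∫ x, gk r δ x = 2 * ∫ x in (0:ℝ)..r, gk r δ x := by
  rw [← setIntegral_eq_integral_of_forall_compl_eq_zero (s := Ioc (-r) r)
    (fun x hx => by by_contra h; exact hx (gk_supp hr h)), ← intervalIntegral.integral_of_le (by linarith)]
  have hi : ∀ a b, IntervalIntegrable (gk r δ) volume a b := fun a b => (gk_cont hδ).intervalIntegrable a b
  rw [← intervalIntegral.integral_add_adjacent_intervals (hi (-r) 0) (hi 0 r)]
  have : ∫ x in (-r)..0, gk r δ x = ∫ x in (0:ℝ)..r, gk r δ x := by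
    have := intervalIntegral.integral_comp_neg (a := 0) (b := r) (gk r δ)
    simp only [gk_neg, neg_zero] at this
    exact this.symm
  rw [this]; ring

theorem gk_le {r δ : ℝ} (hr : 0 < r) (hδ : 0 < δ) : ∫ x, gk r δ x ≤ 2 * r := by
  rw [gk_total hr hδ]
  have h : ∫ x in (0:ℝ)..r, gk r δ x ≤ ∫ x in (0:ℝ)..r, (Real.log r - Real.log x) := by
    apply intervalIntegral.integral_mono_on_of_le_Ioo hr.le
    · exact (gk_cont hδ).intervalIntegrable _ _
    · exact intervalIntegrable_const.sub intervalIntegral.intervalIntegrable_log'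
    · intro x hx
      unfold gk
      have h1 : r/‖(⟨δ, x⟩ : ℂ)‖ ≤ r/x := by
        have := gk_norm_ge δ x
        rw [abs_of_pos hx.1] at this
        gcongr
        exact hx.1
      refine (Real.posLog_le_posLog (by positivity) h1).trans ?_
      rw [Real.posLog_eq_log, Real.log_div hr.ne' hx.1.ne']
      rw [abs_of_nonneg (div_nonneg hr.le hx.1.le), le_div_iff₀ hx.1]
      linarith [hx.2]
  rw [intervalIntegral.integral_sub intervalIntegrable_const intervalIntegral.intervalIntegrable_log', integral_log] at h
  simp at h
  linarith

theorem gk_ge {r δ w : ℝ} (hw : 0 < w) (hwr : w < r) (hδ : 0 < δ) (hδw : δ ≤ w) :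
    2 * (r - w - w * Real.log (r/w)) ≤ ∫ x, gk r δ x := by
  have hr : 0 < r := by linarith
  rw [gk_total hr hδ]
  have h1 : ∫ x in (0:ℝ)..(r-w), gk r δ x ≤ ∫ x in (0:ℝ)..r, gk r δ x := by
    apply intervalIntegral.integral_mono_interval le_rfl (by linarith) (by linarith)
    · exact Eventually.of_forall fun x => gk_nonneg _ _ _
    · exact (gk_cont hδ).intervalIntegrable _ _
  have hii : IntervalIntegrable (fun x => Real.log r - Real.log (x+w)) volume 0 (r-w) := by
    apply ContinuousOn.intervalIntegrable
    refine continuousOn_const.sub (ContinuousOn.log (by fun_prop) ?_)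
    intro x hx
    rw [uIcc_of_le (by linarith)] at hx
    linarith [hx.1]
  have h : ∫ x in (0:ℝ)..(r-w), (Real.log r - Real.log (x+w)) ≤ ∫ x in (0:ℝ)..(r-w), gk r δ x := by
    apply intervalIntegral.integral_mono_on_of_le_Ioo (by linarith)
    · exact hii
    · exact (gk_cont hδ).intervalIntegrable _ _
    · intro x hx
      unfold gk
      have h2 := gk_norm_le (x := x) hδ.le
      have h3 := gk_norm_ge δ x
      rw [abs_of_pos hx.1] at h2 h3
      have h4 := hx.1
      rw [← Real.log_div hr.ne' (by linarith [hx.1])]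
      refine le_trans (Real.log_le_log (by apply div_pos hr; linarith) ?_) (le_max_right _ _)
      apply div_le_div_of_nonneg_left hr.le (by linarith)
      linarith
  have e : ∫ x in (0:ℝ)..(r-w), (Real.log r - Real.log (x+w)) = r - w - w * Real.log (r/w) := by
    rw [intervalIntegral.integral_comp_add_right (fun y => Real.log r - Real.log y) w,
      intervalIntegral.integral_sub intervalIntegrable_const intervalIntegral.intervalIntegrable_log',
      integral_log, Real.log_div hr.ne' hw.ne']
    simp; ring
  linarith

theorem gk_int_le {r δ : ℝ} (hr : 0 < r) (hδ : 0 < δ) {a b : ℝ} (hab : a ≤ b) (γ : ℝ) :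
    ∫ τ in a..b, gk r δ (τ - γ) ≤ 2 * r := by
  rw [intervalIntegral.integral_comp_sub_right (gk r δ), intervalIntegral.integral_of_le (by linarith)]
  exact (setIntegral_le_integral (gk_integrable hr hδ) (Eventually.of_forall fun x => gk_nonneg _ _ _)).trans (gk_le hr hδ)

theorem gk_int_ge {r δ w : ℝ} (hw : 0 < w) (hwr : w < r) (hδ : 0 < δ) (hδw : δ ≤ w) {a b γ : ℝ}
    (ha : a ≤ γ - r) (hb : γ + r ≤ b) :
    2 * (r - w - w * Real.log (r/w)) ≤ ∫ τ in a..b, gk r δ (τ - γ) := by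
  have hr : 0 < r := by linarith
  rw [intervalIntegral.integral_comp_sub_right (gk r δ), intervalIntegral.integral_of_le (by linarith)]
  rw [setIntegral_eq_integral_of_forall_compl_eq_zero]
  · exact gk_ge hw hwr hδ hδw
  · intro x hx
    by_contra h
    have := gk_supp hr h
    exact hx ⟨by linarith [this.1], by linarith [this.2]⟩

theorem gk_int_zero {r δ : ℝ} (hr : 0 < r) {a b γ : ℝ} (hab : a ≤ b) (h : γ + r ≤ a ∨ b ≤ γ - r) :
    ∫ τ in a..b, gk r δ (τ - γ) = 0 := by
  rw [intervalIntegral.integral_congr (g := fun _ => (0:ℝ))]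
  · simp
  · intro τ hτ
    rw [uIcc_of_le hab] at hτ
    apply gk_zero hr
    rw [le_abs]
    rcases h with h | h
    · left; linarith [hτ.1]
    · right; linarith [hτ.2]
end RZ

namespace RZ
open Filter Topology Set Complex

noncomputable def cc (σ0 τ : ℝ) : ℂ := (σ0:ℂ) + (τ:ℂ) * I

theorem cc_re (σ0 τ : ℝ) : (cc σ0 τ).re = σ0 := by simp [cc]
theorem cc_im (σ0 τ : ℝ) : (cc σ0 τ).im = τ := by simp [cc]

structure Hy (f : ℂ → ℂ) (σ0 T r w M E : ℝ) : Prop where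
  an : AnalyticOnNhd ℂ f {s | 0 < s.im}
  ms : Measurable f
  hw : 1 ≤ w
  hr : 8 * w ≤ r
  hT : 64 * r ≤ T
  hσ : 0 ≤ σ0
  hσw : σ0 ≤ w
  hM : 2 ≤ M
  hE : 2 ≤ E
  crude : ∀ s : ℂ, T/8 ≤ s.im → s.im ≤ 8*T → |s.re| ≤ 4*r → Real.log ‖f s‖ ≤ M
  right : ∀ s : ℂ, T/8 ≤ s.im → s.im ≤ 8*T → σ0 ≤ s.re → f s ≠ 0 ∧ |Real.log ‖f s‖| ≤ 2
  left : ∀ s : ℂ, T/8 ≤ s.im → s.im ≤ 8*T → s.re ≤ σ0 - w → f s ≠ 0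
  left' : ∀ s : ℂ, T/8 ≤ s.im → s.im ≤ 8*T → s.re ≤ σ0 - w → |s.re| ≤ 4*r → |Real.log ‖f s‖| ≤ E

def Sp (σ0 T w : ℝ) : Set ℂ := {s | (σ0 - w < s.re ∧ s.re < σ0) ∧ (T/4 ≤ s.im ∧ s.im ≤ 4*T)}

theorem Sp_meas (σ0 T w : ℝ) : MeasurableSet (Sp σ0 T w) := by
  have h1 := Complex.measurable_re
  have h2 := Complex.measurable_im
  exact (((measurableSet_lt measurable_const h1).inter (measurableSet_lt h1 measurable_const)).inter
    ((measurableSet_le measurable_const h2).inter (measurableSet_le h2 measurable_const)))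

noncomputable def vv (f : ℂ → ℂ) (σ0 T w : ℝ) : ℂ → ENNReal :=
  (Sp σ0 T w).indicator fun s => ‖Real.log ‖f s‖‖ₑ

theorem vv_meas {f : ℂ → ℂ} (hf : Measurable f) (σ0 T w : ℝ) : Measurable (vv f σ0 T w) :=
  (((Real.measurable_log.comp hf.norm)).enorm).indicator (Sp_meas _ _ _)

theorem vv_le (f : ℂ → ℂ) (σ0 T w : ℝ) (s : ℂ) : vv f σ0 T w s ≤ ‖Real.log ‖f s‖‖ₑ :=
  indicator_le_self _ _ _

theorem circle_re (c : ℂ) (r θ : ℝ) : (circleMap c r θ).re = c.re + r * Real.cos θ := by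
  simp [circleMap, Complex.exp_re]
theorem circle_im (c : ℂ) (r θ : ℝ) : (circleMap c r θ).im = c.im + r * Real.sin θ := by
  simp [circleMap, Complex.exp_im]

theorem fub {v : ℂ → ENNReal} (hv : Measurable v) (σ0 ρ : ℝ) :
    ∫⁻ τ : ℝ, ∫⁻ θ in Ioc 0 (2*Real.pi), v (circleMap (cc σ0 τ) ρ θ) =
      ∫⁻ θ in Ioc 0 (2*Real.pi), (fun x => ∫⁻ t : ℝ, v (cc (σ0 + x) t)) (ρ * Real.cos θ) := by
  rw [lintegral_lintegral_swap]
  · congr 1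
    ext θ
    have := lintegral_add_right_eq_self (μ := (volume : Measure ℝ)) (fun t => v (cc (σ0 + ρ * Real.cos θ) t)) (ρ * Real.sin θ)
    simp only
    rw [← this]
    congr 1
    ext τ
    congr 1
    apply Complex.ext
    · rw [circle_re, cc_re, cc_re]
    · rw [circle_im, cc_im, cc_im]
  · apply Measurable.aemeasurable
    apply hv.comp
    apply Continuous.measurable
    simp only [circleMap, cc]
    fun_prop

variable {f : ℂ → ℂ} {σ0 T r w M E : ℝ}

theorem Hy.ball (H : Hy f σ0 T r w M E) {τ ρ : ℝ} (h1 : T/6 ≤ τ) (h2 : τ ≤ 6*T) (hρ : 0 ≤ ρ) (hρ' : ρ ≤ r) {s : ℂ}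
    (hs : s ∈ Metric.closedBall (cc σ0 τ) ρ) : T/8 ≤ s.im ∧ s.im ≤ 8*T ∧ |s.re| ≤ 4*r := by
  rw [Metric.mem_closedBall, dist_eq_norm] at hs
  have a := (Complex.abs_re_le_norm (s - cc σ0 τ)).trans hs
  have b := (Complex.abs_im_le_norm (s - cc σ0 τ)).trans hs
  rw [Complex.sub_re, cc_re] at a
  rw [Complex.sub_im, cc_im] at b
  rw [abs_le] at a b
  have := H.hw; have := H.hr; have := H.hT; have := H.hσ; have := H.hσw
  refine ⟨by linarith, by linarith, ?_⟩
  rw [abs_le]; constructor <;> linarith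

theorem Hy.anball (H : Hy f σ0 T r w M E) {τ ρ : ℝ} (h1 : T/6 ≤ τ) (h2 : τ ≤ 6*T) (hρ : 0 ≤ ρ) (hρ' : ρ ≤ r) :
    AnalyticOnNhd ℂ f (Metric.closedBall (cc σ0 τ) ρ) := by
  intro s hs
  apply H.an
  have := (H.ball h1 h2 hρ hρ' hs).1
  have := H.hw; have := H.hr; have := H.hT
  show 0 < s.im
  linarith

theorem Hy.ci (H : Hy f σ0 T r w M E) {τ ρ : ℝ} (h1 : T/6 ≤ τ) (h2 : τ ≤ 6*T) (hρ : 0 ≤ ρ) (hρ' : ρ ≤ r) :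
    CircleIntegrable (fun z => Real.log ‖f z‖) (cc σ0 τ) ρ := by
  apply MeromorphicOn.circleIntegrable_log_norm_of_nonneg _ hρ
  exact ((H.anball h1 h2 hρ hρ').mono Metric.sphere_subset_closedBall).meromorphicOn

theorem Hy.cen (H : Hy f σ0 T r w M E) {τ : ℝ} (h1 : T/6 ≤ τ) (h2 : τ ≤ 6*T) :
    f (cc σ0 τ) ≠ 0 ∧ |Real.log ‖f (cc σ0 τ)‖| ≤ 2 := by
  have := H.hw; have := H.hr; have := H.hT
  apply H.right
  · rw [cc_im]; linarith
  · rw [cc_im]; linarith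
  · rw [cc_re]

theorem Hy.jens (H : Hy f σ0 T r w M E) {τ ρ : ℝ} (h1 : T/6 ≤ τ) (h2 : τ ≤ 6*T) (hρ : 0 < ρ) (hρ' : ρ ≤ r) :
    -2 ≤ Real.circleAverage (fun z => Real.log ‖f z‖) (cc σ0 τ) ρ := by
  have ha := H.anball h1 h2 hρ.le hρ'
  obtain ⟨hc, hl⟩ := H.cen h1 h2
  have hfin : {u ∈ Metric.closedBall (cc σ0 τ) ρ | f u = 0}.Finite := by
    have h := ha.eqOn_zero_or_eventually_ne_zero_of_preconnected (convex_closedBall _ _).isPreconnected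
    rcases h with h | h
    · exact absurd (h (Metric.mem_closedBall_self hρ.le)) hc
    · have := (isCompact_closedBall (cc σ0 τ) ρ).finite_sdiff_of_mem_codiscreteWithin h
      refine this.subset ?_
      intro x hx
      exact ⟨hx.1, fun h => h hx.2⟩
  rw [jensen_finset hρ ha hc hfin.toFinset (fun u hu h0 => by simpa using ⟨by simpa using hu, h0⟩)]
  have : 0 ≤ ∑ ρ' ∈ hfin.toFinset, (analyticOrderNatAt f ρ' : ℝ) * Real.posLog (ρ / ‖cc σ0 τ - ρ'‖) :=
    Finset.sum_nonneg fun i _ => mul_nonneg (by positivity) Real.posLog_nonneg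
  rw [abs_le] at hl
  linarith

theorem Hy.small (H : Hy f σ0 T r w M E) {τ ρ : ℝ} (h1 : T/6 ≤ τ) (h2 : τ ≤ 6*T) (hρ : 0 < ρ) (hρ' : ρ ≤ r) :
    ∫⁻ θ in Ioc 0 (2*Real.pi), ‖Real.log ‖f (circleMap (cc σ0 τ) ρ θ)‖‖ₑ ≤ ENNReal.ofReal (26*M) := by
  have hj := H.jens h1 h2 hρ hρ'
  have hi := H.ci h1 h2 hρ.le hρ'
  rw [Real.circleAverage_def, smul_eq_mul] at hj
  set g : ℝ → ℝ := fun θ => Real.log ‖f (circleMap (cc σ0 τ) ρ θ)‖ with hg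
  have hi' : IntervalIntegrable g volume 0 (2*Real.pi) := hi
  have hpi := Real.pi_pos
  have hpi4 := Real.pi_lt_d2
  have hM := H.hM
  have hj' : -(4*Real.pi) ≤ ∫ θ in 0..(2*Real.pi), g θ := by
    have := mul_le_mul_of_nonneg_left hj (show 0 ≤ 2*Real.pi by positivity)
    rw [← mul_assoc, mul_inv_cancel₀ (by positivity), one_mul] at this
    linarith
  have hgM : ∀ θ, g θ ≤ M := by
    intro θ
    obtain ⟨a, b, c⟩ := H.ball h1 h2 hρ.le hρ' (circleMap_mem_closedBall (cc σ0 τ) hρ.le θ)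
    exact H.crude _ a b c
  have hii : IntegrableOn (fun θ => 2*M - g θ) (Ioc 0 (2*Real.pi)) := by
    have : IntervalIntegrable (fun θ => 2*M - g θ) volume 0 (2*Real.pi) := intervalIntegrable_const.sub hi'
    exact this.1
  have hle : ∀ θ, ‖g θ‖ₑ ≤ ENNReal.ofReal (2*M - g θ) := by
    intro θ
    rw [Real.enorm_eq_ofReal_abs]
    apply ENNReal.ofReal_le_ofReal
    rw [abs_le]; constructor <;> linarith [hgM θ]
  refine (lintegral_mono hle).trans ?_
  rw [← ofReal_integral_eq_lintegral_ofReal hii (Eventually.of_forall fun θ => by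
    show 0 ≤ 2*M - g θ
    linarith [hgM θ])]
  apply ENNReal.ofReal_le_ofReal
  rw [← intervalIntegral.integral_of_le (by positivity), intervalIntegral.integral_sub intervalIntegrable_const hi']
  simp only [intervalIntegral.integral_const, sub_zero, smul_eq_mul]
  nlinarith

theorem Hy.strip (H : Hy f σ0 T r w M E) :
    ∫⁻ τ : ℝ, ∫⁻ θ in Ioc 0 (2*Real.pi), vv f σ0 T w (circleMap (cc σ0 τ) r θ) ≤
      ENNReal.ofReal (1248 * (w*T*M/r)) := by
  have hw := H.hw; have hr := H.hr; have hT := H.hT; have hM := H.hM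
  have hv := vv_meas H.ms σ0 T w
  set G : ℝ → ENNReal := fun x => ∫⁻ t : ℝ, vv f σ0 T w (cc (σ0 + x) t) with hG
  have hG0 : ∀ x, ¬ (-w < x ∧ x < 0) → G x = 0 := by
    intro x hx
    simp only [hG]
    rw [lintegral_eq_zero_of_ae_eq_zero]
    refine Eventually.of_forall fun t => ?_
    apply indicator_of_notMem
    intro h
    have h1 := h.1.1
    have h2 := h.1.2
    rw [cc_re] at h1 h2
    exact hx ⟨by linarith, by linarith⟩
  have hsm : ∫⁻ τ : ℝ, ∫⁻ θ in Ioc 0 (2*Real.pi), vv f σ0 T w (circleMap (cc σ0 τ) (2*w) θ) ≤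
      ENNReal.ofReal (26*M*(6*T)) := by
    have h0 : ∀ τ, τ ∉ Icc (T/6) (6*T) → ∫⁻ θ in Ioc 0 (2*Real.pi), vv f σ0 T w (circleMap (cc σ0 τ) (2*w) θ) = 0 := by
      intro τ hτ
      rw [lintegral_eq_zero_of_ae_eq_zero]
      refine Eventually.of_forall fun θ => ?_
      apply indicator_of_notMem
      intro h
      have h1 := h.2.1
      have h2 := h.2.2
      rw [circle_im, cc_im] at h1 h2
      have := Real.sin_le_one θ
      have := Real.neg_one_le_sin θ
      exact hτ ⟨by nlinarith, by nlinarith⟩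
    calc _ = ∫⁻ τ in Icc (T/6) (6*T), ∫⁻ θ in Ioc 0 (2*Real.pi), vv f σ0 T w (circleMap (cc σ0 τ) (2*w) θ) := by
            rw [setLIntegral_eq_of_support_subset]
            intro τ hτ
            by_contra h
            exact hτ (h0 τ h)
      _ ≤ ∫⁻ τ in Icc (T/6) (6*T), ENNReal.ofReal (26*M) := by
            refine setLIntegral_mono_ae' measurableSet_Icc (ae_of_all _ fun τ hτ => ?_)
            refine le_trans (lintegral_mono fun θ => vv_le _ _ _ _ _) (H.small hτ.1 hτ.2 (by linarith) (by linarith))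
      _ = ENNReal.ofReal (26*M) * ENNReal.ofReal (6*T - T/6) := by
            rw [setLIntegral_const, Real.volume_Icc]
      _ ≤ _ := by
            rw [← ENNReal.ofReal_mul (by linarith)]
            apply ENNReal.ofReal_le_ofReal
            nlinarith
  rw [fub hv] at hsm ⊢
  have hGi : ∫⁻ x, G x ≤ ENNReal.ofReal (2*w) * ENNReal.ofReal (26*M*(6*T)) := by
    refine le_trans ?_ ((cos_down G (show 0 < 2*w by linarith)).trans (mul_le_mul_right hsm _))
    rw [setLIntegral_eq_of_support_subset]
    intro x hx
    by_contra h
    apply hx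
    apply hG0
    intro h'
    exact h ⟨by linarith [h'.1], by linarith [h'.2]⟩
  have hup := cos_up G (show 0 < r by linarith) (show 2*w ≤ r by linarith) hG0
  have hr0 : 0 < r := by linarith
  have hfin : ENNReal.ofReal r * (∫⁻ θ in Ioc 0 (2*Real.pi), G (r * Real.cos θ)) ≤
      ENNReal.ofReal r * ENNReal.ofReal (1248 * (w*T*M/r)) := by
    refine hup.trans ((mul_le_mul_right hGi 4).trans ?_)
    rw [show (4:ENNReal) = ENNReal.ofReal 4 by simp, ← ENNReal.ofReal_mul (by linarith), ← ENNReal.ofReal_mul (by linarith), ← ENNReal.ofReal_mul (by linarith)]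
    apply ENNReal.ofReal_le_ofReal
    have : r * (1248 * (w*T*M/r)) = 1248 * (w*T*M) := by field_simp
    rw [this]
    linarith
  exact (ENNReal.mul_le_mul_iff_right (by simpa using hr0) ENNReal.ofReal_ne_top).1 hfin
end RZ

namespace RZ
open Filter Topology Set Complex

theorem avg_le {g : ℂ → ℝ} {v : ℂ → ENNReal} {D r : ℝ} {c : ℂ}
    (h : ∀ θ, ‖g (circleMap c r θ)‖ₑ ≤ ENNReal.ofReal D + v (circleMap c r θ)) :
    ‖Real.circleAverage g c r‖ₑ ≤ ENNReal.ofReal D + ∫⁻ θ in Ioc 0 (2*Real.pi), v (circleMap c r θ) := by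
  have hpi := Real.pi_pos
  have hpi3 := Real.pi_gt_three
  rw [Real.circleAverage_def, smul_eq_mul, enorm_mul, intervalIntegral.integral_of_le (by positivity)]
  have h1 : ‖∫ θ in Ioc 0 (2*Real.pi), g (circleMap c r θ)‖ₑ ≤
      ENNReal.ofReal D * ENNReal.ofReal (2*Real.pi) + ∫⁻ θ in Ioc 0 (2*Real.pi), v (circleMap c r θ) := by
    refine (enorm_integral_le_lintegral_enorm _).trans ((lintegral_mono h).trans ?_)
    rw [lintegral_add_left measurable_const, setLIntegral_const, Real.volume_Ioc, sub_zero]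
  refine (mul_le_mul_right h1 _).trans ?_
  rw [mul_add]
  have e1 : ‖(2*Real.pi)⁻¹‖ₑ = ENNReal.ofReal ((2*Real.pi)⁻¹) := by
    rw [Real.enorm_eq_ofReal_abs, abs_of_pos (by positivity)]
  rw [e1]
  apply add_le_add
  · rw [mul_left_comm, ← ENNReal.ofReal_mul (by positivity), inv_mul_cancel₀ (by positivity)]
    simp
  · refine mul_le_of_le_one_left (by positivity) ?_
    rw [ENNReal.ofReal_le_one]
    apply inv_le_one_of_one_le₀
    linarith

noncomputable def SS (f : ℂ → ℂ) (Z : Finset ℂ) (σ0 r τ : ℝ) : ℝ :=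
  ∑ ρ ∈ Z, (analyticOrderNatAt f ρ : ℝ) * gk r (σ0 - ρ.re) (τ - ρ.im)

noncomputable def PP (f : ℂ → ℂ) (Z : Finset ℂ) (σ0 r a b : ℝ) : ℝ :=
  ∫ τ in a..b, SS f Z σ0 r τ

theorem SS_nonneg (f : ℂ → ℂ) (Z : Finset ℂ) (σ0 r τ : ℝ) : 0 ≤ SS f Z σ0 r τ :=
  Finset.sum_nonneg fun _ _ => mul_nonneg (by positivity) (gk_nonneg _ _ _)

variable {f : ℂ → ℂ} {σ0 T r w M E : ℝ}

def ZZ (f : ℂ → ℂ) (T : ℝ) (Z : Finset ℂ) : Prop := ∀ s, s ∈ Z ↔ f s = 0 ∧ T/8 ≤ s.im ∧ s.im ≤ 8*T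

theorem Hy.zre (H : Hy f σ0 T r w M E) {Z : Finset ℂ} (hZ : ZZ f T Z) {ρ : ℂ} (h : ρ ∈ Z) :
    0 < σ0 - ρ.re ∧ σ0 - ρ.re ≤ w := by
  obtain ⟨h0, h1, h2⟩ := (hZ ρ).1 h
  constructor
  · by_contra hh
    exact (H.right ρ h1 h2 (by linarith)).1 h0
  · by_contra hh
    exact H.left ρ h1 h2 (by linarith) h0

theorem Hy.scont (H : Hy f σ0 T r w M E) {Z : Finset ℂ} (hZ : ZZ f T Z) : Continuous (SS f Z σ0 r) := by
  unfold SS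
  refine continuous_finsetSum _ fun ρ hρ => continuous_const.mul ?_
  exact (gk_cont (H.zre hZ hρ).1).comp (by fun_prop)

theorem Hy.sjens (H : Hy f σ0 T r w M E) {Z : Finset ℂ} (hZ : ZZ f T Z) {τ : ℝ} (h1 : T/6 ≤ τ) (h2 : τ ≤ 6*T) :
    SS f Z σ0 r τ = Real.circleAverage (fun z => Real.log ‖f z‖) (cc σ0 τ) r - Real.log ‖f (cc σ0 τ)‖ := by
  have hw := H.hw; have hr := H.hr
  have hr0 : 0 < r := by linarith
  rw [jensen_finset hr0 (H.anball h1 h2 hr0.le le_rfl) (H.cen h1 h2).1 Z]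
  · rw [add_sub_cancel_right]
    unfold SS gk
    refine Finset.sum_congr rfl fun ρ hρ => ?_
    congr 4
    apply Complex.ext
    · simp [cc_re]
    · simp [cc_im]
  · intro u hu h0
    obtain ⟨a, b, c⟩ := H.ball h1 h2 hr0.le le_rfl hu
    exact (hZ u).2 ⟨h0, a, b⟩

theorem Hy.ps (H : Hy f σ0 T r w M E) {Z : Finset ℂ} (hZ : ZZ f T Z) (a b : ℝ) :
    PP f Z σ0 r a b = ∑ ρ ∈ Z, (analyticOrderNatAt f ρ : ℝ) * ∫ τ in a..b, gk r (σ0 - ρ.re) (τ - ρ.im) := by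
  unfold PP SS
  rw [intervalIntegral.integral_finsetSum]
  · refine Finset.sum_congr rfl fun ρ _ => ?_
    rw [intervalIntegral.integral_const_mul]
  · intro ρ hρ
    apply Continuous.intervalIntegrable
    exact continuous_const.mul ((gk_cont (H.zre hZ hρ).1).comp (by fun_prop))

/-- pointwise circle info for the big circle: point in box and im in [T/4,4T] -/
theorem Hy.big (H : Hy f σ0 T r w M E) {τ : ℝ} (h1 : T/2 ≤ τ) (h2 : τ ≤ 3*T) (θ : ℝ) :
    T/4 ≤ (circleMap (cc σ0 τ) r θ).im ∧ (circleMap (cc σ0 τ) r θ).im ≤ 4*T ∧ |(circleMap (cc σ0 τ) r θ).re| ≤ 4*r := by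
  have hw := H.hw; have hr := H.hr; have hT := H.hT
  have hr0 : 0 < r := by linarith
  obtain ⟨a, b, c⟩ := H.ball (τ := τ) (by linarith) (by linarith) hr0.le le_rfl (circleMap_mem_closedBall (cc σ0 τ) hr0.le θ)
  refine ⟨?_, ?_, c⟩ <;> rw [circle_im, cc_im]
  · have := Real.neg_one_le_sin θ
    nlinarith
  · have := Real.sin_le_one θ
    nlinarith

theorem Hy.pt (H : Hy f σ0 T r w M E) {s : ℂ} (h1 : T/4 ≤ s.im) (h2 : s.im ≤ 4*T) (h3 : |s.re| ≤ 4*r) :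
    ‖Real.log ‖f s‖‖ₑ ≤ ENNReal.ofReal E + vv f σ0 T w s := by
  have hw := H.hw; have hr := H.hr; have hT := H.hT; have hE := H.hE
  by_cases hs : s ∈ Sp σ0 T w
  · rw [vv, indicator_of_mem hs]
    exact le_add_self
  · rw [vv, indicator_of_notMem hs, add_zero, Real.enorm_eq_ofReal_abs]
    apply ENNReal.ofReal_le_ofReal
    by_cases h4 : σ0 ≤ s.re
    · have := (H.right s (by linarith) (by linarith) h4).2
      linarith
    · refine H.left' s (by linarith) (by linarith) ?_ h3
      by_contra h5
      exact hs ⟨⟨by linarith, by linarith⟩, h1, h2⟩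

theorem Hy.pbound (H : Hy f σ0 T r w M E) {Z : Finset ℂ} (hZ : ZZ f T Z) {a b : ℝ} (ha : T/2 ≤ a) (hab : a ≤ b) (hb : b ≤ 3*T) :
    PP f Z σ0 r a b ≤ (b-a)*(E+2) + 1248 * (w*T*M/r) := by
  have hw := H.hw; have hr := H.hr; have hT := H.hT; have hE := H.hE; have hM := H.hM
  have hB : 0 ≤ 1248 * (w*T*M/r) := by
    have : 0 ≤ w*T*M/r := div_nonneg (mul_nonneg (mul_nonneg (by linarith) (by linarith)) (by linarith)) (by linarith)
    linarith
  have hA : 0 ≤ (b-a)*(E+2) := mul_nonneg (by linarith) (by linarith)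
  rw [← ENNReal.ofReal_le_ofReal_iff (by linarith)]
  unfold PP
  rw [intervalIntegral.integral_of_le hab, ofReal_integral_eq_lintegral_ofReal
    (((H.scont hZ).integrableOn_Icc).mono_set Ioc_subset_Icc_self) (Eventually.of_forall fun τ => SS_nonneg _ _ _ _ _)]
  have hpt : ∀ τ ∈ Ioc a b, ENNReal.ofReal (SS f Z σ0 r τ) ≤ ENNReal.ofReal (E+2) +
      ∫⁻ θ in Ioc 0 (2*Real.pi), vv f σ0 T w (circleMap (cc σ0 τ) r θ) := by
    intro τ hτ
    have t1 : T/2 ≤ τ := by linarith [hτ.1]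
    have t2 : τ ≤ 3*T := by linarith [hτ.2]
    have h := avg_le (g := fun z => Real.log ‖f z‖) (v := vv f σ0 T w) (D := E) (r := r) (c := cc σ0 τ)
      (fun θ => by obtain ⟨a, b, c⟩ := H.big t1 t2 θ; exact H.pt a b c)
    have hc := (H.cen (τ := τ) (by linarith) (by linarith)).2
    calc ENNReal.ofReal (SS f Z σ0 r τ) ≤ ‖SS f Z σ0 r τ‖ₑ := by
          rw [Real.enorm_eq_ofReal_abs]; exact ENNReal.ofReal_le_ofReal (le_abs_self _)
      _ ≤ ‖Real.circleAverage (fun z => Real.log ‖f z‖) (cc σ0 τ) r‖ₑ + ‖Real.log ‖f (cc σ0 τ)‖‖ₑ := by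
          rw [H.sjens hZ (by linarith) (by linarith)]; exact enorm_sub_le
      _ ≤ _ := by
          refine (add_le_add h (show _ ≤ ENNReal.ofReal 2 from ?_)).trans (le_of_eq ?_)
          · rw [Real.enorm_eq_ofReal_abs]; exact ENNReal.ofReal_le_ofReal hc
          · rw [ENNReal.ofReal_add (by linarith) (by norm_num)]; ring
  refine (setLIntegral_mono_ae' measurableSet_Ioc (ae_of_all _ hpt)).trans ?_
  rw [lintegral_add_left measurable_const, setLIntegral_const, Real.volume_Ioc, ENNReal.ofReal_add hA hB]
  apply add_le_add
  · rw [← ENNReal.ofReal_mul (by linarith), mul_comm]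
  · exact (setLIntegral_le_lintegral _ _).trans H.strip

theorem pdiff {g : ℂ → ℂ} (H : Hy f σ0 T r w M E) (Hg : Hy g σ0 T r w M E) {Z Zg : Finset ℂ} (hZ : ZZ f T Z) (hZg : ZZ g T Zg)
    {D : ℝ} (hD : 6 ≤ D)
    (hfg : ∀ s : ℂ, T/8 ≤ s.im → s.im ≤ 8*T → s.re ≤ σ0 - w → |s.re| ≤ 4*r → |2*Real.log ‖f s‖ - Real.log ‖g s‖| ≤ D)
    {a b : ℝ} (ha : T/2 ≤ a) (hab : a ≤ b) (hb : b ≤ 3*T) :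
    |2 * PP f Z σ0 r a b - PP g Zg σ0 r a b| ≤ (b-a)*(D+6) + 3*(1248 * (w*T*M/r)) := by
  have hw := H.hw; have hr := H.hr; have hT := H.hT; have hE := H.hE; have hM := H.hM
  have hr0 : 0 < r := by linarith
  have hB : 0 ≤ 1248 * (w*T*M/r) := by
    have : 0 ≤ w*T*M/r := div_nonneg (mul_nonneg (mul_nonneg (by linarith) (by linarith)) (by linarith)) (by linarith)
    linarith
  have hA : 0 ≤ (b-a)*(D+6) := mul_nonneg (by linarith) (by linarith)
  have e : 2 * PP f Z σ0 r a b - PP g Zg σ0 r a b = ∫ τ in a..b, (2 * SS f Z σ0 r τ - SS g Zg σ0 r τ) := by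
    unfold PP
    rw [intervalIntegral.integral_sub, intervalIntegral.integral_const_mul]
    · exact (continuous_const.mul (H.scont hZ)).intervalIntegrable _ _
    · exact (Hg.scont hZg).intervalIntegrable _ _
  rw [e, ← ENNReal.ofReal_le_ofReal_iff (by linarith), ← Real.enorm_eq_ofReal_abs, intervalIntegral.integral_of_le hab]
  refine (enorm_integral_le_lintegral_enorm _).trans ?_
  set V : ℂ → ENNReal := fun s => 2 * vv f σ0 T w s + vv g σ0 T w s with hV
  have hVpt : ∀ s : ℂ, T/4 ≤ s.im → s.im ≤ 4*T → |s.re| ≤ 4*r →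
      ‖2*Real.log ‖f s‖ - Real.log ‖g s‖‖ₑ ≤ ENNReal.ofReal D + V s := by
    intro s h1 h2 h3
    by_cases hs : s ∈ Sp σ0 T w
    · rw [hV]
      simp only
      rw [vv, vv, indicator_of_mem hs, indicator_of_mem hs]
      refine (enorm_sub_le).trans (le_trans ?_ le_add_self)
      rw [enorm_mul]
      gcongr
      rw [Real.enorm_eq_ofReal_abs]; simp
    · rw [hV]
      simp only
      rw [vv, vv, indicator_of_notMem hs, indicator_of_notMem hs, mul_zero, add_zero, add_zero, Real.enorm_eq_ofReal_abs]
      apply ENNReal.ofReal_le_ofReal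
      by_cases h4 : σ0 ≤ s.re
      · have k1 := (H.right s (by linarith) (by linarith) h4).2
        have k2 := (Hg.right s (by linarith) (by linarith) h4).2
        rw [abs_le] at k1 k2 ⊢
        constructor <;> linarith [k1.1, k1.2, k2.1, k2.2]
      · refine hfg s (by linarith) (by linarith) ?_ h3
        by_contra h5
        exact hs ⟨⟨by linarith, by linarith⟩, h1, h2⟩
  have hpt : ∀ τ ∈ Ioc a b, ‖2 * SS f Z σ0 r τ - SS g Zg σ0 r τ‖ₑ ≤ ENNReal.ofReal (D+6) +
      ∫⁻ θ in Ioc 0 (2*Real.pi), V (circleMap (cc σ0 τ) r θ) := by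
    intro τ hτ
    have t1 : T/2 ≤ τ := by linarith [hτ.1]
    have t2 : τ ≤ 3*T := by linarith [hτ.2]
    have h := avg_le (g := fun z => 2*Real.log ‖f z‖ - Real.log ‖g z‖) (v := V) (D := D) (r := r) (c := cc σ0 τ)
      (fun θ => by obtain ⟨a, b, c⟩ := H.big t1 t2 θ; exact hVpt _ a b c)
    have hc := (H.cen (τ := τ) (by linarith) (by linarith)).2
    have hcg := (Hg.cen (τ := τ) (by linarith) (by linarith)).2
    have hci := H.ci (τ := τ) (by linarith) (by linarith) hr0.le le_rfl
    have hcig := Hg.ci (τ := τ) (by linarith) (by linarith) hr0.le le_rfl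
    have e2 : Real.circleAverage (fun z => 2*Real.log ‖f z‖ - Real.log ‖g z‖) (cc σ0 τ) r =
        2 * Real.circleAverage (fun z => Real.log ‖f z‖) (cc σ0 τ) r - Real.circleAverage (fun z => Real.log ‖g z‖) (cc σ0 τ) r := by
      have hci2 : CircleIntegrable (fun z => 2 * Real.log ‖f z‖) (cc σ0 τ) r := IntervalIntegrable.const_mul hci 2
      rw [Real.circleAverage_fun_sub hci2 hcig]
      congr 1
      simp only [← smul_eq_mul]
      exact Real.circleAverage_fun_smul
    rw [e2] at h
    rw [H.sjens hZ (by linarith) (by linarith), Hg.sjens hZg (by linarith) (by linarith)]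
    set x := Real.circleAverage (fun z => Real.log ‖f z‖) (cc σ0 τ) r
    set y := Real.circleAverage (fun z => Real.log ‖g z‖) (cc σ0 τ) r
    set x' := Real.log ‖f (cc σ0 τ)‖
    set y' := Real.log ‖g (cc σ0 τ)‖
    have e3 : 2*(x-x') - (y - y') = (2*x - y) - (2*x'-y') := by ring
    rw [e3]
    refine enorm_sub_le.trans ((add_le_add h (show _ ≤ ENNReal.ofReal 6 from ?_)).trans (le_of_eq ?_))
    · rw [Real.enorm_eq_ofReal_abs]; apply ENNReal.ofReal_le_ofReal
      rw [abs_le] at hc hcg ⊢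
      constructor <;> linarith [hc.1, hc.2, hcg.1, hcg.2]
    · rw [ENNReal.ofReal_add (by linarith) (by norm_num)]; ring
  refine (setLIntegral_mono_ae' measurableSet_Ioc (ae_of_all _ hpt)).trans ?_
  rw [lintegral_add_left measurable_const, setLIntegral_const, Real.volume_Ioc, ENNReal.ofReal_add hA (by linarith)]
  apply add_le_add
  · rw [← ENNReal.ofReal_mul (by linarith), mul_comm]
  · refine (setLIntegral_le_lintegral _ _).trans ?_
    have mf := vv_meas H.ms σ0 T w
    have mg := vv_meas Hg.ms σ0 T w
    have hcm : Continuous fun p : ℝ × ℝ => circleMap (cc σ0 p.1) r p.2 := by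
      simp only [circleMap, cc]; fun_prop
    have e4 : ∀ τ : ℝ, ∫⁻ θ in Ioc 0 (2*Real.pi), V (circleMap (cc σ0 τ) r θ) =
        2 * (∫⁻ θ in Ioc 0 (2*Real.pi), vv f σ0 T w (circleMap (cc σ0 τ) r θ)) +
        ∫⁻ θ in Ioc 0 (2*Real.pi), vv g σ0 T w (circleMap (cc σ0 τ) r θ) := by
      intro τ
      have m1 : Measurable fun θ => vv f σ0 T w (circleMap (cc σ0 τ) r θ) := mf.comp (continuous_circleMap _ _).measurable
      simp only [hV]
      rw [lintegral_add_left (m1.const_mul 2), lintegral_const_mul _ m1]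
    simp only [e4]
    have m2 : Measurable fun τ => ∫⁻ θ in Ioc 0 (2*Real.pi), vv f σ0 T w (circleMap (cc σ0 τ) r θ) :=
      Measurable.lintegral_prod_right' (f := fun p : ℝ × ℝ => vv f σ0 T w (circleMap (cc σ0 p.1) r p.2)) (mf.comp hcm.measurable)
    rw [lintegral_add_left (m2.const_mul 2), lintegral_const_mul _ m2]
    refine (add_le_add (mul_le_mul_right H.strip 2) Hg.strip).trans (le_of_eq ?_)
    rw [show (2:ENNReal) = ENNReal.ofReal 2 by simp, ← ENNReal.ofReal_mul (by norm_num), ← ENNReal.ofReal_add (by linarith) (by linarith)]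
    congr 1; ring
end RZ

namespace RZ
open Filter Topology Set Complex
variable {f : ℂ → ℂ} {σ0 T r w M E : ℝ}

noncomputable def NN (f : ℂ → ℂ) (T : ℝ) (Z : Finset ℂ) : ℝ :=
  ∑ ρ ∈ Z with T < ρ.im ∧ ρ.im ≤ 2*T, (analyticOrderNatAt f ρ : ℝ)

theorem NN_nonneg (f : ℂ → ℂ) (T : ℝ) (Z : Finset ℂ) : 0 ≤ NN f T Z := Finset.sum_nonneg fun _ _ => by positivity

theorem Hy.padd (H : Hy f σ0 T r w M E) {Z : Finset ℂ} (hZ : ZZ f T Z) (a b c : ℝ) :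
    PP f Z σ0 r a c = PP f Z σ0 r a b + PP f Z σ0 r b c := by
  unfold PP
  rw [intervalIntegral.integral_add_adjacent_intervals] <;> exact (H.scont hZ).intervalIntegrable _ _

theorem Hy.nlow (H : Hy f σ0 T r w M E) {Z : Finset ℂ} (hZ : ZZ f T Z) :
    NN f T Z * (2*(r - w - w*Real.log (r/w))) ≤ PP f Z σ0 r (T-r) (2*T+r) := by
  have hw := H.hw; have hr := H.hr; have hT := H.hT
  rw [H.ps hZ, NN, Finset.sum_mul]
  refine (Finset.sum_le_sum (fun ρ hρ => ?_)).trans (Finset.sum_le_sum_of_subset_of_nonneg (Finset.filter_subset (fun ρ : ℂ => T < ρ.im ∧ ρ.im ≤ 2*T) Z) ?_)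
  · rw [Finset.mem_filter] at hρ
    obtain ⟨h1, h2⟩ := H.zre hZ hρ.1
    exact mul_le_mul_of_nonneg_left (gk_int_ge (by linarith) (by linarith) h1 h2 (by linarith [hρ.2.1]) (by linarith [hρ.2.2])) (by positivity)
  · intro ρ _ _
    exact mul_nonneg (by positivity) (intervalIntegral.integral_nonneg (by linarith) fun _ _ => gk_nonneg _ _ _)

theorem Hy.nup (H : Hy f σ0 T r w M E) {Z : Finset ℂ} (hZ : ZZ f T Z) :
    PP f Z σ0 r (T+r) (2*T-r) ≤ NN f T Z * (2*r) := by
  have hw := H.hw; have hr := H.hr; have hT := H.hT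
  rw [H.ps hZ, NN, Finset.sum_mul, Finset.sum_filter]
  refine Finset.sum_le_sum (fun ρ hρ => ?_)
  obtain ⟨h1, h2⟩ := H.zre hZ hρ
  split_ifs with h
  · exact mul_le_mul_of_nonneg_left (gk_int_le (by linarith) h1 (by linarith) _) (by positivity)
  · rw [gk_int_zero (by linarith) (by linarith), mul_zero]
    by_contra hh
    push Not at hh
    exact h ⟨by linarith [hh.1], by linarith [hh.2]⟩

theorem Hy.ncount (H : Hy f σ0 T r w M E) {Z : Finset ℂ} (hZ : ZZ f T Z) {κ : ℝ}
    (hκ : w + w*Real.log (r/w) ≤ κ) (hκr : 2*κ ≤ r) :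
    |NN f T Z * (2*r) - PP f Z σ0 r T (2*T)| ≤
      2*(r*(E+2) + 1248 * (w*T*M/r)) + 2*κ/r*(2*T*(E+2) + 1248 * (w*T*M/r)) := by
  have hw := H.hw; have hr := H.hr; have hT := H.hT; have hE := H.hE
  have hM := H.hM
  have hr0 : 0 < r := by linarith
  have hlog : 0 ≤ Real.log (r/w) := Real.log_nonneg (by rw [le_div_iff₀ (by linarith)]; linarith)
  have hκ0 : 0 ≤ κ := by nlinarith
  have hlow := H.nlow hZ
  have hup := H.nup hZ
  set N := NN f T Z
  have hN : 0 ≤ N := NN_nonneg _ _ _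
  set B := 1248 * (w*T*M/r)
  have hB : 0 ≤ B := by
    have : 0 ≤ w*T*M/r := div_nonneg (mul_nonneg (mul_nonneg (by linarith) (by linarith)) (by linarith)) (by linarith)
    show 0 ≤ 1248 * (w*T*M/r)
    linarith
  have b1 := H.pbound hZ (a := T-r) (b := T) (by linarith) (by linarith) (by linarith)
  have b2 := H.pbound hZ (a := T) (b := T+r) (by linarith) (by linarith) (by linarith)
  have b3 := H.pbound hZ (a := 2*T-r) (b := 2*T) (by linarith) (by linarith) (by linarith)
  have b4 := H.pbound hZ (a := 2*T) (b := 2*T+r) (by linarith) (by linarith) (by linarith)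
  have b5 := H.pbound hZ (a := T-r) (b := 2*T+r) (by linarith) (by linarith) (by linarith)
  have s1 := H.padd hZ (T-r) T (2*T+r)
  have s2 := H.padd hZ T (2*T) (2*T+r)
  have s3 := H.padd hZ T (T+r) (2*T)
  have s4 := H.padd hZ (T+r) (2*T-r) (2*T)
  have n1 : N*(2*(r-κ)) ≤ PP f Z σ0 r (T-r) (2*T+r) :=
    le_trans (mul_le_mul_of_nonneg_left (by linarith) hN) hlow
  have n2 : N*r ≤ 2*T*(E+2) + B := by
    have : N*r ≤ N*(2*(r-κ)) := mul_le_mul_of_nonneg_left (by linarith) hN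
    have : (2*T+r-(T-r))*(E+2) ≤ 2*T*(E+2) := mul_le_mul_of_nonneg_right (by linarith) (by linarith)
    linarith
  have n3 : N*(2*κ) ≤ 2*κ/r*(2*T*(E+2) + B) := by
    have := mul_le_mul_of_nonneg_left n2 (show 0 ≤ 2*κ/r by positivity)
    have e : 2*κ/r*(N*r) = N*(2*κ) := by field_simp
    linarith
  have n4 : 0 ≤ 2*κ/r*(2*T*(E+2) + B) := le_trans (by positivity) n3
  rw [abs_le]
  constructor <;> nlinarith

theorem count_final {g : ℂ → ℂ} {q : ℝ} (hq : 10000 ≤ q)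
    (H : Hy f σ0 (q^64) (q^62) (q^57) (q^65) (q^63)) (Hg : Hy g σ0 (q^64) (q^62) (q^57) (q^65) (q^63))
    {Z Zg : Finset ℂ} (hZ : ZZ f (q^64) Z) (hZg : ZZ g (q^64) Zg)
    (hfg : ∀ s : ℂ, q^64/8 ≤ s.im → s.im ≤ 8*q^64 → s.re ≤ σ0 - q^57 → |s.re| ≤ 4*q^62 →
      |2*Real.log ‖f s‖ - Real.log ‖g s‖| ≤ q^60) :
    |2 * NN f (q^64) Z - NN g (q^64) Zg| ≤ 20 * q^63 := by
  have hq0 : 0 < q := by linarith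
  have pw : ∀ n : ℕ, 10000 * q^n ≤ q^(n+1) := fun n => by
    rw [pow_succ, mul_comm (q^n)]; exact mul_le_mul_of_nonneg_right hq (by positivity)
  have p1 : ∀ n : ℕ, 1 ≤ q^n := fun n => one_le_pow₀ (by linarith)
  have hκ : q^57 + q^57*Real.log (q^62/q^57) ≤ q^59 := by
    have e : q^62/q^57 = q^5 := by rw [div_eq_iff (by positivity), ← pow_add]
    rw [e, Real.log_pow]
    have := Real.log_le_sub_one_of_pos hq0
    have h1 : q^57 + q^57*(((5:ℕ):ℝ)*Real.log q) ≤ q^57 + q^57*(5*q) := by push_cast; gcongr; linarith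
    have h2 := pw 57
    have h3 := pw 58
    have h4 : q^57*(5*q) = 5*q^58 := by ring
    norm_num at h2 h3
    linarith [p1 57, p1 58]
  have hκr : 2*q^59 ≤ q^62 := by
    have h1 := pw 59; have h2 := pw 60; have h3 := pw 61
    norm_num at h1 h2 h3
    linarith [p1 59, p1 60, p1 61]
  have n1 := H.ncount hZ hκ hκr
  have n2 := Hg.ncount hZg hκ hκr
  have h64 : q^64 ≤ 2*q^64 := by linarith [p1 64]
  have d := pdiff H Hg hZ hZg (D := q^60) (by have := pw 59; norm_num at this; linarith [p1 59]) hfg (a := q^64) (b := 2*q^64)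
    (by linarith [p1 64]) h64 (by linarith [p1 64])
  have e1 : 1248 * (q^57*q^64*q^65/q^62) = 1248*q^124 := by
    have : q^57*q^64*q^65/q^62 = q^124 := by rw [div_eq_iff (by positivity)]; ring
    rw [this]
  have e2 : 2*q^59/q^62*(2*q^64*(q^63+2) + 1248*q^124) = 4*q^124 + 8*q^61 + 2496*q^121 := by
    rw [div_mul_eq_mul_div, div_eq_iff (by positivity)]; ring
  rw [e1, e2] at n1 n2
  rw [e1] at d
  have e3 : q^62*(q^63+2) = q^125 + 2*q^62 := by ring
  have e4 : (2*q^64-q^64)*(q^60+6) = q^124 + 6*q^64 := by ring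
  rw [e3] at n1 n2
  rw [e4] at d
  have c1 : q^62 ≤ q^124 := pow_le_pow_right₀ (by linarith) (by norm_num)
  have c2 : q^61 ≤ q^124 := pow_le_pow_right₀ (by linarith) (by norm_num)
  have c3 : q^64 ≤ q^124 := pow_le_pow_right₀ (by linarith) (by norm_num)
  have c4 : q^121 ≤ q^124 := pow_le_pow_right₀ (by linarith) (by norm_num)
  have c5 := pw 124
  norm_num at c5
  have key : |2 * NN f (q^64) Z - NN g (q^64) Zg| * q^62 ≤ 20*q^63*q^62 := by
    rw [← abs_of_pos (show 0 < q^62 by positivity), ← abs_mul, abs_of_pos (show 0 < q^62 by positivity)]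
    have e5 : 20*q^63*q^62 = 20*q^125 := by ring
    rw [e5]
    rw [abs_le] at n1 n2 d ⊢
    constructor <;> linarith [n1.1, n1.2, n2.1, n2.2, d.1, d.2]
  exact le_of_mul_le_mul_right key (by positivity)
end RZ

namespace RZ
open Filter Topology Set Complex

theorem near_one {z : ℂ} (h : ‖z - 1‖ ≤ 1/2) : z ≠ 0 ∧ |Real.log ‖z‖| ≤ 2 := by
  have h1 : ‖z‖ ≤ 2 := by
    have := norm_add_le (z-1) 1
    simp only [sub_add_cancel, norm_one] at this
    linarith
  have h2 : 1/2 ≤ ‖z‖ := by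
    have := norm_sub_norm_le 1 (1 - z)
    rw [norm_sub_rev 1 z] at this
    simp only [norm_one, sub_sub_cancel] at this
    linarith
  refine ⟨by rintro rfl; norm_num at h2, ?_⟩
  have hl := log_near (a := ‖z‖) (m := 1) (c := 2) (by norm_num) (by norm_num) (by linarith) (by linarith)
  rw [Real.log_one, sub_zero] at hl
  have := Real.log_two_lt_d9
  linarith

theorem log_le_of_exp {x X : ℝ} (hx : 0 ≤ x) (hX : 0 ≤ X) (h : x ≤ Real.exp X) : Real.log x ≤ X := by
  rcases hx.eq_or_lt with h0 | h0
  · rw [← h0, Real.log_zero]; exact hX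
  · exact (Real.log_le_iff_le_exp h0).2 h

theorem exists_p (s : ℂ) : ∃ p : ℝ, 0 ≤ p ∧ p^8 = ‖s‖ := by
  refine ⟨‖s‖^((8:ℝ)⁻¹), by positivity, ?_⟩
  have := Real.rpow_inv_natCast_pow (norm_nonneg s) (show (8:ℕ) ≠ 0 by norm_num)
  simpa using this

theorem region {q σ0 : ℝ} (hq : 100000000 ≤ q) (hσ : 0 ≤ σ0) (hσq : σ0 ≤ q) {s : ℂ} (h1 : q^64/8 ≤ s.im) (h2 : s.im ≤ 8*q^64)
    (h3 : s.re ≤ σ0 - q^57) : ∃ p : ℝ, q^7 ≤ p ∧ p^8 = ‖s‖ ∧ p^7 ≤ -s.re := by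
  have hq0 : 0 < q := by linarith
  have p1 : ∀ n : ℕ, 1 ≤ q^n := fun n => one_le_pow₀ (by linarith)
  have pw : ∀ n : ℕ, 100000000 * q^n ≤ q^(n+1) := fun n => by
    rw [pow_succ, mul_comm (q^n)]; exact mul_le_mul_of_nonneg_right hq (by positivity)
  obtain ⟨p, hp0, hp⟩ := exists_p s
  have hx : q^57/2 ≤ -s.re := by
    have : q^2 ≤ q^57 := pow_le_pow_right₀ (by linarith) (by norm_num)
    nlinarith
  refine ⟨p, ?_, hp, ?_⟩
  · have : (q^7)^8 ≤ p^8 := by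
      rw [hp, ← pow_mul]
      have := Complex.im_le_norm s
      have h8 : 8*q^56 ≤ q^64 := by
        have := pw 56
        have h := pow_le_pow_right₀ (show 1 ≤ q by linarith) (show 57 ≤ 64 by norm_num)
        norm_num at this
        linarith [p1 56]
      norm_num
      linarith
    exact le_of_pow_le_pow_left₀ (by norm_num) hp0 this
  · by_contra hc
    push Not at hc
    have hn : ‖s‖ ≤ -s.re + 8*q^64 := by
      have := Complex.norm_le_abs_re_add_abs_im s
      rw [abs_of_neg (by linarith [p1 57]), abs_of_pos (by linarith [p1 64])] at this
      linarith
    have hp10 : 10*q^8 ≤ p := by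
      by_contra hh
      push Not at hh
      have : p^7 ≤ (10*q^8)^7 := pow_le_pow_left₀ hp0 hh.le 7
      have e : (10*q^8)^7 = 10000000*q^56 := by ring
      have := pw 56
      norm_num at this
      linarith [p1 56]
    have e8 : p^8 = p^7*p := by ring
    have : (q^57/2)*(9*q^8) ≤ p^7*(p-1) := by
      apply mul_le_mul
      · linarith
      · linarith [p1 8]
      · positivity
      · positivity
    have e65 : (q^57/2)*(9*q^8) = 9/2*q^65 := by ring
    have := pw 64
    norm_num at this
    nlinarith [p1 64]

set_option maxHeartbeats 4000000 in
theorem all_Hy : ∃ σ0 : ℝ, 3 ≤ σ0 ∧ ∀ᶠ q in (atTop : Filter ℝ),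
    Hy RiemannR σ0 (q^64) (q^62) (q^57) (q^65) (q^63) ∧ Hy riemannZeta σ0 (q^64) (q^62) (q^57) (q^65) (q^63) ∧
    ∀ s : ℂ, q^64/8 ≤ s.im → s.im ≤ 8*q^64 → s.re ≤ σ0 - q^57 → |s.re| ≤ 4*q^62 →
      |2*Real.log ‖RiemannR s‖ - Real.log ‖riemannZeta s‖| ≤ q^60 := by
  obtain ⟨σ1, hσ1, hR⟩ := R_right
  obtain ⟨C1, hC1⟩ := R_crude
  obtain ⟨C2, hC2, hz⟩ := zeta_crude
  obtain ⟨P1, hP1, hRl, hRl'⟩ := R_left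
  obtain ⟨P2, hP2, hzl⟩ := zeta_left
  refine ⟨max σ1 3, le_max_right _ _, ?_⟩
  set σ0 := max σ1 3 with hσ0
  have h3 : 3 ≤ σ0 := le_max_right _ _
  have h1 : σ1 ≤ σ0 := le_max_left _ _
  have hlo : ∀ᶠ q in (atTop : Filter ℝ), Real.log q ≤ (1/(10000*(1+C2)))*q := by
    have := Real.isLittleO_log_id_atTop.def (show 0 < 1/(10000*(1+C2)) by positivity)
    filter_upwards [this, eventually_ge_atTop 1] with q hq hq1
    simp only [Real.norm_eq_abs, id] at hq
    rw [abs_of_nonneg (by linarith : (0:ℝ) ≤ q)] at hq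
    exact (le_abs_self _).trans hq
  filter_upwards [hlo, eventually_ge_atTop 100000000, eventually_ge_atTop σ0, eventually_ge_atTop P1,
    eventually_ge_atTop P2, eventually_ge_atTop |C1|, eventually_ge_atTop (1000*C2)] with q hl hq hqσ hqP1 hqP2 hqC1 hqC2
  have hq0 : 0 < q := by linarith
  have p1 : ∀ n : ℕ, 1 ≤ q^n := fun n => one_le_pow₀ (by linarith)
  have pw : ∀ n : ℕ, 100000000 * q^n ≤ q^(n+1) := fun n => by
    rw [pow_succ, mul_comm (q^n)]; exact mul_le_mul_of_nonneg_right hq (by positivity)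
  have pm : ∀ m n : ℕ, m ≤ n → q^m ≤ q^n := fun m n h => pow_le_pow_right₀ (by linarith) h
  have hlq0 : 0 ≤ Real.log q := Real.log_nonneg (by linarith)
  have hl1 : Real.log q ≤ q/10000 := by
    refine hl.trans ?_
    rw [div_mul_eq_mul_div, one_mul]
    apply div_le_div_of_nonneg_left hq0.le (by norm_num)
    nlinarith
  have hl2 : C2 * Real.log q ≤ q/10000 := by
    have : (1+C2) * Real.log q ≤ (1+C2)*((1/(10000*(1+C2)))*q) := mul_le_mul_of_nonneg_left hl (by linarith)
    have e : (1+C2)*((1/(10000*(1+C2)))*q) = q/10000 := by field_simp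
    nlinarith
  set K := 9*q^64 with hK
  have hKl : Real.log K ≤ 3 + 64*Real.log q := by
    rw [hK, Real.log_mul (by norm_num) (by positivity), Real.log_pow]
    have : Real.log 9 ≤ 3 := by
      rw [show (9:ℝ) = 3^2 by norm_num, Real.log_pow]
      have := Real.log_le_sub_one_of_pos (show (0:ℝ) < 3/2 by norm_num)
      have h2 := Real.log_two_lt_d9
      have e : Real.log 3 = Real.log (3/2) + Real.log 2 := by rw [← Real.log_mul (by norm_num) (by norm_num)]; norm_num
      push_cast; linarith
    push_cast; linarith
  have hK0 : 0 < K := by positivity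
  have hK3 : 3 ≤ K := by linarith [p1 64]
  have hKlog0 : 0 ≤ Real.log K := Real.log_nonneg (by linarith)
  have hnK : ∀ s : ℂ, q^64/8 ≤ s.im → s.im ≤ 8*q^64 → |s.re| ≤ 4*q^62 → ‖s‖ ≤ K := by
    intro s a b c
    have := Complex.norm_le_abs_re_add_abs_im s
    rw [abs_of_pos (by linarith [p1 64] : 0 < s.im)] at this
    have e1 := pw 62
    have e2 := pw 63
    norm_num at e1 e2
    rw [hK]
    linarith [p1 62, p1 63]
  have e65 : q^65 = q^64*q := by ring
  have him1 : ∀ s : ℂ, q^64/8 ≤ s.im → 1 ≤ s.im := by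
    intro s h
    have := pw 63
    norm_num at this
    linarith [p1 63]
  have q7 : q ≤ q^7 := by have := pm 1 7 (by norm_num); simpa using this
  -- region estimates
  have hreg : ∀ s : ℂ, q^64/8 ≤ s.im → s.im ≤ 8*q^64 → s.re ≤ σ0 - q^57 → |s.re| ≤ 4*q^62 →
      ∃ p : ℝ, P1 ≤ p ∧ P2 ≤ p ∧ p^8 = ‖s‖ ∧ p^7 ≤ -s.re ∧ 0 < bet s ∧ bet s ≤ q^32 ∧ 0 ≤ Real.log p ∧
        Real.log p ≤ q/1000 ∧ |XX s| ≤ q^63/2 := by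
    intro s a b c d
    obtain ⟨p, k1, k2, k3⟩ := region hq (by linarith) hqσ a b c
    have hre : s.re < 0 := by
      have : 0 < p^7 := by
        have : 0 < p := by linarith [p1 7]
        positivity
      linarith
    have him : 0 < s.im := by linarith [him1 s a]
    obtain ⟨b1, b2, b3⟩ := bet_bounds hre him
    have hp0 : 0 < p := by linarith [p1 7]
    have hp10 : 10 ≤ p := by linarith
    obtain ⟨x1, x2⟩ := XX_bounds hp10 k2 hre him
    have hx : -s.re ≤ 4*q^62 := by rw [abs_of_neg hre] at d; exact d
    have hlp : Real.log p ≤ q/1000 := by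
      have hp : 8*Real.log p ≤ Real.log K := by
        have e : 8*Real.log p = Real.log (p^8) := by rw [Real.log_pow]; norm_num
        rw [e, k2]
        apply Real.log_le_log
        · rw [← k2]; positivity
        · exact hnK s a b d
      linarith
    refine ⟨p, by linarith, by linarith, k2, k3, b1, ?_, Real.log_nonneg (by linarith), hlp, ?_⟩
    · apply le_of_pow_le_pow_left₀ (n := 2) (by norm_num) (by positivity)
      rw [← pow_mul]
      have e1 := pw 62
      have e2 := pw 63
      norm_num at e1 e2 ⊢
      linarith [p1 62, p1 63]
    · have e63 : q^63 = q^62*q := by ring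
      have e1 := pw 62
      norm_num at e1
      rw [abs_le]
      constructor
      · linarith [p1 62]
      · refine x2.trans ?_
        have : (1-s.re)*(8*Real.log p) ≤ (5*q^62)*(8*(q/1000)) := by
          apply mul_le_mul
          · linarith [p1 62]
          · linarith
          · have := Real.log_nonneg (show 1 ≤ p by linarith); linarith
          · positivity
        nlinarith [p1 63]
  have hw : 1 ≤ q^57 := p1 57
  have hr : 8*q^57 ≤ q^62 := by
    have : 100000000*q^57 ≤ q^58 := pw 57
    have := pm 58 62 (by norm_num)
    linarith [p1 57]
  have hT : 64*q^62 ≤ q^64 := by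
    have : 100000000*q^62 ≤ q^63 := pw 62
    have := pm 63 64 (by norm_num)
    linarith [p1 62]
  have hσw : σ0 ≤ q^57 := hqσ.trans (by have := pm 1 57 (by norm_num); simpa using this)
  have hM : 2 ≤ q^65 := by have : 100000000*q^64 ≤ q^65 := pw 64; linarith [p1 64]
  have hE : 2 ≤ q^63 := by have : 100000000*q^62 ≤ q^63 := pw 62; linarith [p1 62]
  have q32 : q^32 * 100 ≤ q^60 := by
    have : 100000000*q^32 ≤ q^33 := pw 32
    have := pm 33 60 (by norm_num)
    linarith [p1 32]
  have qq : q ≤ q^60 := by have := pm 1 60 (by norm_num); simpa using this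
  have q60 : 100*q^60 ≤ q^63 := by
    have : 100000000*q^60 ≤ q^61 := pw 60
    have := pm 61 63 (by norm_num)
    linarith [p1 60]
  have q100 : 100 * q ≤ q^60 := by
    have h1 : 100000000*q^1 ≤ q^2 := pw 1
    have h2 := pm 2 60 (by norm_num)
    rw [pow_one] at h1
    linarith
  refine ⟨?_, ?_, ?_⟩
  · refine ⟨fun s _ => R_diff.analyticAt s, R_diff.continuous.measurable, hw, hr, hT, by linarith, hσw, hM, hE, ?_, ?_, ?_, ?_⟩
    · intro s a b c
      have h := hC1 s K (by linarith) (hnK s a b c)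
      have hC1a := neg_abs_le C1
      have hKl2 : 0 ≤ K*Real.log K := by positivity
      have hpi := Real.pi_lt_four
      have hpi3 := Real.pi_gt_three
      have hKq : q ≤ K := by
        have := pm 1 64 (by norm_num)
        rw [hK]; simp at this; linarith
      have hX : 0 ≤ K*Real.log K + Real.pi*K + C1 := by
        have hk : 1*K ≤ Real.pi*K := mul_le_mul_of_nonneg_right (by linarith) hK0.le
        linarith
      refine (log_le_of_exp (norm_nonneg _) hX h).trans ?_
      · have k1 : K*Real.log K ≤ K*(3+64*Real.log q) := mul_le_mul_of_nonneg_left hKl hK0.le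
        have k2 : K*(3+64*Real.log q) ≤ K*(3+64*(q/10000)) := by gcongr
        have k3 : Real.pi*K ≤ 4*K := mul_le_mul_of_nonneg_right hpi.le hK0.le
        have k4 : C1 ≤ K := (le_abs_self C1).trans (hqC1.trans hKq)
        have k5 : K*(3+64*(q/10000)) = 27*q^64 + 9*64/10000*(q^64*q) := by rw [hK]; ring
        rw [e65]
        have : 100000000*q^64 ≤ q^64*q := by rw [← e65]; exact pw 64
        linarith [p1 64]
    · intro s a b c
      exact near_one (hR s (by linarith) (by linarith [him1 s a]))
    · intro s a b c
      obtain ⟨p, k1, k2, k3⟩ := region hq (by linarith) hqσ a b c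
      exact hRl s p (by linarith) k2 k3 (by linarith [him1 s a])
    · intro s a b c d
      obtain ⟨p, k1, k2, k3, k4, k5, k6, k7, k8, k9⟩ := hreg s a b c d
      have := hRl' s p k1 k3 k4 (him1 s a)
      rw [abs_le] at this k9 ⊢
      constructor <;> linarith [this.1, this.2, k9.1, k9.2]
  · refine ⟨?_, ?_, hw, hr, hT, by linarith, hσw, hM, hE, ?_, ?_, ?_, ?_⟩
    · have hop : IsOpen {s : ℂ | 0 < s.im} := isOpen_lt continuous_const Complex.continuous_im
      apply DifferentiableOn.analyticOnNhd _ hop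
      intro s hs
      refine (differentiableAt_riemannZeta ?_).differentiableWithinAt
      rintro rfl
      simp at hs
    · refine measurable_of_continuousOn_compl_singleton 1 fun s hs => ?_
      exact (differentiableAt_riemannZeta hs).continuousAt.continuousWithinAt
    · intro s a b c
      have h := hz s K hK3 (hnK s a b c) (him1 s a)
      refine log_le_of_exp (norm_nonneg _) (by positivity) h |>.trans ?_
      have k1 : C2*(K*Real.log K) ≤ C2*(K*(3+64*Real.log q)) := by gcongr
      have k2 : C2*(K*(3+64*Real.log q)) = K*(3*C2+64*(C2*Real.log q)) := by ring
      have k3 : K*(3*C2+64*(C2*Real.log q)) ≤ K*(3*(q/1000)+64*(q/10000)) := by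
        apply mul_le_mul_of_nonneg_left _ hK0.le
        linarith
      have k4 : K*(3*(q/1000)+64*(q/10000)) = (27/1000+9*64/10000)*(q^64*q) := by rw [hK]; ring
      rw [e65]
      have : 0 < q^64*q := by positivity
      linarith
    · intro s a b c
      exact near_one (zeta_right (by linarith))
    · intro s a b c
      obtain ⟨p, k1, k2, k3⟩ := region hq (by linarith) hqσ a b c
      exact (hzl s p (by linarith) k2 k3 (him1 s a)).1
    · intro s a b c d
      obtain ⟨p, k1, k2, k3, k4, k5, k6, k7, k8, k9⟩ := hreg s a b c d
      have := (hzl s p k2 k3 k4 (him1 s a)).2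
      rw [abs_le] at this k9 ⊢
      constructor <;> linarith [this.1, this.2, k9.1, k9.2]
  · intro s a b c d
    obtain ⟨p, k1, k2, k3, k4, k5, k6, k7, k8, k9⟩ := hreg s a b c d
    have t1 := (hzl s p k2 k3 k4 (him1 s a)).2
    have t2 := hRl' s p k1 k3 k4 (him1 s a)
    rw [abs_le] at t1 t2 ⊢
    constructor <;> linarith [t1.1, t1.2, t2.1, t2.2]
end RZ

namespace RZ
open Filter Topology Set Complex

theorem R_fin (T : ℝ) : {ρ : ℂ | RiemannR ρ = 0 ∧ 0 < ρ.im ∧ ρ.im ≤ T}.Finite := by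
  obtain ⟨σ1, hσ1, hR⟩ := R_right
  obtain ⟨P1, hP1, hRl, -⟩ := R_left
  have hnz : RiemannR (σ1 : ℂ) ≠ 0 := (near_one (hR σ1 (by simp) (by simp))).1
  set X := max |T| (P1^8) with hX
  have hX1 : |T| ≤ X := le_max_left _ _
  have hX2 : P1^8 ≤ X := le_max_right _ _
  have hP8 : (1:ℝ) ≤ P1^8 := one_le_pow₀ (by linarith)
  set B := Metric.closedBall (0:ℂ) (σ1 + X + |T|) with hB
  have hfin : {u ∈ B | RiemannR u = 0}.Finite := by
    have ha : AnalyticOnNhd ℂ RiemannR B := fun s _ => R_diff.analyticAt s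
    have h := ha.eqOn_zero_or_eventually_ne_zero_of_preconnected (convex_closedBall _ _).isPreconnected
    rcases h with h | h
    · refine absurd (h ?_) hnz
      rw [hB, mem_closedBall_zero_iff, Complex.norm_real, Real.norm_eq_abs, abs_of_nonneg (by linarith)]
      linarith [abs_nonneg T]
    · have := (isCompact_closedBall (0:ℂ) (σ1 + X + |T|)).finite_sdiff_of_mem_codiscreteWithin h
      refine this.subset ?_
      intro x hx
      exact ⟨hx.1, fun h => h hx.2⟩
  refine hfin.subset ?_
  rintro s ⟨h0, h1, h2⟩
  refine ⟨?_, h0⟩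
  have hr : s.re < σ1 := by
    by_contra hh
    exact (near_one (hR s (by linarith) h1.le)).1 h0
  have hT : |s.im| ≤ |T| := by rw [abs_of_pos h1]; exact h2.trans (le_abs_self T)
  have hl : -X < s.re := by
    by_contra hh
    push Not at hh
    obtain ⟨p, hp0, hp⟩ := exists_p s
    have a1 : -s.re ≤ ‖s‖ := (neg_le_abs _).trans (Complex.abs_re_le_norm s)
    have hpP : P1 ≤ p := by
      apply le_of_pow_le_pow_left₀ (n := 8) (by norm_num) hp0
      linarith
    refine hRl s p hpP hp ?_ h1 h0
    by_contra hx
    push Not at hx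
    have a2 := Complex.norm_le_abs_re_add_abs_im s
    rw [abs_of_nonpos (by linarith : s.re ≤ 0)] at a2
    have a3 : p^8 = p^7*p := by ring
    have a4 : 0 < p^7 := by
      have : 0 < p := by linarith
      positivity
    nlinarith
  rw [hB, mem_closedBall_zero_iff]
  have := Complex.norm_le_abs_re_add_abs_im s
  have : |s.re| ≤ σ1 + X := by
    rw [abs_le]; constructor <;> linarith
  linarith

theorem zeta_ne_of_neg {s : ℂ} (h : s.re < 0) (hi : 0 < s.im) : riemannZeta s ≠ 0 := by
  have him : (1 - s).im ≠ 0 := by simp; linarith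
  have e := riemannZeta_one_sub (s := 1 - s) (fun n hn => by
      rw [hn] at him; simp at him) (fun hn => by rw [hn] at him; simp at him)
  rw [sub_sub_cancel] at e
  rw [e]
  have hre : 1 < (1-s).re := by simp; linarith
  have hz : riemannZeta (1-s) ≠ 0 := riemannZeta_ne_zero_of_one_le_re hre.le
  have hg : Complex.Gamma (1-s) ≠ 0 := Complex.Gamma_ne_zero_of_re_pos (by linarith)
  have hc : Complex.cos (Real.pi * (1-s)/2) ≠ 0 := by
    rw [Complex.cos_ne_zero_iff]
    intro k hk
    have := congrArg Complex.im hk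
    have e1 : ((2*(k:ℂ)+1)*(Real.pi:ℂ)/2) = (((2*(k:ℝ)+1)*Real.pi/2 : ℝ) : ℂ) := by push_cast; ring
    rw [e1, Complex.ofReal_im, show (Real.pi:ℂ) * (1-s)/2 = ((Real.pi/2 : ℝ):ℂ) * (1-s) by push_cast; ring,
      Complex.im_ofReal_mul] at this
    have hpi := Real.pi_pos
    rcases mul_eq_zero.1 this with h | h
    · linarith
    · exact him h
  have hp : (2 * (Real.pi:ℂ)) ^ (-(1-s)) ≠ 0 := by
    rw [Complex.cpow_ne_zero_iff]
    left
    have := Real.pi_ne_zero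
    simpa using this
  have h2 : (2:ℂ) ≠ 0 := two_ne_zero
  simp only [ne_eq, mul_eq_zero, not_or]
  tauto

theorem zeta_fin (T : ℝ) : {ρ : ℂ | riemannZeta ρ = 0 ∧ 0 < ρ.im ∧ ρ.im ≤ T}.Finite := by
  have hc : IsCompact (Metric.closedBall (0:ℂ) (1 + |T|)) := isCompact_closedBall _ _
  refine hc.inter_riemannZetaZeros_finite.subset ?_
  rintro s ⟨h0, h1, h2⟩
  refine ⟨?_, h0⟩
  have hr : s.re < 1 := by
    by_contra hh
    exact riemannZeta_ne_zero_of_one_le_re (by linarith) h0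
  have hl : 0 ≤ s.re := by
    by_contra hh
    exact zeta_ne_of_neg (by linarith) h1 h0
  rw [mem_closedBall_zero_iff]
  have := Complex.norm_le_abs_re_add_abs_im s
  have hT : |s.im| ≤ |T| := by rw [abs_of_pos h1]; exact h2.trans (le_abs_self T)
  rw [abs_of_nonneg hl] at this
  linarith

theorem ord_eq {f g : ℂ → ℂ} {ρ : ℂ} {n : ℕ} (hf : AnalyticAt ℂ f ρ) (hg : AnalyticAt ℂ g ρ) (h0 : g ρ ≠ 0)
    (h : ∀ᶠ s in 𝓝 ρ, f s = (s - ρ)^n * g s) : analyticOrderNatAt f ρ = n := by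
  have : analyticOrderAt f ρ = n := hf.analyticOrderAt_eq_natCast.2 ⟨g, hg, h0, by simpa using h⟩
  rw [analyticOrderNatAt, this]; simp

def FF (f : ℂ → ℂ) : Prop := ∀ T : ℝ, {ρ : ℂ | f ρ = 0 ∧ 0 < ρ.im ∧ ρ.im ≤ T}.Finite

noncomputable def CN (f : ℂ → ℂ) (h : FF f) (T : ℝ) : ℝ := ∑ ρ ∈ (h T).toFinset, (analyticOrderNatAt f ρ : ℝ)

theorem CN_nonneg (f : ℂ → ℂ) (h : FF f) (T : ℝ) : 0 ≤ CN f h T := Finset.sum_nonneg fun _ _ => by positivity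

theorem CN_mono (f : ℂ → ℂ) (h : FF f) {a b : ℝ} (hab : a ≤ b) : CN f h a ≤ CN f h b := by
  apply Finset.sum_le_sum_of_subset_of_nonneg
  · intro s hs
    simp only [Finite.mem_toFinset, mem_setOf] at hs ⊢
    exact ⟨hs.1, hs.2.1, hs.2.2.trans hab⟩
  · intros; positivity

theorem CN_finsum (f : ℂ → ℂ) (h : FF f) (m : ℂ → ℕ) (T : ℝ)
    (hm : ∀ ρ, f ρ = 0 → 0 < ρ.im → analyticOrderNatAt f ρ = m ρ) :
    ∑ᶠ ρ ∈ {ρ : ℂ | f ρ = 0 ∧ 0 < ρ.im ∧ ρ.im ≤ T}, (m ρ : ℝ) = CN f h T := by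
  rw [finsum_mem_eq_finite_toFinset_sum _ (h T), CN]
  apply Finset.sum_congr rfl
  intro s hs
  simp only [Finite.mem_toFinset, mem_setOf] at hs
  rw [hm s hs.1 hs.2.1]

theorem CN_diff (f : ℂ → ℂ) (h : FF f) {T : ℝ} (hT : 0 < T) :
    ∃ Z, ZZ f T Z ∧ CN f h (2*T) - CN f h T = NN f T Z := by
  classical
  refine ⟨(h (8*T)).toFinset.filter (fun s => T/8 ≤ s.im), ?_, ?_⟩
  · intro s
    simp only [Finset.mem_filter, Finite.mem_toFinset, mem_setOf]
    constructor
    · rintro ⟨⟨a, b, c⟩, d⟩; exact ⟨a, d, c⟩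
    · rintro ⟨a, b, c⟩; exact ⟨⟨a, by linarith, c⟩, b⟩
  · rw [CN, ← Finset.sum_filter_add_sum_filter_not _ (fun s : ℂ => s.im ≤ T), CN, NN]
    have e1 : (h (2*T)).toFinset.filter (fun s : ℂ => s.im ≤ T) = (h T).toFinset := by
      ext s
      simp only [Finset.mem_filter, Finite.mem_toFinset, mem_setOf]
      constructor
      · rintro ⟨⟨a, b, c⟩, d⟩; exact ⟨a, b, d⟩
      · rintro ⟨a, b, c⟩; exact ⟨⟨a, b, by linarith⟩, c⟩
    rw [e1, add_sub_cancel_left]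
    apply Finset.sum_congr _ fun _ _ => rfl
    ext s
    simp only [Finset.mem_filter, Finite.mem_toFinset, mem_setOf, not_le]
    constructor
    · rintro ⟨⟨a, b, c⟩, d⟩; exact ⟨⟨⟨a, b, by linarith⟩, by linarith⟩, d, c⟩
    · rintro ⟨⟨⟨a, b, c⟩, d⟩, e, g⟩; exact ⟨⟨a, b, g⟩, e⟩

theorem step : ∀ ε > (0:ℝ), ∃ T1 : ℝ, 1 ≤ T1 ∧ ∀ T ≥ T1,
    |(2 * CN RiemannR R_fin (2*T) - CN riemannZeta zeta_fin (2*T)) -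
      (2 * CN RiemannR R_fin T - CN riemannZeta zeta_fin T)| ≤ ε * T := by
  intro ε hε
  obtain ⟨σ0, -, H⟩ := all_Hy
  rw [eventually_atTop] at H
  obtain ⟨q0, H⟩ := H
  set Q := max q0 (max 10000 (20/ε)) with hQ
  have hQ1 : q0 ≤ Q := le_max_left _ _
  have hQ2 : 10000 ≤ Q := (le_max_left _ _).trans (le_max_right _ _)
  have hQ3 : 20/ε ≤ Q := (le_max_right _ _).trans (le_max_right _ _)
  refine ⟨Q^64, one_le_pow₀ (by linarith), fun T hT => ?_⟩
  have hT0 : 0 < T := lt_of_lt_of_le (by positivity) hT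
  obtain ⟨q, hq0, rfl⟩ : ∃ q : ℝ, 0 ≤ q ∧ q^64 = T := by
    exact ⟨T^(((64:ℕ):ℝ)⁻¹), Real.rpow_nonneg hT0.le _, Real.rpow_inv_natCast_pow hT0.le (by norm_num)⟩
  have hqQ : Q ≤ q := le_of_pow_le_pow_left₀ (n := 64) (by norm_num) hq0 hT
  obtain ⟨H1, H2, H3⟩ := H q (by linarith)
  obtain ⟨Z, hZ, eZ⟩ := CN_diff RiemannR R_fin hT0
  obtain ⟨Zg, hZg, eZg⟩ := CN_diff riemannZeta zeta_fin hT0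
  have := count_final (by linarith) H1 H2 hZ hZg H3
  rw [← eZ, ← eZg] at this
  have e : (2 * CN RiemannR R_fin (2*q^64) - CN riemannZeta zeta_fin (2*q^64)) -
      (2 * CN RiemannR R_fin (q^64) - CN riemannZeta zeta_fin (q^64)) =
      2 * (CN RiemannR R_fin (2*q^64) - CN RiemannR R_fin (q^64)) -
        (CN riemannZeta zeta_fin (2*q^64) - CN riemannZeta zeta_fin (q^64)) := by ring
  rw [e]
  refine this.trans ?_
  have h20 : 20 ≤ ε * q := by
    have := (div_le_iff₀ hε).1 (hQ3.trans hqQ)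
    linarith
  calc 20*q^63 ≤ (ε*q)*q^63 := mul_le_mul_of_nonneg_right h20 (pow_nonneg hq0 63)
    _ = ε * q^64 := by ring

theorem dyadic (D : ℝ → ℝ) {ε T1 B : ℝ} (hT1 : 1 ≤ T1) (hs : ∀ T ≥ T1, |D (2*T) - D T| ≤ ε*T)
    (hB : ∀ T, T1 ≤ T → T ≤ 2*T1 → |D T| ≤ B) (hε : 0 < ε) : ∀ T ≥ T1, |D T| ≤ B + ε*T := by
  have key : ∀ n : ℕ, ∀ T, T1 ≤ T → T ≤ 2^(n+1)*T1 → |D T| ≤ B + ε*T := by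
    intro n
    induction n with
    | zero =>
      intro T h1 h2
      have := hB T h1 (by simpa using h2)
      have : 0 ≤ ε*T := mul_nonneg hε.le (by linarith)
      linarith
    | succ n ih =>
      intro T h1 h2
      by_cases h : T ≤ 2*T1
      · have := hB T h1 h
        have : 0 ≤ ε*T := mul_nonneg hε.le (by linarith)
        linarith
      · push Not at h
        have a := ih (T/2) (by linarith) (by rw [pow_succ] at h2; linarith)
        have b := hs (T/2) (by linarith : T1 ≤ T/2)
        rw [mul_div_cancel₀ T (two_ne_zero)] at b
        rw [abs_le] at *
        constructor <;> linarith [a.1, a.2, b.1, b.2]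
  intro T hT
  obtain ⟨n, hn⟩ := pow_unbounded_of_one_lt (T/T1) (show (1:ℝ) < 2 by norm_num)
  refine key n T hT ?_
  have h0 : 0 < T1 := by linarith
  rw [div_lt_iff₀ h0] at hn
  rw [pow_succ]
  nlinarith [show (0:ℝ) < 2^n by positivity]

theorem final_CN : ∀ ε > (0:ℝ), ∃ T0 : ℝ, ∀ T ≥ T0,
    |CN RiemannR R_fin T - (1/2) * CN riemannZeta zeta_fin T| ≤ ε*T := by
  intro ε hε
  obtain ⟨T1, hT1, hs⟩ := step ε hε
  set B := 2 * CN RiemannR R_fin (2*T1) + CN riemannZeta zeta_fin (2*T1) with hB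
  have hd := dyadic (fun T => 2 * CN RiemannR R_fin T - CN riemannZeta zeta_fin T) (B := B) hT1 hs (by
    intro T h1 h2
    have a := CN_mono RiemannR R_fin h2
    have b := CN_mono riemannZeta zeta_fin h2
    have c := CN_nonneg RiemannR R_fin T
    have d := CN_nonneg riemannZeta zeta_fin T
    rw [abs_le]
    constructor <;> linarith) hε
  refine ⟨max T1 (B/ε), fun T hT => ?_⟩
  have h1 : T1 ≤ T := (le_max_left _ _).trans hT
  have h2 : B ≤ ε*T := by
    have := (div_le_iff₀ hε).1 ((le_max_right _ _).trans hT)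
    linarith
  have := hd T h1
  simp only [abs_le] at this ⊢
  constructor <;> linarith [this.1, this.2]
end RZ

/-- If `m` gives the multiplicities of the zeros of `R` and `mζ` those of the
Riemann zeta function (both characterized by local factorizations), and
`N(T)`, `N_ζ(T)` count the respective zeros with imaginary part in `(0, T]`
with multiplicity, then `N(T) = (1/2) N_ζ(T) + o(T)` as `T → +∞`. -/
theorem countZerosR_eq_half_countZerosZeta
    (m mζ : ℂ → ℕ)
    (hm : ∀ ρ : ℂ, RiemannR ρ = 0 →
      ∃ g : ℂ → ℂ, AnalyticAt ℂ g ρ ∧ g ρ ≠ 0 ∧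
        ∀ᶠ s in nhds ρ, RiemannR s = (s - ρ) ^ (m ρ) * g s)
    (hmζ : ∀ ρ : ℂ, riemannZeta ρ = 0 → 0 < ρ.im →
      ∃ g : ℂ → ℂ, AnalyticAt ℂ g ρ ∧ g ρ ≠ 0 ∧
        ∀ᶠ s in nhds ρ, riemannZeta s = (s - ρ) ^ (mζ ρ) * g s) :
    ∀ ε > (0 : ℝ), ∃ T₀ : ℝ, ∀ T ≥ T₀,
      |(∑ᶠ ρ ∈ {ρ : ℂ | RiemannR ρ = 0 ∧ 0 < ρ.im ∧ ρ.im ≤ T}, (m ρ : ℝ)) -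
        (1 / 2) *
          ∑ᶠ ρ ∈ {ρ : ℂ | riemannZeta ρ = 0 ∧ 0 < ρ.im ∧ ρ.im ≤ T},
            (mζ ρ : ℝ)| ≤ ε * T := by
  intro ε hε
  obtain ⟨T0, h⟩ := RZ.final_CN ε hε
  refine ⟨T0, fun T hT => ?_⟩
  rw [RZ.CN_finsum RiemannR RZ.R_fin m T, RZ.CN_finsum riemannZeta RZ.zeta_fin mζ T]
  · exact h T hT
  · intro ρ h0 h1
    obtain ⟨g, a, b, c⟩ := hmζ ρ h0 h1
    refine RZ.ord_eq ?_ a b c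
    have hop : IsOpen {s : ℂ | 0 < s.im} := isOpen_lt continuous_const Complex.continuous_im
    refine DifferentiableOn.analyticOnNhd (s := {s : ℂ | 0 < s.im}) ?_ hop ρ h1
    intro s hs
    refine (differentiableAt_riemannZeta ?_).differentiableWithinAt
    rintro rfl
    simp at hs
  · intro ρ h0 _
    obtain ⟨g, a, b, c⟩ := hm ρ h0
    exact RZ.ord_eq (RZ.R_diff.analyticAt ρ) a b c
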